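/- Let D³ denote the closed unit ball in ℝ³, S² = {x ∈ ℝ³ : |x| = 1} its boundary sphere, and D² the closed unit disk in ℝ². Let X be a Hausdorff topological space with closed subsets B₁ and B₂ such that X = B₁ ∪ B₂, and suppose there are homeomorphisms h₁ : B₁ → D³ and h₂ : B₂ → D³ such that h₁(B₁ ∩ B₂) ⊆ S², h₂(B₁ ∩ B₂) ⊆ S², and B₁ ∩ B₂ is homeomorphic to D². Then X is homeomorphic to D³. -/

import Mathlib

open Set Metric Filter Topology

/-- `g` has a continuous logarithm on the set `A`. -/
def HasLogOn {X : Type*} [TopologicalSpace X] (g : X → ℂ) (A : Set X) : Prop :=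
  ∃ L : X → ℂ, ContinuousOn L A ∧ ∀ x ∈ A, Complex.exp (L x) = g x

namespace HasLogOn

variable {X Y : Type*} [TopologicalSpace X] [TopologicalSpace Y] {g h : X → ℂ} {A B : Set X}

theorem mono (hg : HasLogOn g A) (hBA : B ⊆ A) : HasLogOn g B := by
  obtain ⟨L, hL, hLg⟩ := hg
  exact ⟨L, hL.mono hBA, fun x hx => hLg x (hBA hx)⟩

theorem congr (hg : HasLogOn g A) (hgh : EqOn h g A) : HasLogOn h A := by
  obtain ⟨L, hL, hLg⟩ := hg
  exact ⟨L, hL, fun x hx => (hLg x hx).trans (hgh hx).symm⟩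

theorem mul (hg : HasLogOn g A) (hh : HasLogOn h A) : HasLogOn (fun x => g x * h x) A := by
  obtain ⟨L, hL, hLg⟩ := hg
  obtain ⟨M, hM, hMh⟩ := hh
  exact ⟨fun x => L x + M x, hL.add hM, fun x hx => by
    rw [Complex.exp_add, hLg x hx, hMh x hx]⟩

theorem inv (hg : HasLogOn g A) : HasLogOn (fun x => (g x)⁻¹) A := by
  obtain ⟨L, hL, hLg⟩ := hg
  exact ⟨fun x => -L x, hL.neg, fun x hx => by rw [Complex.exp_neg, hLg x hx]⟩

theorem div (hg : HasLogOn g A) (hh : HasLogOn h A) : HasLogOn (fun x => g x / h x) A := by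
  simpa only [div_eq_mul_inv] using hg.mul hh.inv

theorem const {c : ℂ} (hc : c ≠ 0) : HasLogOn (fun _ : X => c) A :=
  ⟨fun _ => Complex.log c, continuousOn_const, fun _ _ => Complex.exp_log hc⟩

theorem comp {B : Set Y} {f : Y → X} (hg : HasLogOn g A) (hf : ContinuousOn f B)
    (hfB : MapsTo f B A) : HasLogOn (fun y => g (f y)) B := by
  obtain ⟨L, hL, hLg⟩ := hg
  exact ⟨fun y => L (f y), hL.comp hf hfB, fun y hy => hLg _ (hfB hy)⟩

theorem of_norm_sub_one_lt (hg : ContinuousOn g A) (h1 : ∀ x ∈ A, ‖g x - 1‖ < 1) :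
    HasLogOn g A := by
  have hs : ∀ x ∈ A, g x ∈ Complex.slitPlane := fun x hx => by
    simpa using Complex.mem_slitPlane_of_norm_lt_one (h1 x hx)
  refine ⟨fun x => Complex.log (g x), hg.clog hs, fun x hx => Complex.exp_log ?_⟩
  exact Complex.slitPlane_ne_zero (hs x hx)

/-- A function close to a function with a logarithm has a logarithm. -/
theorem of_norm_sub_lt (hh : HasLogOn h A) (hg : ContinuousOn g A)
    (hgh : ∀ x ∈ A, ‖g x - h x‖ < ‖h x‖) : HasLogOn g A := by
  have h0 : ∀ x ∈ A, h x ≠ 0 := fun x hx hx0 => by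
    have := hgh x hx
    rw [hx0, norm_zero] at this
    exact absurd this (not_lt.2 (norm_nonneg _))
  have hc : ContinuousOn h A := by
    obtain ⟨L, hL, hLg⟩ := hh
    exact (Complex.continuous_exp.comp_continuousOn hL).congr fun x hx => (hLg x hx).symm
  have : HasLogOn (fun x => g x / h x) A := by
    refine of_norm_sub_one_lt (hg.div hc h0) fun x hx => ?_
    rw [div_sub_one (h0 x hx), norm_div, div_lt_one (norm_pos_iff.2 (h0 x hx))]
    exact hgh x hx
  refine (this.mul hh).congr fun x hx => ?_
  field_simp [h0 x hx]

/-- A continuous function on a connected set whose exponential is `1` is constant. -/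
theorem const_of_exp_eq (hA : IsPreconnected A) (hg : ContinuousOn g A) {c : ℂ}
    (h1 : ∀ x ∈ A, Complex.exp (g x) = c) {x y : X} (hx : x ∈ A) (hy : y ∈ A) : g x = g y := by
  have hd : IsDiscrete (range fun n : ℤ => (n : ℂ)) := by
    have := (Complex.isometry_ofReal.isEmbedding.comp Int.isClosedEmbedding_coe_real.isEmbedding)
    simpa [Function.comp_def] using this.isInducing.isDiscrete_range
  have h2 : (2 * Real.pi * Complex.I : ℂ) ≠ 0 := Complex.two_pi_I_ne_zero
  have hc : c ≠ 0 := by rw [← h1 x hx]; exact Complex.exp_ne_zero _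
  have := hA.constant_of_mapsTo hd (f := fun z => (g z - g y) / (2 * Real.pi * Complex.I))
    ((hg.sub continuousOn_const).div_const _) ?_ hx hy
  · simpa [sub_eq_zero, Real.pi_ne_zero] using this
  · intro z hz
    have : Complex.exp (g z - g y) = 1 := by
      rw [Complex.exp_sub, h1 z hz, h1 y hy, div_self hc]
    obtain ⟨n, hn⟩ := Complex.exp_eq_one_iff.1 this
    exact ⟨n, by simp only [hn]; field_simp⟩

/-- Existence of a logarithm on a compact set is invariant under deformations. -/
theorem of_homotopy {S : Set Y} (hS : IsPreconnected S) (hA : IsCompact A) {G : Y → X → ℂ}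
    (hG : ContinuousOn (fun p : Y × X => G p.1 p.2) (S ×ˢ A))
    (h0 : ∀ s ∈ S, ∀ x ∈ A, G s x ≠ 0) {s t : Y} (hs : s ∈ S) (ht : t ∈ S)
    (hlog : HasLogOn (G s) A) : HasLogOn (G t) A := by
  have hGs : ∀ s ∈ S, ContinuousOn (G s) A := fun s hs =>
    hG.comp (f := fun x => (s, x)) (by fun_prop) fun x hx => ⟨hs, hx⟩
  have key : ∀ s ∈ S, ∀ᶠ t in 𝓝 s, ∀ x ∈ A, t ∈ S → ‖G t x - G s x‖ < ‖G s x‖ ∧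
      ‖G s x - G t x‖ < ‖G t x‖ := by
    intro s hs
    have hc := hA.eventually_forall_of_forall_eventually (x₀ := s) (P := fun t x => t ∈ S → x ∈ A →
      ‖G t x - G s x‖ < ‖G s x‖ ∧ ‖G s x - G t x‖ < ‖G t x‖) ?_
    · filter_upwards [hc] with t ht x hx hts using ht x hx hts hx
    · intro x hx
      have h1 : Tendsto (fun p : Y × X => G p.1 p.2) (𝓝[S ×ˢ A] (s, x)) (𝓝 (G s x)) :=
        hG (s, x) ⟨hs, hx⟩
      have h2 : Tendsto (fun p : Y × X => G s p.2) (𝓝[S ×ˢ A] (s, x)) (𝓝 (G s x)) := by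
        have := hGs s hs x hx
        refine Tendsto.comp this ?_
        rw [nhdsWithin_prod_eq]
        exact tendsto_snd
      have hpos : 0 < ‖G s x‖ := norm_pos_iff.2 (h0 s hs x hx)
      have := ((h1.sub h2).norm.eventually_lt h2.norm (by simpa using hpos)).and
        ((h2.sub h1).norm.eventually_lt h1.norm (by simpa using hpos))
      rw [eventually_nhdsWithin_iff] at this
      filter_upwards [this] with p hp h1 h2 using hp ⟨h1, h2⟩
  have hloc : ∀ s ∈ S, ∀ᶠ t in 𝓝[S] s, HasLogOn (G s) A ↔ HasLogOn (G t) A := by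
    intro s hs
    rw [eventually_nhdsWithin_iff]
    filter_upwards [key s hs] with t ht hts
    exact ⟨fun h => h.of_norm_sub_lt (hGs t hts) fun x hx => (ht x hx hts).1,
      fun h => h.of_norm_sub_lt (hGs s hs) fun x hx => (ht x hx hts).2⟩
  exact (hS.induction₂ (fun s t => HasLogOn (G s) A ↔ HasLogOn (G t) A) hloc
    (fun _ _ _ _ _ _ => Iff.trans) (fun _ _ _ _ => Iff.symm) hs ht).1 hlog

/-- Logarithms on two closed sets with connected intersection can be glued. -/
theorem union (hA : IsClosed A) (hB : IsClosed B) (hAB : IsPreconnected (A ∩ B))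
    (hgA : HasLogOn g A) (hgB : HasLogOn g B) : HasLogOn g (A ∪ B) := by
  classical
  obtain ⟨L, hL, hLg⟩ := hgA
  obtain ⟨M, hM, hMg⟩ := hgB
  have hexp : ∀ x ∈ A ∩ B, Complex.exp (L x - M x) = 1 := fun x hx => by
    rw [Complex.exp_sub, hLg x hx.1, hMg x hx.2, div_self]
    rw [← hLg x hx.1]
    exact Complex.exp_ne_zero _
  obtain ⟨c, hc1, hc⟩ : ∃ c : ℂ, Complex.exp c = 1 ∧ ∀ x ∈ A ∩ B, L x = M x + c := by
    rcases (A ∩ B).eq_empty_or_nonempty with he | ⟨x₀, hx₀⟩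
    · exact ⟨0, by simp, by simp [he]⟩
    · refine ⟨L x₀ - M x₀, hexp x₀ hx₀, fun x hx => ?_⟩
      have := const_of_exp_eq hAB ((hL.mono inter_subset_left).sub (hM.mono inter_subset_right))
        hexp hx hx₀
      simp only [Pi.sub_apply] at this
      rw [← this]; ring
  refine ⟨fun x => if x ∈ A then L x else M x + c, ?_, ?_⟩
  · refine ContinuousOn.union_of_isClosed (hL.congr fun x hx => if_pos hx)
      ((hM.add continuousOn_const).congr (f := fun x => M x + c) fun x hx => ?_) hA hB
    by_cases hxA : x ∈ A
    · simp only [if_pos hxA, hc x ⟨hxA, hx⟩]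
    · simp only [if_neg hxA]
  · intro x hx
    by_cases hxA : x ∈ A
    · simp only [if_pos hxA, hLg x hxA]
    · simp only [if_neg hxA, Complex.exp_add, hc1, mul_one, hMg x (hx.resolve_left hxA)]

theorem closedBall {g : ℂ → ℂ} {c : ℂ} {r : ℝ} (hg : ContinuousOn g (closedBall c r))
    (h0 : ∀ z ∈ Metric.closedBall c r, g z ≠ 0) : HasLogOn g (Metric.closedBall c r) := by
  rcases lt_or_ge r 0 with hr | hr
  · exact ⟨0, by simp [Metric.closedBall_eq_empty.2 hr], by simp [Metric.closedBall_eq_empty.2 hr]⟩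
  have hmaps : ∀ t ∈ Icc (0 : ℝ) 1, ∀ z ∈ Metric.closedBall c r,
      c + t * (z - c) ∈ Metric.closedBall c r := by
    intro t ht z hz
    rw [mem_closedBall, dist_eq_norm] at hz ⊢
    rw [add_sub_cancel_left, norm_mul, Complex.norm_real, Real.norm_of_nonneg ht.1]
    nlinarith [ht.1, ht.2, norm_nonneg (z - c)]
  have := of_homotopy (S := Icc (0 : ℝ) 1) (A := Metric.closedBall c r)
    (G := fun t z => g (c + t * (z - c))) isPreconnected_Icc
    (isCompact_closedBall c r) ?_ (fun t ht z hz => h0 _ (hmaps t ht z hz))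
    (s := 0) (t := 1) (by simp) (by simp) ?_
  · exact this.congr fun z hz => by simp
  · refine hg.comp (f := fun p : ℝ × ℂ => c + p.1 * (p.2 - c)) (by fun_prop) ?_
    rintro ⟨t, z⟩ ⟨ht, hz⟩
    exact hmaps t ht z hz
  · simpa using HasLogOn.const (h0 c (mem_closedBall_self hr))

end HasLogOn

/-- An odd function on a circle has no logarithm. -/
theorem not_hasLogOn_of_odd {g : ℂ → ℂ} {r : ℝ} (hr : 0 ≤ r)
    (hg : ∀ z ∈ sphere (0 : ℂ) r, g (-z) = -g z) : ¬ HasLogOn g (sphere 0 r) := by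
  rintro ⟨L, hL, hLg⟩
  have hneg : ∀ z ∈ sphere (0 : ℂ) r, -z ∈ sphere (0 : ℂ) r := fun z hz => by simpa using hz
  have hL' : ContinuousOn (fun z => L (-z)) (sphere 0 r) :=
    hL.comp (by fun_prop) hneg
  have hD := hL'.sub hL
  obtain ⟨z, hz⟩ : (sphere (0 : ℂ) r).Nonempty := NormedSpace.sphere_nonempty.2 hr
  have h1 : ∀ z ∈ sphere (0 : ℂ) r, Complex.exp (L (-z) - L z) = -1 := by
    intro z hz
    have hne : g z ≠ 0 := by rw [← hLg z hz]; exact Complex.exp_ne_zero _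
    rw [Complex.exp_sub, hLg z hz, hLg _ (hneg z hz), hg z hz, neg_div, div_self hne]
  have hconn : IsPreconnected (sphere (0 : ℂ) r) :=
    isPreconnected_sphere (by simp [Complex.rank_real_complex]) 0 r
  have h2 := HasLogOn.const_of_exp_eq hconn hD h1 hz (hneg z hz)
  simp only [Pi.sub_apply, neg_neg] at h2
  have h3 : L (-z) - L z = 0 := by linear_combination h2 / 2
  have := h1 z hz
  rw [h3, Complex.exp_zero] at this
  norm_num at this

theorem not_hasLogOn_sub_sphere (p : ℂ) {r : ℝ} (hr : 0 ≤ r) :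
    ¬ HasLogOn (fun z => z - p) (sphere p r) := by
  intro h
  refine not_hasLogOn_of_odd (g := fun z => z) hr (fun _ _ => rfl) ?_
  have := h.comp (f := fun z => z + p) (B := sphere 0 r) (by fun_prop) fun z hz => by simpa using hz
  simpa using this

theorem isPreconnected_compl_closedBall_complex (c : ℂ) (r : ℝ) :
    IsPreconnected (closedBall c r)ᶜ := by
  rcases lt_or_ge r 0 with hr | hr
  · rw [closedBall_eq_empty.2 hr, compl_empty]
    exact isPreconnected_univ
  have : (closedBall c r)ᶜ = (fun p : ℝ × ℂ => c + p.1 * p.2) '' (Ioi r ×ˢ sphere 0 1) := by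
    ext z
    simp only [mem_compl_iff, mem_closedBall, not_le, mem_image, Prod.exists, mem_prod, mem_Ioi,
      mem_sphere, dist_zero_right]
    constructor
    · intro hz
      rw [dist_eq_norm] at hz
      have h0 : (‖z - c‖ : ℂ) ≠ 0 := by
        rw [Complex.ofReal_ne_zero]; exact (hr.trans_lt hz).ne'
      refine ⟨‖z - c‖, (z - c) / ‖z - c‖, ⟨hz, ?_⟩, ?_⟩
      · rw [norm_div, Complex.norm_real, norm_norm, div_self (by exact_mod_cast h0)]
      · field_simp; ring
    · rintro ⟨a, b, ⟨ha, hb⟩, rfl⟩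
      rw [dist_eq_norm, add_sub_cancel_left, norm_mul, hb, mul_one, Complex.norm_real]
      exact ha.trans_le (le_abs_self a)
  rw [this]
  exact (isPreconnected_Ioi.prod (isPreconnected_sphere
    (by simp [Complex.rank_real_complex]) 0 1)).image _ (by fun_prop)

theorem frontier_connectedComponentIn_subset {X : Type*} [TopologicalSpace X]
    [LocallyConnectedSpace X] {A : Set X} (hA : IsClosed A) (p : X) :
    frontier (connectedComponentIn Aᶜ p) ⊆ A := by
  intro z hz
  by_contra hzA
  have hV : IsOpen (connectedComponentIn Aᶜ p) := hA.isOpen_compl.connectedComponentIn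
  have hz' : z ∈ closure (connectedComponentIn Aᶜ p) := frontier_subset_closure hz
  have hW : IsOpen (connectedComponentIn Aᶜ z) := hA.isOpen_compl.connectedComponentIn
  have hzW : z ∈ connectedComponentIn Aᶜ z := mem_connectedComponentIn hzA
  obtain ⟨y, hyW, hyV⟩ := mem_closure_iff.1 hz' _ hW hzW
  have h1 := connectedComponentIn_eq hyW
  have h2 := connectedComponentIn_eq hyV
  rw [hV.frontier_eq] at hz
  exact hz.2 (h2 ▸ h1 ▸ hzW)

private theorem mem_component_of_bounded {A : Set ℂ} (hA : IsCompact A) {p q : ℂ} (hp : p ∉ A)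
    (hq : q ∉ A) (hlog : HasLogOn (fun w => (w - p) / (w - q)) A)
    (hb : Bornology.IsBounded (connectedComponentIn Aᶜ p)) : q ∈ connectedComponentIn Aᶜ p := by
  classical
  by_contra hqV
  set V := connectedComponentIn Aᶜ p with hV
  have hVo : IsOpen V := hA.isClosed.isOpen_compl.connectedComponentIn
  have hpV : p ∈ V := mem_connectedComponentIn hp
  have hfr : frontier V ⊆ A := frontier_connectedComponentIn_subset hA.isClosed p
  have hcl : closure V ⊆ V ∪ A := fun z hz => by
    by_cases h : z ∈ V
    · exact Or.inl h
    · exact Or.inr (hfr (by rw [hVo.frontier_eq]; exact ⟨hz, h⟩))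
  obtain ⟨L, hL, hLg⟩ := hlog
  obtain ⟨M, hM⟩ := ContinuousMap.exists_restrict_eq hA.isClosed
    (⟨A.domRestrict L, hL.domRestrict⟩ : C(A, ℂ))
  have hMA : ∀ z ∈ A, M z = L z := fun z hz => congrArg (fun f => f ⟨z, hz⟩) hM
  have hqA : ∀ z ∈ closure V, z - q ≠ 0 := fun z hz h => by
    rw [sub_eq_zero] at h
    subst h
    exact (hcl hz).elim hqV hq
  let G : ℂ → ℂ := fun z => if z ∈ V then (z - q) * Complex.exp (M z) else z - p
  have hG : Continuous G := by
    refine Continuous.if (fun z hz => ?_) (by fun_prop) (by fun_prop)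
    have hzA : z ∈ A := hfr hz
    rw [hMA z hzA, hLg z hzA, mul_div_cancel₀]
    exact hqA z (frontier_subset_closure hz)
  have hG0 : ∀ z, G z ≠ 0 := by
    intro z
    by_cases hz : z ∈ V
    · simp only [G, if_pos hz]
      exact mul_ne_zero (hqA z (subset_closure hz)) (Complex.exp_ne_zero _)
    · simp only [G, if_neg hz]
      rw [sub_ne_zero]
      rintro rfl
      exact hz hpV
  obtain ⟨r, hr⟩ := hb.subset_ball p
  have hr0 : 0 ≤ r := dist_nonneg.trans (mem_ball.1 (hr hpV)).le
  have := HasLogOn.closedBall (c := p) (r := r) hG.continuousOn fun z _ => hG0 z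
  refine not_hasLogOn_sub_sphere p hr0 ((this.mono sphere_subset_closedBall).congr fun z hz => ?_)
  have : z ∉ V := fun h => (mem_ball.1 (hr h)).ne (mem_sphere.1 hz)
  simp only [G, if_neg this]

/-- Two points outside a compact set `A` are not separated by `A` as soon as the function
`(w - p) / (w - q)` has a logarithm on `A`. -/
theorem mem_connectedComponentIn_compl_of_hasLogOn {A : Set ℂ} (hA : IsCompact A) {p q : ℂ}
    (hp : p ∉ A) (hq : q ∉ A) (hlog : HasLogOn (fun w => (w - p) / (w - q)) A) :
    q ∈ connectedComponentIn Aᶜ p := by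
  by_cases hb : Bornology.IsBounded (connectedComponentIn Aᶜ p)
  · exact mem_component_of_bounded hA hp hq hlog hb
  by_cases hb' : Bornology.IsBounded (connectedComponentIn Aᶜ q)
  · have := mem_component_of_bounded hA hq hp (hlog.inv.congr fun w _ => (inv_div _ _).symm) hb'
    rw [← connectedComponentIn_eq this]
    exact mem_connectedComponentIn hq
  obtain ⟨R, hR⟩ := hA.isBounded.subset_closedBall 0
  have key : ∀ p, ¬ Bornology.IsBounded (connectedComponentIn Aᶜ p) →
      ∃ y, y ∈ connectedComponentIn Aᶜ p ∧ y ∈ (closedBall (0 : ℂ) R)ᶜ := by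
    intro p hp
    by_contra! h
    exact hp (isBounded_closedBall.subset fun y hy => not_not.1 (h y hy))
  obtain ⟨y, hyp, hyR⟩ := key p hb
  obtain ⟨z, hzq, hzR⟩ := key q hb'
  have h1 : (closedBall (0 : ℂ) R)ᶜ ⊆ connectedComponentIn Aᶜ y :=
    (isPreconnected_compl_closedBall_complex 0 R).subset_connectedComponentIn hyR
      (compl_subset_compl.2 hR)
  rw [connectedComponentIn_eq hyp, connectedComponentIn_eq (h1 hzR), ← connectedComponentIn_eq hzq]
  exact mem_connectedComponentIn hq

theorem hasLogOn_of_isPreconnected {A S : Set ℂ} (hA : IsCompact A) (hS : IsPreconnected S)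
    (hSA : Disjoint S A) {p q : ℂ} (hp : p ∈ S) (hq : q ∈ S) :
    HasLogOn (fun w => (w - p) / (w - q)) A := by
  have hne : ∀ s ∈ S, ∀ w ∈ A, w - s ≠ 0 := fun s hs w hw h => by
    rw [sub_eq_zero] at h
    exact hSA.ne_of_mem hs hw h.symm
  refine HasLogOn.of_homotopy hS hA (G := fun s w => (w - s) / (w - q)) ?_
    (fun s hs w hw => div_ne_zero (hne s hs w hw) (hne q hq w hw)) hq hp ?_
  · refine ContinuousOn.div (by fun_prop) (by fun_prop) fun x hx => hne q hq _ hx.2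
  · exact (HasLogOn.const one_ne_zero).congr fun w hw => div_self (hne q hq w hw)

/-- **Janiszewski's theorem**: if two points are separated neither by `A` nor by `B`, and
`A ∩ B` is connected, then they are not separated by `A ∪ B`. -/
theorem exists_isPreconnected_of_union {A B S T : Set ℂ} (hA : IsCompact A) (hB : IsCompact B)
    (hAB : IsPreconnected (A ∩ B)) (hS : IsPreconnected S) (hSA : Disjoint S A)
    (hT : IsPreconnected T) (hTB : Disjoint T B) {p q : ℂ} (hpS : p ∈ S) (hqS : q ∈ S)
    (hpT : p ∈ T) (hqT : q ∈ T) :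
    ∃ W, IsPreconnected W ∧ Disjoint W (A ∪ B) ∧ p ∈ W ∧ q ∈ W := by
  have hn : ∀ x ∈ S, x ∈ T → x ∉ A ∪ B := fun x hS hT h =>
    h.elim (fun h => hSA.ne_of_mem hS h rfl) fun h => hTB.ne_of_mem hT h rfl
  refine ⟨connectedComponentIn (A ∪ B)ᶜ p, isPreconnected_connectedComponentIn,
    disjoint_left.2 fun x hx => connectedComponentIn_subset _ _ hx,
    mem_connectedComponentIn (hn p hpS hpT), ?_⟩
  exact mem_connectedComponentIn_compl_of_hasLogOn (hA.union hB) (hn p hpS hpT) (hn q hqS hqT)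
    ((hasLogOn_of_isPreconnected hA hS hSA hpS hqS).union hA.isClosed hB.isClosed hAB
      (hasLogOn_of_isPreconnected hB hT hTB hpT hqT))

theorem HasLogOn.image_of_injOn {X : Type*} [TopologicalSpace X] {A : Set X} (hA : IsCompact A)
    {f : X → ℂ} (hf : ContinuousOn f A) (hi : InjOn f A) {g : ℂ → ℂ}
    (hg : HasLogOn (fun x => g (f x)) A) : HasLogOn g (f '' A) := by
  obtain ⟨L, hL, hLg⟩ := hg
  rcases A.eq_empty_or_nonempty with rfl | ⟨a, ha⟩
  · exact ⟨0, by simp, by simp⟩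
  have : Nonempty X := ⟨a⟩
  have hinv : ContinuousOn (Function.invFunOn f A) (f '' A) := by
    have := isCompact_iff_compactSpace.1 hA
    have he : IsClosedEmbedding (A.domRestrict f) :=
      hf.domRestrict.isClosedEmbedding (injOn_iff_injective.1 hi)
    rw [continuousOn_iff_continuous_domRestrict]
    have h1 : Continuous fun y : f '' A =>
        (⟨Function.invFunOn f A y, Function.invFunOn_mem y.2⟩ : A) := by
      rw [he.isInducing.continuous_iff]
      exact continuous_subtype_val.congr fun y => (Function.invFunOn_eq y.2).symm
    exact continuous_subtype_val.comp h1
  refine ⟨fun y => L (Function.invFunOn f A y), hL.comp hinv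
    fun y hy => Function.invFunOn_mem hy, fun y hy => ?_⟩
  rw [hLg _ (Function.invFunOn_mem hy)]
  exact congrArg g (Function.invFunOn_eq hy)

/-- The complement of an embedded closed disc in the plane is connected. -/
theorem isPreconnected_compl_image_closedBall {c : ℂ} {r : ℝ} {f : ℂ → ℂ}
    (hf : ContinuousOn f (closedBall c r)) (hi : InjOn f (closedBall c r)) :
    IsPreconnected (f '' closedBall c r)ᶜ := by
  have hA : IsCompact (f '' closedBall c r) := (isCompact_closedBall c r).image_of_continuousOn hf
  refine isPreconnected_of_forall_pair fun p hp q hq => ⟨_, connectedComponentIn_subset _ p,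
    mem_connectedComponentIn hp, ?_, isPreconnected_connectedComponentIn⟩
  refine mem_connectedComponentIn_compl_of_hasLogOn hA hp hq
    (HasLogOn.image_of_injOn (isCompact_closedBall c r) hf hi ?_)
  have hne : ∀ p ∉ f '' closedBall c r, ∀ z ∈ closedBall c r, f z - p ≠ 0 := fun p hp z hz h =>
    hp ⟨z, hz, sub_eq_zero.1 h⟩
  exact HasLogOn.closedBall ((hf.sub continuousOn_const).div (hf.sub continuousOn_const) (hne q hq))
    fun z hz => div_ne_zero (hne p hp z hz) (hne q hq z hz)

theorem not_hasLogOn_sub_center {r : ℝ} (hr : 0 < r) {f : ℂ → ℂ}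
    (hf : ContinuousOn f (closedBall 0 r)) (hi : InjOn f (closedBall 0 r)) :
    ¬ HasLogOn (fun z => f z - f 0) (sphere 0 r) := by
  intro h
  have hm1 : ∀ t ∈ Icc (0 : ℝ) 1, ∀ z ∈ sphere (0 : ℂ) r,
      z / (1 + t : ℝ) ∈ closedBall (0 : ℂ) r := by
    intro t ht z hz
    rw [mem_sphere, dist_zero_right] at hz
    rw [mem_closedBall, dist_zero_right, norm_div, hz, Complex.norm_real,
      Real.norm_of_nonneg (by linarith [ht.1])]
    exact div_le_self hr.le (by linarith [ht.1])
  have hm2 : ∀ t ∈ Icc (0 : ℝ) 1, ∀ z ∈ sphere (0 : ℂ) r,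
      -(t * z) / (1 + t : ℝ) ∈ closedBall (0 : ℂ) r := by
    intro t ht z hz
    rw [mem_sphere, dist_zero_right] at hz
    rw [mem_closedBall, dist_zero_right, norm_div, norm_neg, norm_mul, hz, Complex.norm_real,
      Complex.norm_real, Real.norm_of_nonneg ht.1,
      Real.norm_of_nonneg (show (0 : ℝ) ≤ 1 + t by linarith [ht.1]),
      div_le_iff₀ (by linarith [ht.1])]
    nlinarith [ht.1, ht.2]
  have hpos : ∀ t ∈ Icc (0 : ℝ) 1, ((1 + t : ℝ) : ℂ) ≠ 0 := fun t ht => by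
    rw [Complex.ofReal_ne_zero]; linarith [ht.1]
  have := HasLogOn.of_homotopy (S := Icc (0 : ℝ) 1) isPreconnected_Icc (isCompact_sphere (0 : ℂ) r)
    (G := fun t z => f (z / (1 + t : ℝ)) - f (-(t * z) / (1 + t : ℝ))) ?_ ?_
    (s := 0) (t := 1) (by simp) (by simp) ?_
  · refine not_hasLogOn_of_odd hr.le (fun z _ => ?_) this
    have h1 : -z / ((1 + 1 : ℝ) : ℂ) = -(((1 : ℝ) : ℂ) * z) / ((1 + 1 : ℝ) : ℂ) := by simp
    have h2 : -(((1 : ℝ) : ℂ) * -z) / ((1 + 1 : ℝ) : ℂ) = z / ((1 + 1 : ℝ) : ℂ) := by simp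
    rw [h1, h2, neg_sub]
  · refine ContinuousOn.sub
      (hf.comp (f := fun p : ℝ × ℂ => p.2 / (1 + p.1 : ℝ)) ?_ fun p hp => hm1 _ hp.1 _ hp.2)
      (hf.comp (f := fun p : ℝ × ℂ => -(p.1 * p.2) / (1 + p.1 : ℝ)) ?_
        fun p hp => hm2 _ hp.1 _ hp.2)
    · exact ContinuousOn.div (by fun_prop) (by fun_prop) fun p hp => hpos _ hp.1
    · exact ContinuousOn.div (by fun_prop) (by fun_prop) fun p hp => hpos _ hp.1
  · intro t ht z hz h0
    have := hi (hm1 t ht z hz) (hm2 t ht z hz) (sub_eq_zero.1 h0)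
    rw [div_left_inj' (hpos t ht)] at this
    have h3 : ((1 + t : ℝ) : ℂ) * z = 0 := by push_cast; linear_combination this
    rcases mul_eq_zero.1 h3 with h | h
    · exact hpos t ht h
    · rw [h] at hz
      simp at hz
      exact hr.ne hz
  · simpa using h

theorem mem_interior_image_closedBall {r : ℝ} (hr : 0 < r) {f : ℂ → ℂ}
    (hf : ContinuousOn f (closedBall 0 r)) (hi : InjOn f (closedBall 0 r)) :
    f 0 ∈ interior (f '' closedBall 0 r) := by
  have hK : IsCompact (f '' sphere 0 r) :=
    (isCompact_sphere (0 : ℂ) r).image_of_continuousOn (hf.mono sphere_subset_closedBall)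
  have h0 : f 0 ∉ f '' sphere 0 r := by
    rintro ⟨z, hz, hz0⟩
    have := hi (sphere_subset_closedBall hz) (by simp [hr.le]) hz0
    subst this
    simp at hz
    exact hr.ne hz
  obtain ⟨ε, hε, hball⟩ := Metric.isOpen_iff.1 hK.isClosed.isOpen_compl _ h0
  rw [mem_interior]
  refine ⟨ball (f 0) ε, fun q hq => ?_, isOpen_ball, mem_ball_self hε⟩
  by_contra hqA
  refine not_hasLogOn_sub_center hr hf hi ?_
  have h1 : HasLogOn (fun z => f z - q) (sphere 0 r) :=
    (HasLogOn.closedBall (hf.sub continuousOn_const) fun z hz h =>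
      hqA ⟨z, hz, sub_eq_zero.1 h⟩).mono sphere_subset_closedBall
  have h2 : HasLogOn (fun w => (w - f 0) / (w - q)) (f '' sphere 0 r) :=
    hasLogOn_of_isPreconnected hK (convex_ball (f 0) ε).isPreconnected
      (disjoint_left.2 fun x hx => hball hx) (mem_ball_self hε) hq
  refine ((h2.comp (hf.mono sphere_subset_closedBall) (mapsTo_image f _)).mul h1).congr
    fun z hz => ?_
  refine (div_mul_cancel₀ _ ?_).symm
  intro h
  exact hqA ⟨z, sphere_subset_closedBall hz, sub_eq_zero.1 h⟩

/-- **Invariance of domain** in the plane, for closed discs. -/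
theorem image_ball_subset_interior {c : ℂ} {r : ℝ} {f : ℂ → ℂ}
    (hf : ContinuousOn f (closedBall c r)) (hi : InjOn f (closedBall c r)) :
    f '' ball c r ⊆ interior (f '' closedBall c r) := by
  rintro _ ⟨z, hz, rfl⟩
  have hs : 0 < r - dist z c := sub_pos.2 hz
  have hsub : closedBall z (r - dist z c) ⊆ closedBall c r :=
    closedBall_subset_closedBall' (by simp)
  have hm : MapsTo (fun w => z + w) (closedBall 0 (r - dist z c)) (closedBall z (r - dist z c)) :=
    fun w hw => by simpa using hw
  have := mem_interior_image_closedBall hs (f := fun w => f (z + w))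
    (hf.comp (by fun_prop) (hm.mono_right hsub))
    (fun a ha b hb hab => by simpa using hi (hsub (hm ha)) (hsub (hm hb)) hab)
  rw [add_zero] at this
  refine interior_mono ?_ this
  rintro _ ⟨w, hw, rfl⟩
  exact ⟨_, hsub (hm hw), rfl⟩

open MeasureTheory in
/-- **Pompeiu's formula** for compactly supported functions, at the origin. -/
theorem integral_dbar_div_self {u : ℂ → ℂ} (hu : ContDiff ℝ 1 u) (hc : HasCompactSupport u) :
    ∫ w : ℂ, (fderiv ℝ u w 1 + Complex.I * fderiv ℝ u w Complex.I) / w = -(2 * Real.pi) * u 0 := by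
  set e : ℝ → ℂ := fun θ => Real.cos θ + Real.sin θ * Complex.I with he
  set e' : ℝ → ℂ := fun θ => -Real.sin θ + Real.cos θ * Complex.I with he'
  have hec : Continuous e := by fun_prop
  have hec' : Continuous e' := by fun_prop
  have hd : ∀ θ, HasDerivAt e (e' θ) θ := fun θ => by
    have h1 := (Real.hasDerivAt_cos θ).ofReal_comp
    have h2 := (Real.hasDerivAt_sin θ).ofReal_comp
    exact (h1.add (h2.mul_const Complex.I)).congr_deriv (by simp [e'])
  have hcs : ∀ θ : ℝ, (Real.cos θ : ℂ) * Real.cos θ + Real.sin θ * Real.sin θ = 1 := fun θ => by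
    have := Real.cos_sq_add_sin_sq θ
    rw [sq, sq] at this
    exact_mod_cast this
  have he0 : ∀ θ, e θ ≠ 0 := fun θ h => by
    have h2 : e θ * (Real.cos θ - Real.sin θ * Complex.I) = 1 := by
      rw [← hcs θ, he]
      linear_combination (-Real.sin θ * Real.sin θ) * Complex.I_mul_I
    rw [h, zero_mul] at h2
    exact zero_ne_one h2
  have hen : ∀ θ, ‖e θ‖ = 1 := fun θ => by
    rw [he]; simp only [Complex.norm_add_mul_I]
    simp
  have huD : Differentiable ℝ u := hu.differentiable one_ne_zero
  have hfc : Continuous (fderiv ℝ u) := hu.continuous_fderiv one_ne_zero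
  obtain ⟨R, hR⟩ := hc.isCompact.isBounded.subset_closedBall 0
  have hsupp : ∀ w : ℂ, R < ‖w‖ → fderiv ℝ u w = 0 := fun w hw => by
    by_contra h
    have := hR (support_fderiv_subset ℝ (f := u) h)
    rw [mem_closedBall, dist_zero_right] at this
    exact this.not_gt hw
  set a : ℝ × ℝ → ℂ := fun p => fderiv ℝ u (p.1 * e p.2) (e p.2) with ha
  set b : ℝ × ℝ → ℂ := fun p => fderiv ℝ u (p.1 * e p.2) (e' p.2) with hb
  have hac : Continuous a := (hfc.comp (by fun_prop)).clm_apply (by fun_prop)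
  have hbc : Continuous b := (hfc.comp (by fun_prop)).clm_apply (by fun_prop)
  have h_int : ∀ c : ℝ × ℝ → ℂ, Continuous c → (∀ p, R < p.1 → 0 < p.1 → c p = 0) →
      IntegrableOn c (Ioi (0 : ℝ) ×ˢ Ioo (-Real.pi) Real.pi) := by
    intro c hcc hc0
    have h1 : IntegrableOn c (Icc 0 R ×ˢ Icc (-Real.pi) Real.pi) :=
      hcc.continuousOn.integrableOn_compact (isCompact_Icc.prod isCompact_Icc)
    refine h1.of_forall_sdiff_eq_zero (measurableSet_Ioi.prod measurableSet_Ioo) ?_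
    rintro p ⟨⟨h1, h2⟩, h3⟩
    refine hc0 p ?_ h1
    by_contra h4
    exact h3 ⟨⟨(mem_Ioi.1 h1).le, not_lt.1 h4⟩, Ioo_subset_Icc_self h2⟩
  have hzero : ∀ p : ℝ × ℝ, R < p.1 → 0 < p.1 → fderiv ℝ u (p.1 * e p.2) = 0 := by
    intro p h1 h2
    refine hsupp _ ?_
    rwa [norm_mul, hen, mul_one, Complex.norm_real, Real.norm_of_nonneg h2.le]
  have hai := h_int a hac fun p h1 h2 => by simp [a, hzero p h1 h2]
  have hbi := h_int b hbc fun p h1 h2 => by simp [b, hzero p h1 h2]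
  have hpi : -Real.pi ≤ Real.pi := by linarith [Real.pi_pos]
  have hIa : ∫ p in Ioi (0 : ℝ) ×ˢ Ioo (-Real.pi) Real.pi, a p = -(2 * Real.pi) * u 0 := by
    have : ∀ θ, ∫ r in Ioi (0 : ℝ), a (r, θ) = -u 0 := fun θ => by
      have h1 : ∀ r : ℝ, HasDerivAt (fun r : ℝ => u (r * e θ)) (a (r, θ)) r := fun r => by
        have h2 : HasDerivAt (fun r : ℝ => (r : ℂ) * e θ) (e θ) r := by
          simpa using (Complex.ofRealCLM.hasDerivAt (x := r)).mul_const (e θ)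
        exact (huD (r * e θ)).hasFDerivAt.comp_hasDerivAt r h2
      have h3 : HasCompactSupport fun r : ℝ => u (r * e θ) := by
        refine HasCompactSupport.intro (isCompact_closedBall 0 R) fun r hr => ?_
        by_contra h
        have := hR (subset_tsupport _ h)
        rw [mem_closedBall, dist_zero_right, norm_mul, hen, mul_one, Complex.norm_real] at this
        exact hr (by simpa using this)
      have h4 : ContDiff ℝ 1 fun r : ℝ => u (r * e θ) :=
        hu.comp (Complex.ofRealCLM.contDiff.mul contDiff_const)
      have := h3.integral_Ioi_deriv_eq h4 0
      rw [← (by simp : u ((0 : ℝ) * e θ) = u 0), ← this]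
      exact integral_congr_ae (Eventually.of_forall fun r => (h1 r).deriv.symm)
    rw [Measure.volume_eq_prod, ← setIntegral_prod_swap, setIntegral_prod]
    · simp only [Prod.swap_prod_mk, this]
      simp only [integral_const, MeasurableSet.univ, measureReal_restrict_apply, univ_inter,
        Real.volume_real_Ioo_of_le hpi, Complex.real_smul]
      push_cast; ring
    · rw [← Measure.volume_eq_prod]
      exact hai.swap
  have hIb : ∫ p in Ioi (0 : ℝ) ×ˢ Ioo (-Real.pi) Real.pi, b p = 0 := by
    have : ∀ r ∈ Ioi (0 : ℝ), ∫ θ in Ioo (-Real.pi) Real.pi, b (r, θ) = 0 := fun r hr => by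
      have h1 : ∀ θ : ℝ, HasDerivAt (fun θ : ℝ => (r : ℂ)⁻¹ * u (r * e θ)) (b (r, θ)) θ :=
          fun θ => by
        have h2 : HasDerivAt (fun θ : ℝ => (r : ℂ) * e θ) (r * e' θ) θ := (hd θ).const_mul _
        have h3 := ((huD (r * e θ)).hasFDerivAt.comp_hasDerivAt θ h2).const_mul (r : ℂ)⁻¹
        refine h3.congr_deriv ?_
        have h4 : fderiv ℝ u (r * e θ) (r * e' θ) = r * fderiv ℝ u (r * e θ) (e' θ) := by
          have := (fderiv ℝ u (r * e θ)).map_smul r (e' θ)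
          simpa only [Complex.real_smul] using this
        rw [h4, ← mul_assoc, inv_mul_cancel₀, one_mul]
        exact_mod_cast (mem_Ioi.1 hr).ne'
      rw [← integral_Ioc_eq_integral_Ioo, ← intervalIntegral.integral_of_le hpi,
        intervalIntegral.integral_eq_sub_of_hasDerivAt (fun θ _ => h1 θ)
          (Continuous.intervalIntegrable (by fun_prop) _ _)]
      simp [e]
    rw [Measure.volume_eq_prod, setIntegral_prod _ hbi,
      setIntegral_congr_fun measurableSet_Ioi this]
    simp
  rw [← Complex.integral_comp_polarCoord_symm, polarCoord_target]
  have : ∀ p ∈ Ioi (0 : ℝ) ×ˢ Ioo (-Real.pi) Real.pi,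
      p.1 • ((fderiv ℝ u (Complex.polarCoord.symm p) 1 + Complex.I * fderiv ℝ u
        (Complex.polarCoord.symm p) Complex.I) / Complex.polarCoord.symm p)
      = a p + Complex.I * b p := by
    rintro ⟨r, θ⟩ ⟨hr, -⟩
    have hr : (r : ℂ) ≠ 0 := by exact_mod_cast (mem_Ioi.1 hr).ne'
    have h1 : Complex.polarCoord.symm (r, θ) = r * e θ := by rw [Complex.polarCoord_symm_apply]
    have hlin : ∀ x y : ℝ, fderiv ℝ u (r * e θ) (x + y * Complex.I) =
        x * fderiv ℝ u (r * e θ) 1 + y * fderiv ℝ u (r * e θ) Complex.I := fun x y => by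
      have : (x + y * Complex.I : ℂ) = x • (1 : ℂ) + y • Complex.I := by simp
      rw [this, map_add, map_smul, map_smul, Complex.real_smul, Complex.real_smul]
    rw [h1, Complex.real_smul]
    simp only [a, b]
    rw [show fderiv ℝ u (r * e θ) (e θ) = _ from hlin _ _,
      show fderiv ℝ u (r * e θ) (e' θ) = _ from by
        simpa only [Complex.ofReal_neg] using hlin (-Real.sin θ) (Real.cos θ)]
    generalize fderiv ℝ u (r * e θ) 1 = x
    generalize fderiv ℝ u (r * e θ) Complex.I = y
    rw [← mul_div_assoc, mul_div_mul_left _ _ hr, div_eq_iff (he0 θ)]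
    linear_combination (-(x + Complex.I * y)) * hcs θ + ((x + Complex.I * y) * Real.sin θ *
      Real.sin θ - Real.sin θ * y * e θ) * Complex.I_mul_I
  rw [setIntegral_congr_fun (measurableSet_Ioi.prod measurableSet_Ioo) this,
    integral_add hai (hbi.const_mul _), integral_const_mul, hIa, hIb, mul_zero, add_zero]

open MeasureTheory in
/-- **Pompeiu's formula** for compactly supported functions. -/
theorem integral_dbar_div_sub {u : ℂ → ℂ} (hu : ContDiff ℝ 1 u) (hc : HasCompactSupport u) (z : ℂ) :
    ∫ w : ℂ, (fderiv ℝ u w 1 + Complex.I * fderiv ℝ u w Complex.I) / (w - z) =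
      -(2 * Real.pi) * u z := by
  have h := integral_dbar_div_self (u := fun w => u (w + z))
    (hu.comp (contDiff_id.add contDiff_const))
    (hc.comp_homeomorph (Homeomorph.addRight z))
  simp only [fderiv_comp_add_right, zero_add] at h
  rw [← h, ← integral_add_right_eq_self _ z]
  simp

/-- The rational functions with poles off `K`, as continuous functions on `K`. -/
def rationalFunctionsOn (K : Set ℂ) : Submodule ℂ C(K, ℂ) where
  carrier := {F | ∃ P Q : Polynomial ℂ, ∀ z : K, Q.eval (z : ℂ) ≠ 0 ∧
    F z = P.eval (z : ℂ) / Q.eval (z : ℂ)}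
  zero_mem' := ⟨0, 1, fun z => by simp⟩
  add_mem' := by
    rintro F G ⟨P, Q, h⟩ ⟨P', Q', h'⟩
    refine ⟨P * Q' + Q * P', Q * Q', fun z => ⟨?_, ?_⟩⟩
    · simp [(h z).1, (h' z).1]
    · rw [ContinuousMap.add_apply, (h z).2, (h' z).2, div_add_div _ _ (h z).1 (h' z).1]
      simp
  smul_mem' := by
    rintro c F ⟨P, Q, h⟩
    refine ⟨Polynomial.C c * P, Q, fun z => ⟨(h z).1, ?_⟩⟩
    simp [(h z).2, mul_div_assoc]

open MeasureTheory in
theorem integral_mem_topologicalClosure {α E : Type*} [MeasurableSpace α] {μ : Measure α}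
    [NormedAddCommGroup E] [NormedSpace ℂ E] [CompleteSpace E] (S : Submodule ℂ E) {f : α → E}
    (hf : ∀ a, f a ∈ S) : ∫ a, f a ∂μ ∈ S.topologicalClosure := by
  by_cases hi : Integrable f μ
  · have := S.isClosed_topologicalClosure
    have h := ContinuousLinearMap.integral_comp_comm S.topologicalClosure.mkQL hi
    have h0 : ∀ a, S.topologicalClosure.mkQL (f a) = 0 := fun a => by
      rw [Submodule.mkQL_apply, Submodule.mkQ_apply, Submodule.Quotient.mk_eq_zero]
      exact S.le_topologicalClosure (hf a)
    simp only [h0, integral_zero] at h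
    rw [← Submodule.Quotient.mk_eq_zero, ← Submodule.mkQ_apply, ← Submodule.mkQL_apply, ← h]
  · rw [integral_undef hi]
    exact zero_mem _

open MeasureTheory in
/-- **Runge's theorem**: a holomorphic function on a neighbourhood of a compact set `K` is a uniform
limit on `K` of rational functions with poles off `K`. -/
theorem exists_rational_near {K U : Set ℂ} (hK : IsCompact K) (hU : IsOpen U) (hKU : K ⊆ U)
    {g : ℂ → ℂ} (hg : DifferentiableOn ℂ g U) {ε : ℝ} (hε : 0 < ε) :
    ∃ P Q : Polynomial ℂ, ∀ z ∈ K, Q.eval z ≠ 0 ∧ ‖g z - P.eval z / Q.eval z‖ < ε := by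
  obtain ⟨K', hK', hKK', hK'U⟩ := exists_compact_between hK hU hKU
  obtain ⟨χ, hχ1, hχ0, -⟩ := exists_contMDiffMap_one_nhds_of_subset_interior
    (n := 1) (modelWithCornersSelf ℝ ℂ) hK.isClosed hKK'
  have hχd : ContDiff ℝ 1 χ := χ.contMDiff.contDiff
  set u : ℂ → ℂ := fun z => χ z * g z with hu
  have hu0 : ∀ z ∉ K', u z = 0 := fun z hz => by simp [u, hχ0 z hz]
  have huc : HasCompactSupport u := HasCompactSupport.intro hK' fun z hz => hu0 z hz
  have hud : ContDiff ℝ 1 u := by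
    rw [contDiff_iff_contDiffAt]
    intro z
    by_cases hz : z ∈ K'
    · exact (Complex.ofRealCLM.contDiff.comp hχd).contDiffAt.mul
        ((hg.analyticAt (hU.mem_nhds (hK'U hz))).restrictScalars (𝕜 := ℝ)).contDiffAt
    · refine (contDiffAt_const (c := (0 : ℂ))).congr_of_eventuallyEq ?_
      filter_upwards [hK'.isClosed.isOpen_compl.mem_nhds hz] with w hw using hu0 w hw
  set m : ℂ → ℂ := fun w => fderiv ℝ u w 1 + Complex.I * fderiv ℝ u w Complex.I with hm
  have hmc : Continuous m := by
    have := hud.continuous_fderiv one_ne_zero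
    fun_prop
  have hm0 : ∀ z ∈ K, ∀ᶠ w in 𝓝 z, m w = 0 := fun z hz => by
    have h1 : ∀ᶠ w in 𝓝 z, u w = g w := by
      filter_upwards [mem_nhdsSet_iff_forall.1 hχ1 z hz] with w hw
      simp [u, show χ w = 1 from hw]
    filter_upwards [eventually_eventually_nhds.2 h1, hU.mem_nhds (hKU hz)] with w hw hwU
    have hd := (hg.differentiableAt (hU.mem_nhds hwU)).hasDerivAt.hasFDerivAt.restrictScalars ℝ
    simp only [m, (hd.congr_of_eventuallyEq hw).fderiv]
    simp
    linear_combination (deriv g w) * Complex.I_mul_I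
  have hmK' : ∀ w ∉ K', m w = 0 := fun w hw => by
    have : fderiv ℝ u w = 0 := by
      by_contra h
      have h2 := support_fderiv_subset ℝ (f := u) h
      exact hw (closure_minimal (fun z hz => not_imp_comm.1 (hu0 z) hz) hK'.isClosed h2)
    simp [m, this]
  have := isCompact_iff_compactSpace.1 hK
  have hjc : Continuous fun p : ℂ × K => m p.1 / (p.1 - p.2) := by
    rw [continuous_iff_continuousAt]
    rintro ⟨w, z⟩
    by_cases hwz : w = z
    · subst hwz
      refine (continuousAt_const (y := (0 : ℂ))).congr ?_
      filter_upwards [continuousAt_fst.eventually (hm0 z z.2)] with p hp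
      simp [show m p.1 = 0 from hp]
    · exact ContinuousAt.div (by fun_prop) (by fun_prop) (sub_ne_zero.2 hwz)
  set Φ : C(ℂ, C(K, ℂ)) := ContinuousMap.curry ⟨_, hjc⟩ with hΦ
  have hΦa : ∀ w z, Φ w z = m w / (w - z) := fun w z => rfl
  have hΦi : Integrable Φ := Φ.continuous.integrable_of_hasCompactSupport
    (HasCompactSupport.intro hK' fun w hw => by ext z; simp [hΦa, hmK' w hw])
  have hΦm : ∀ w, Φ w ∈ rationalFunctionsOn K := fun w => by
    by_cases hw : w ∈ K
    · refine ⟨0, 1, fun z => ⟨by simp, ?_⟩⟩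
      simp [hΦa, (hm0 w hw).self_of_nhds]
    · refine ⟨Polynomial.C (m w), Polynomial.C w - Polynomial.X, fun z => ⟨?_, ?_⟩⟩
      · simp only [Polynomial.eval_sub, Polynomial.eval_C, Polynomial.eval_X]
        intro h
        rw [sub_eq_zero] at h
        exact hw (h ▸ z.2)
      · simp [hΦa]
  have hmem := integral_mem_topologicalClosure (μ := volume) (rationalFunctionsOn K) hΦm
  have hval : ∀ z : K, (∫ w, Φ w) z = -(2 * Real.pi) * g z := fun z => by
    rw [ContinuousMap.integral_apply hΦi]
    simp only [hΦa]
    rw [integral_dbar_div_sub hud huc]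
    simp [u, hχ1.self_of_nhdsSet _ z.2]
  have hmem2 := (rationalFunctionsOn K).topologicalClosure.smul_mem (-(2 * Real.pi : ℂ))⁻¹ hmem
  rw [← SetLike.mem_coe, Submodule.topologicalClosure_coe] at hmem2
  obtain ⟨F, ⟨P, Q, hPQ⟩, hF⟩ := Metric.mem_closure_iff.1 hmem2 ε hε
  refine ⟨P, Q, fun z hz => ⟨(hPQ ⟨z, hz⟩).1, ?_⟩⟩
  refine lt_of_le_of_lt ?_ hF
  rw [dist_eq_norm]
  refine le_trans (le_of_eq ?_) (ContinuousMap.norm_coe_le_norm _ (⟨z, hz⟩ : K))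
  have hpi : (-(2 * Real.pi : ℂ)) ≠ 0 := by simp [Real.pi_ne_zero]
  rw [ContinuousMap.sub_apply, ContinuousMap.smul_apply, hval, smul_eq_mul,
    inv_mul_cancel_left₀ hpi,
    (hPQ ⟨z, hz⟩).2]

theorem HasLogOn.sub_of_isPreconnected {U : Set ℂ} (hb : Bornology.IsBounded U)
    (hc : IsPreconnected Uᶜ) {δ : ℝ} (hδ : 0 < δ) {e : ℂ} (he : e ∈ Uᶜ) :
    HasLogOn (fun z => z - e) {z | δ ≤ infDist z Uᶜ} := by
  have hstep : ∀ e ∈ Uᶜ, ∀ e' ∈ Uᶜ, dist e e' < δ →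
      HasLogOn (fun z => z - e) {z | δ ≤ infDist z Uᶜ} →
      HasLogOn (fun z => z - e') {z | δ ≤ infDist z Uᶜ} := by
    intro e he e' he' hd h
    refine h.of_norm_sub_lt (by fun_prop) fun z hz => ?_
    rw [sub_sub_sub_cancel_left, ← dist_eq_norm, ← dist_eq_norm]
    exact hd.trans_le ((show δ ≤ infDist z Uᶜ from hz).trans (infDist_le_dist_of_mem he))
  obtain ⟨R, hR⟩ := hb.subset_closedBall 0
  have hR0 : (0 : ℝ) < |R| + 1 := by positivity
  have hfar : ((|R| + 1 : ℝ) : ℂ) ∈ Uᶜ := fun h => by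
    have := hR h
    rw [mem_closedBall, dist_zero_right, Complex.norm_real, Real.norm_of_nonneg hR0.le] at this
    linarith [le_abs_self R]
  refine (hc.induction₂ (fun e e' => HasLogOn (fun z => z - e) {z | δ ≤ infDist z Uᶜ} ↔
    HasLogOn (fun z => z - e') {z | δ ≤ infDist z Uᶜ}) (fun x hx => ?_)
    (fun _ _ _ _ _ _ => Iff.trans) (fun _ _ _ _ => Iff.symm) hfar he).1 ?_
  · rw [eventually_nhdsWithin_iff]
    filter_upwards [ball_mem_nhds x hδ] with y hy hyU
    exact ⟨hstep x hx y hyU (mem_ball'.1 hy), hstep y hyU x hx hy⟩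
  · refine (HasLogOn.const (c := -((|R| + 1 : ℝ) : ℂ)) ?_).of_norm_sub_lt (by fun_prop) fun z hz => ?_
    · rw [neg_ne_zero, Complex.ofReal_ne_zero]
      exact hR0.ne'
    · have hzU : z ∈ U := by
        by_contra h
        have h2 : δ ≤ infDist z Uᶜ := hz
        rw [infDist_zero_of_mem (show z ∈ Uᶜ from h)] at h2
        exact h2.not_gt hδ
      have := hR hzU
      rw [mem_closedBall, dist_zero_right] at this
      rw [sub_neg_eq_add, sub_add_cancel, norm_neg, Complex.norm_real, Real.norm_of_nonneg hR0.le]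
      linarith [le_abs_self R]

theorem HasLogOn.sub_of_notMem {U : Set ℂ} (hb : Bornology.IsBounded U)
    (hc : IsPreconnected Uᶜ) {δ : ℝ} (hδ : 0 < δ) {a : ℂ} (ha : infDist a Uᶜ < δ) :
    HasLogOn (fun z => z - a) {z | δ ≤ infDist z Uᶜ} := by
  have hne : (Uᶜ).Nonempty := by
    rw [nonempty_compl]
    rintro rfl
    exact NormedSpace.unbounded_univ ℂ ℂ hb
  obtain ⟨e, he, hae⟩ := (infDist_lt_iff hne).1 ha
  refine (HasLogOn.sub_of_isPreconnected hb hc hδ he).of_norm_sub_lt (by fun_prop) fun z hz => ?_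
  rw [sub_sub_sub_cancel_left, ← dist_eq_norm, ← dist_eq_norm, dist_comm e]
  exact hae.trans_le ((show δ ≤ infDist z Uᶜ from hz).trans (infDist_le_dist_of_mem he))

theorem HasLogOn.polynomial_eval {K : Set ℂ} (hK : ∀ a ∉ K, HasLogOn (fun z => z - a) K)
    {P : Polynomial ℂ} (hP0 : P ≠ 0) (hP : ∀ z ∈ K, P.eval z ≠ 0) :
    HasLogOn (fun z => P.eval z) K := by
  have hr : ∀ s : Multiset ℂ, (∀ a ∈ s, a ∉ K) →
      HasLogOn (fun z => (s.map fun a => z - a).prod) K := by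
    intro s
    induction s using Multiset.induction_on with
    | empty => intro _; simpa using HasLogOn.const one_ne_zero
    | cons a s ih =>
      intro h
      simp only [Multiset.map_cons, Multiset.prod_cons]
      exact (hK a (h a (by simp))).mul (ih fun b hb => h b (by simp [hb]))
  have := (HasLogOn.const (A := K) (Polynomial.leadingCoeff_ne_zero.2 hP0)).mul
    (hr P.roots fun a ha haK => hP a haK (Polynomial.isRoot_of_mem_roots ha))
  exact this.congr fun z _ => (IsAlgClosed.splits P).eval_eq_prod_roots z

/-- If the complement of a bounded open set `U` is connected, then a nonvanishing holomorphic
function on `U` has a logarithm on the compact sets exhausting `U`. -/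
theorem HasLogOn.of_differentiableOn {U : Set ℂ} (hU : IsOpen U) (hb : Bornology.IsBounded U)
    (hc : IsPreconnected Uᶜ) {g : ℂ → ℂ} (hg : DifferentiableOn ℂ g U) (h0 : ∀ z ∈ U, g z ≠ 0)
    {δ : ℝ} (hδ : 0 < δ) : HasLogOn g {z | δ ≤ infDist z Uᶜ} := by
  have hKU : {z | δ ≤ infDist z Uᶜ} ⊆ U := fun z hz => by
    by_contra h
    have h2 : δ ≤ infDist z Uᶜ := hz
    rw [infDist_zero_of_mem (show z ∈ Uᶜ from h)] at h2
    exact h2.not_gt hδ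
  set K := {z | δ ≤ infDist z Uᶜ} with hKdef
  have hK : IsCompact K :=
    isCompact_of_isClosed_isBounded (isClosed_le continuous_const (continuous_infDist_pt _))
      (hb.subset hKU)
  have hgK := hg.continuousOn.mono hKU
  rcases K.eq_empty_or_nonempty with he | hne
  · exact ⟨0, by simp [he], by simp [he]⟩
  obtain ⟨z₀, hz₀, hmin⟩ := hK.exists_isMinOn hne hgK.norm
  have hε : 0 < ‖g z₀‖ := norm_pos_iff.2 (h0 _ (hKU hz₀))
  obtain ⟨P, Q, hPQ⟩ := exists_rational_near hK hU hKU hg (half_pos hε)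
  have hlt : ∀ z ∈ K, ‖g z - P.eval z / Q.eval z‖ < ‖P.eval z / Q.eval z‖ := fun z hz => by
    have h1 := (hPQ z hz).2
    have h2 : ‖g z₀‖ ≤ ‖g z‖ := hmin hz
    have h3 := norm_sub_norm_le (g z) (P.eval z / Q.eval z)
    linarith
  have hP : ∀ z ∈ K, P.eval z ≠ 0 := fun z hz h => by
    have := hlt z hz
    rw [h, zero_div, norm_zero] at this
    exact absurd this (not_lt.2 (norm_nonneg _))
  have hlog : ∀ a ∉ K, HasLogOn (fun z => z - a) K := fun a ha =>
    HasLogOn.sub_of_notMem hb hc hδ (not_le.1 ha)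
  have hpoly : ∀ P : Polynomial ℂ, (∀ z ∈ K, P.eval z ≠ 0) → HasLogOn (fun z => P.eval z) K :=
    fun P hP => HasLogOn.polynomial_eval hlog (fun h => hP z₀ hz₀ (by simp [h])) hP
  exact ((hpoly P hP).div (hpoly Q fun z hz => (hPQ z hz).1)).of_norm_sub_lt hgK hlt

theorem exists_preconnected_infDist_ge {U : Set ℂ} (hU : IsOpen U) (hc : IsConnected U)
    (hne : (Uᶜ).Nonempty) {z w : ℂ} (hz : z ∈ U) (hw : w ∈ U) :
    ∃ δ > 0, w ∈ connectedComponentIn {z | δ < infDist z Uᶜ} z := by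
  obtain ⟨γ, hγ⟩ := (hU.isConnected_iff_isPathConnected.1 hc).joinedIn z hz w hw
  obtain ⟨t, -, ht⟩ := isCompact_univ.exists_isMinOn univ_nonempty
    ((continuous_infDist_pt Uᶜ).comp γ.continuous).continuousOn
  have hpos : 0 < infDist (γ t) Uᶜ := by
    rw [← hU.isClosed_compl.notMem_iff_infDist_pos hne]
    exact not_not.2 (hγ t)
  refine ⟨_, half_pos hpos, ?_⟩
  refine (isPreconnected_range γ.continuous).subset_connectedComponentIn ⟨0, γ.source⟩ ?_
    ⟨1, γ.target⟩
  rintro _ ⟨s, rfl⟩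
  exact (half_lt_self hpos).trans_le (ht (mem_univ s))

/-- If the complement of a bounded connected open set `U` is connected, then a nonvanishing
holomorphic function on `U` has a logarithm on `U`. -/
theorem HasLogOn.of_isPreconnected_compl {U : Set ℂ} (hU : IsOpen U) (hb : Bornology.IsBounded U)
    (hU' : IsConnected U) (hc : IsPreconnected Uᶜ) {g : ℂ → ℂ} (hg : DifferentiableOn ℂ g U)
    (h0 : ∀ z ∈ U, g z ≠ 0) : HasLogOn g U := by
  have hne : (Uᶜ).Nonempty := by
    rw [nonempty_compl]
    rintro rfl
    exact NormedSpace.unbounded_univ ℂ ℂ hb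
  obtain ⟨z₀, hz₀⟩ := hU'.nonempty
  set C : ℝ → Set ℂ := fun δ => connectedComponentIn {z | δ < infDist z Uᶜ} z₀ with hC
  have hCo : ∀ δ, IsOpen (C δ) := fun δ =>
    (isOpen_lt continuous_const (continuous_infDist_pt _)).connectedComponentIn
  have hex : ∀ δ > 0, ∃ L : ℂ → ℂ, ContinuousOn L (C δ) ∧ (∀ z ∈ C δ, Complex.exp (L z) = g z) ∧
      L z₀ = Complex.log (g z₀) := by
    intro δ hδ
    obtain ⟨L, hL, hLg⟩ := (HasLogOn.of_differentiableOn hU hb hc hg h0 hδ).mono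
      (show C δ ⊆ _ from fun z hz => mem_ofPred.2
        (mem_ofPred.1 (connectedComponentIn_subset _ _ hz)).le)
    by_cases hz : z₀ ∈ C δ
    · refine ⟨fun z => L z - L z₀ + Complex.log (g z₀), by fun_prop, fun z hz' => ?_, by ring⟩
      rw [Complex.exp_add, Complex.exp_sub, hLg z hz', hLg z₀ hz, Complex.exp_log (h0 _ hz₀)]
      field_simp [h0 _ hz₀]
    · have : C δ = ∅ := by
        by_contra h
        obtain ⟨y, hy⟩ := nonempty_iff_ne_empty.2 h
        exact hz (mem_connectedComponentIn (connectedComponentIn_nonempty_iff.1 ⟨y, hy⟩))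
      exact ⟨fun _ => Complex.log (g z₀), continuousOn_const, by simp [this], rfl⟩
  choose! L hL hLg hL0 using hex
  have hmono : ∀ {δ δ'}, δ ≤ δ' → C δ' ⊆ C δ := fun h =>
    connectedComponentIn_mono _ fun z hz => lt_of_le_of_lt h hz
  have hagree' : ∀ δ δ', 0 < δ → δ ≤ δ' → EqOn (L δ) (L δ') (C δ') := fun δ δ' hδ h z hz => by
    have hz₀' : z₀ ∈ C δ' := mem_connectedComponentIn (connectedComponentIn_nonempty_iff.1 ⟨z, hz⟩)
    have := HasLogOn.const_of_exp_eq (c := 1) isPreconnected_connectedComponentIn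
      (((hL δ hδ).mono (hmono h)).sub (hL δ' (hδ.trans_le h))) (fun x hx => ?_) hz hz₀'
    · simp only [Pi.sub_apply, hL0 δ hδ, hL0 δ' (hδ.trans_le h), sub_self] at this
      exact sub_eq_zero.1 this
    · have hx0 : g x ≠ 0 := by rw [← hLg δ hδ x (hmono h hx)]; exact Complex.exp_ne_zero _
      rw [Pi.sub_apply, Complex.exp_sub, hLg δ hδ x (hmono h hx), hLg δ' (hδ.trans_le h) x hx,
        div_self hx0]
  have hagree : ∀ δ δ' z, 0 < δ → 0 < δ' → z ∈ C δ → z ∈ C δ' → L δ z = L δ' z := by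
    intro δ δ' z hδ hδ' h h'
    rcases le_total δ δ' with hle | hle
    · exact hagree' δ δ' hδ hle h'
    · exact (hagree' δ' δ hδ' hle h).symm
  have hcov := fun z (hz : z ∈ U) => exists_preconnected_infDist_ge hU hU' hne hz₀ hz
  choose! d hd hdC using hcov
  refine ⟨fun z => L (d z) z, fun z hz => ContinuousAt.continuousWithinAt ?_,
    fun z hz => hLg _ (hd z hz) z (hdC z hz)⟩
  refine ((hL _ (hd z hz)).continuousAt ((hCo _).mem_nhds (hdC z hz))).congr ?_
  filter_upwards [(hCo _).mem_nhds (hdC z hz), hU.mem_nhds hz] with w hw hwU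
  exact hagree _ _ _ (hd z hz) (hd w hwU) hw (hdC w hwU)

/-- If the complement of a bounded connected open set `U` is connected, then a nonvanishing
holomorphic function on `U` has a holomorphic square root on `U`. -/
theorem exists_sqrt_of_isPreconnected_compl {U : Set ℂ} (hU : IsOpen U)
    (hb : Bornology.IsBounded U) (hU' : IsConnected U) (hc : IsPreconnected Uᶜ) {g : ℂ → ℂ}
    (hg : DifferentiableOn ℂ g U) (h0 : ∀ z ∈ U, g z ≠ 0) :
    ∃ s : ℂ → ℂ, DifferentiableOn ℂ s U ∧ ∀ z ∈ U, s z * s z = g z := by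
  obtain ⟨L, hL, hLg⟩ := HasLogOn.of_isPreconnected_compl hU hb hU' hc hg h0
  have hs : ∀ z ∈ U, Complex.exp (L z / 2) * Complex.exp (L z / 2) = g z := fun z hz => by
    rw [← Complex.exp_add, add_halves, hLg z hz]
  refine ⟨fun z => Complex.exp (L z / 2), fun z hz => ?_, hs⟩
  have hUz := hU.mem_nhds hz
  have hcont : ContinuousAt (fun z => Complex.exp (L z / 2)) z :=
    (Complex.continuous_exp.continuousAt).comp ((hL.continuousAt hUz).div_const 2)
  have hne : Complex.exp (L z / 2) + Complex.exp (L z / 2) ≠ 0 := by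
    rw [← two_mul]; exact mul_ne_zero two_ne_zero (Complex.exp_ne_zero _)
  have hslope := (hg.differentiableAt hUz).hasDerivAt.tendsto_slope
  have hsum : Tendsto (fun w => Complex.exp (L w / 2) + Complex.exp (L z / 2)) (𝓝[≠] z)
      (𝓝 (Complex.exp (L z / 2) + Complex.exp (L z / 2))) :=
    (hcont.add continuousAt_const).tendsto.mono_left nhdsWithin_le_nhds
  refine DifferentiableAt.differentiableWithinAt <| HasDerivAt.differentiableAt <|
    hasDerivAt_iff_tendsto_slope.2 ((hslope.div hsum hne).congr' ?_)
  filter_upwards [hsum.eventually_ne hne, nhdsWithin_le_nhds hUz] with w hw hwU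
  rw [Pi.div_apply, div_eq_iff hw, slope_def_field, slope_def_field, ← hs w hwU, ← hs z hz]
  ring

theorem one_sub_conj_mul_ne_zero {c w : ℂ} (hc : ‖c‖ < 1) (hw : ‖w‖ < 1) :
    1 - (starRingEnd ℂ) c * w ≠ 0 := by
  intro h
  have h1 : ‖(starRingEnd ℂ) c * w‖ = 1 := by rw [← sub_eq_zero.1 h, norm_one]
  rw [norm_mul, RCLike.norm_conj] at h1
  nlinarith [norm_nonneg c, norm_nonneg w]

theorem norm_mobius_lt_one {c w : ℂ} (hc : ‖c‖ < 1) (hw : ‖w‖ < 1) :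
    ‖(w - c) / (1 - (starRingEnd ℂ) c * w)‖ < 1 := by
  have h0 := one_sub_conj_mul_ne_zero hc hw
  rw [norm_div, div_lt_one (norm_pos_iff.2 h0)]
  refine lt_of_pow_lt_pow_left₀ 2 (norm_nonneg _) ?_
  have hc2 : ‖c‖ ^ 2 < 1 := by nlinarith [norm_nonneg c]
  have hw2 : ‖w‖ ^ 2 < 1 := by nlinarith [norm_nonneg w]
  have : ‖1 - (starRingEnd ℂ) c * w‖ ^ 2 - ‖w - c‖ ^ 2 = (1 - ‖c‖ ^ 2) * (1 - ‖w‖ ^ 2) := by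
    simp only [← Complex.normSq_eq_norm_sq, Complex.normSq_apply, Complex.sub_re, Complex.sub_im,
      Complex.mul_re, Complex.mul_im, Complex.conj_re, Complex.conj_im, Complex.one_re,
      Complex.one_im]
    ring
  nlinarith

theorem mobius_injOn {c w w' : ℂ} (hc : ‖c‖ < 1) (hw : ‖w‖ < 1) (hw' : ‖w'‖ < 1)
    (h : (w - c) / (1 - (starRingEnd ℂ) c * w) = (w' - c) / (1 - (starRingEnd ℂ) c * w')) :
    w = w' := by
  rw [div_eq_div_iff (one_sub_conj_mul_ne_zero hc hw) (one_sub_conj_mul_ne_zero hc hw')] at h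
  have h1 : (w - w') * (1 - (starRingEnd ℂ) c * c) = 0 := by linear_combination h
  exact sub_eq_zero.1 ((mul_eq_zero.1 h1).resolve_right (one_sub_conj_mul_ne_zero hc hc))

theorem HasDerivAt.mobius {f : ℂ → ℂ} {f' z c : ℂ} (hf : HasDerivAt f f' z) (hc : ‖c‖ < 1)
    (hz : ‖f z‖ < 1) : HasDerivAt (fun z => (f z - c) / (1 - (starRingEnd ℂ) c * f z))
      (f' * (1 - (starRingEnd ℂ) c * c) / (1 - (starRingEnd ℂ) c * f z) ^ 2) z := by
  refine ((hf.sub_const c).div ((hf.const_mul _).const_sub 1)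
    (one_sub_conj_mul_ne_zero hc hz)).congr_deriv ?_
  congr 1
  ring

/-- The competitors in the extremal problem of the Riemann mapping theorem. -/
structure IsRiemannCandidate (U : Set ℂ) (z₀ : ℂ) (f : ℂ → ℂ) : Prop where
  differentiableOn : DifferentiableOn ℂ f U
  injOn : InjOn f U
  mapsTo : ∀ z ∈ U, ‖f z‖ < 1
  map_base : f z₀ = 0

theorem IsRiemannCandidate.exists_norm_deriv_lt {U : Set ℂ} {z₀ : ℂ} {f : ℂ → ℂ}
    (hf : IsRiemannCandidate U z₀ f) (hU : IsOpen U) (hz₀ : z₀ ∈ U)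
    (hsqrt : ∀ g : ℂ → ℂ, DifferentiableOn ℂ g U → (∀ z ∈ U, g z ≠ 0) →
      ∃ s : ℂ → ℂ, DifferentiableOn ℂ s U ∧ ∀ z ∈ U, s z * s z = g z)
    (hd : deriv f z₀ ≠ 0) {c : ℂ} (hc : ‖c‖ < 1) (hcf : c ∉ f '' U) :
    ∃ k, IsRiemannCandidate U z₀ k ∧ ‖deriv f z₀‖ < ‖deriv k z₀‖ := by
  have hmob : ∀ {f : ℂ → ℂ} {c : ℂ}, DifferentiableOn ℂ f U → (∀ z ∈ U, ‖f z‖ < 1) → ‖c‖ < 1 →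
      DifferentiableOn ℂ (fun z => (f z - c) / (1 - (starRingEnd ℂ) c * f z)) U :=
    fun hf h1 hc z hz => ((hf.differentiableAt (hU.mem_nhds hz)).hasDerivAt.mobius hc
      (h1 z hz)).differentiableAt.differentiableWithinAt
  obtain ⟨s, hs, hsg⟩ := hsqrt _ (hmob hf.differentiableOn hf.mapsTo hc) fun z hz =>
    div_ne_zero (sub_ne_zero.2 fun h => hcf ⟨z, hz, h⟩)
      (one_sub_conj_mul_ne_zero hc (hf.mapsTo z hz))
  have hs1 : ∀ z ∈ U, ‖s z‖ < 1 := fun z hz => by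
    have := norm_mobius_lt_one hc (hf.mapsTo z hz)
    rw [← hsg z hz, norm_mul] at this
    nlinarith [norm_nonneg (s z)]
  have hsi : InjOn s U := fun z hz w hw h => by
    have h1 := hsg z hz
    rw [h, hsg w hw] at h1
    exact hf.injOn hz hw (mobius_injOn hc (hf.mapsTo w hw) (hf.mapsTo z hz) h1).symm
  set b := s z₀ with hb
  have hb1 : ‖b‖ < 1 := hs1 z₀ hz₀
  have hbc : b * b = -c := by
    have := hsg z₀ hz₀
    rw [hf.map_base] at this
    simpa using this
  have hc0 : c ≠ 0 := fun h => hcf ⟨z₀, hz₀, by rw [hf.map_base, h]⟩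
  have hb0 : b ≠ 0 := fun h => hc0 (by rw [h] at hbc; simpa using hbc.symm)
  refine ⟨fun z => (s z - b) / (1 - (starRingEnd ℂ) b * s z), ⟨hmob hs hs1 hb1,
    fun z hz w hw h => hsi hz hw (mobius_injOn hb1 (hs1 z hz) (hs1 w hw) h),
    fun z hz => norm_mobius_lt_one hb1 (hs1 z hz), by simp [hb]⟩, ?_⟩
  have hsd := (hs.differentiableAt (hU.mem_nhds hz₀)).hasDerivAt
  have hfd := (hf.differentiableOn.differentiableAt (hU.mem_nhds hz₀)).hasDerivAt
  rw [(hsd.mobius hb1 hb1).deriv]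
  have h2 := (hsd.mul hsd).unique ((hfd.mobius hc (by simp [hf.map_base])).congr_of_eventuallyEq
    (eventuallyEq_of_mem (hU.mem_nhds hz₀) hsg))
  simp only [← hb, hf.map_base, mul_zero, sub_zero, one_pow, div_one] at h2 ⊢
  have hnc : ∀ c : ℂ, 1 - (starRingEnd ℂ) c * c = ((1 - ‖c‖ ^ 2 : ℝ) : ℂ) := fun c => by
    rw [mul_comm, Complex.mul_conj, Complex.normSq_eq_norm_sq]; push_cast; ring
  have hcb : ‖c‖ = ‖b‖ ^ 2 := by rw [← norm_neg, ← hbc, norm_mul, sq]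
  have hbpos : 0 < ‖b‖ := norm_pos_iff.2 hb0
  have h3 : 2 * ‖b‖ * ‖deriv s z₀‖ = ‖deriv f z₀‖ * (1 - ‖b‖ ^ 4) := by
    have h4 : 2 * b * deriv s z₀ = deriv f z₀ * ((1 - ‖c‖ ^ 2 : ℝ) : ℂ) := by
      rw [← hnc, ← h2]; ring
    have := congrArg norm h4
    rw [norm_mul, norm_mul, norm_mul, Complex.norm_real, Complex.norm_two, hcb,
      Real.norm_of_nonneg (by nlinarith [pow_le_one₀ hbpos.le hb1.le (n := 4)])] at this
    rw [this]; ring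
  have hb2 : 0 < 1 - ‖b‖ ^ 2 := by nlinarith
  rw [hnc, norm_div, norm_mul, norm_pow, Complex.norm_real, Real.norm_of_nonneg hb2.le,
    lt_div_iff₀ (by positivity), sq (1 - ‖b‖ ^ 2), ← mul_assoc]
  refine mul_lt_mul_of_pos_right ?_ hb2
  have hdp : 0 < ‖deriv f z₀‖ := norm_pos_iff.2 hd
  have h5 : 2 * ‖b‖ * (‖deriv f z₀‖ * (1 - ‖b‖ ^ 2)) < 2 * ‖b‖ * ‖deriv s z₀‖ := by
    rw [h3]
    have : 0 < ‖deriv f z₀‖ * (1 - ‖b‖ ^ 2) * (1 - ‖b‖) ^ 2 := by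
      have : 0 < 1 - ‖b‖ := by linarith
      positivity
    nlinarith
  exact lt_of_mul_lt_mul_left h5 (by positivity)

theorem tendstoLocallyUniformlyOn_of_norm_le {ι : Type*} {p : Filter ι} [p.NeBot] {U : Set ℂ}
    (hU : IsOpen U)
    {F : ι → ℂ → ℂ} {f : ℂ → ℂ} (hF : ∀ n, DifferentiableOn ℂ (F n) U)
    (hb : ∀ n, ∀ z ∈ U, ‖F n z‖ ≤ 1) (hlim : ∀ z ∈ U, Tendsto (fun n => F n z) p (𝓝 (f z))) :
    TendstoLocallyUniformlyOn F f p U := by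
  rw [Metric.tendstoLocallyUniformlyOn_iff]
  intro ε hε x hx
  obtain ⟨R, hR, hRU⟩ := Metric.isOpen_iff.1 hU x hx
  have hlip : ∀ n, ∀ z ∈ ball x R, dist (F n z) (F n x) ≤ 2 / R * dist z x := by
    intro n z hz
    refine Complex.dist_le_div_mul_dist_of_mapsTo_ball ((hF n).mono hRU) (fun w hw => ?_) hz
    rw [mem_closedBall, dist_eq_norm]
    exact (norm_sub_le _ _).trans (by linarith [hb n w (hRU hw), hb n x hx])
  have hlip' : ∀ z ∈ ball x R, dist (f z) (f x) ≤ 2 / R * dist z x := fun z hz =>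
    le_of_tendsto ((hlim z (hRU hz)).dist (hlim x hx)) (Eventually.of_forall fun n => hlip n z hz)
  have hδ : 0 < min R (ε * R / 8) := lt_min hR (by positivity)
  refine ⟨ball x (min R (ε * R / 8)), mem_nhdsWithin_of_mem_nhds (ball_mem_nhds x hδ), ?_⟩
  filter_upwards [Metric.tendsto_nhds.1 (hlim x hx) (ε / 4) (by positivity)] with n hn z hz
  have hzR : z ∈ ball x R := ball_subset_ball (min_le_left _ _) hz
  have h1 : 2 / R * dist z x ≤ ε / 4 := by
    have : dist z x ≤ ε * R / 8 := (mem_ball.1 hz).le.trans (min_le_right _ _)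
    calc 2 / R * dist z x ≤ 2 / R * (ε * R / 8) := by gcongr
      _ = ε / 4 := by field_simp; norm_num
  have h2 := hlip n z hzR
  have h3 := hlip' z hzR
  have h4 := dist_triangle4 (f z) (f x) (F n x) (F n z)
  rw [dist_comm (F n x) (F n z), dist_comm (f x) (F n x)] at h4
  linarith

/-- **Hurwitz's theorem**: a nonconstant locally uniform limit of injective holomorphic functions
is injective. -/
theorem TendstoLocallyUniformlyOn.injOn_of_injOn {ι : Type*} {p : Filter ι} [p.NeBot] {U : Set ℂ}
    (hU : IsOpen U) (hU' : IsPreconnected U) {F : ι → ℂ → ℂ} {f : ℂ → ℂ}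
    (hlim : TendstoLocallyUniformlyOn F f p U) (hF : ∀ n, DifferentiableOn ℂ (F n) U)
    (hinj : ∀ n, InjOn (F n) U) (hne : ¬ ∃ a, ∀ z ∈ U, f z = a) : InjOn f U := by
  have hf : DifferentiableOn ℂ f U := hlim.differentiableOn (Eventually.of_forall hF) hU
  intro z₁ h₁ z₂ h₂ heq
  by_contra hz
  have hfa : AnalyticOnNhd ℂ (fun z => f z - f z₁) U := (hf.sub_const _).analyticOnNhd hU
  have hev : ∀ᶠ z in 𝓝[≠] z₂, f z - f z₁ ≠ 0 := by
    refine (hfa z₂ h₂).eventually_eq_zero_or_eventually_ne_zero.resolve_left fun h => hne ?_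
    exact ⟨f z₁, fun z hz => sub_eq_zero.1
      (hfa.eqOn_zero_of_preconnected_of_eventuallyEq_zero hU' h₂ h hz)⟩
  rw [eventually_nhdsWithin_iff] at hev
  obtain ⟨R, hR, hRs⟩ := Metric.eventually_nhds_iff_ball.1 (hev.and (hU.mem_nhds h₂))
  have hd : 0 < dist z₁ z₂ := dist_pos.2 hz
  obtain ⟨r, hr, hrR⟩ := exists_between (lt_min hR hd)
  have hrR' : r < R := hrR.trans_le (min_le_left _ _)
  have hsub : closedBall z₂ r ⊆ U := fun z hz =>
    (hRs z (closedBall_subset_ball hrR' hz)).2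
  obtain ⟨w₀, hw₀, hmin⟩ := (isCompact_sphere z₂ r).exists_isMinOn
    (NormedSpace.sphere_nonempty.2 hr.le)
    (((hf.continuousOn.mono (sphere_subset_closedBall.trans hsub)).sub
      (continuousOn_const (c := f z₁))).norm)
  set m := ‖f w₀ - f z₁‖ with hm
  have hw₀' : w₀ ≠ z₂ := fun h => hr.ne' (by rw [← mem_sphere.1 hw₀, h, dist_self])
  have hm0 : 0 < m := norm_pos_iff.2 ((hRs w₀ (closedBall_subset_ball hrR'
    (sphere_subset_closedBall hw₀))).1 hw₀')
  have hunif := (tendstoLocallyUniformlyOn_iff_forall_isCompact hU).1 hlim _ hsub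
    (isCompact_closedBall z₂ r)
  have hpt : ∀ᶠ n in p, dist (F n z₁) (f z₁) < m / 4 :=
    Metric.tendsto_nhds.1 (hlim.tendsto_at h₁) _ (by positivity)
  obtain ⟨n, hn, hn₁⟩ := ((Metric.tendstoUniformlyOn_iff.1 hunif (m / 4) (by positivity)).and
    hpt).exists
  have hz₁ : z₁ ∉ closedBall z₂ r := fun h =>
    absurd (mem_closedBall.1 h) (not_le.2 (hrR.trans_le (min_le_right _ _)))
  have hn0 : ∀ z ∈ closedBall z₂ r, F n z - F n z₁ ≠ 0 := fun z hz h =>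
    hz₁ (hinj n (hsub hz) h₁ (sub_eq_zero.1 h) ▸ hz)
  have hdc : DiffContOnCl ℂ (fun z => (F n z - F n z₁)⁻¹) (ball z₂ r) := by
    refine DifferentiableOn.diffContOnCl ?_
    rw [closure_ball _ hr.ne']
    exact (((hF n).mono hsub).sub_const _).inv hn0
  have hkey : ‖(F n z₂ - F n z₁)⁻¹‖ ≤ (m / 2)⁻¹ := by
    refine Complex.norm_le_of_forall_mem_frontier_norm_le isBounded_ball hdc (fun z hz => ?_)
      (subset_closure (mem_ball_self hr))
    rw [frontier_ball _ hr.ne'] at hz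
    rw [norm_inv]
    gcongr
    have h1 : m ≤ ‖f z - f z₁‖ := hmin hz
    have h2 := hn z (sphere_subset_closedBall hz)
    rw [dist_eq_norm] at h2 hn₁
    have h3 : f z - f z₁ = (f z - F n z) + (F n z - F n z₁) + (F n z₁ - f z₁) := by ring
    rw [h3] at h1
    linarith [norm_add₃_le (a := f z - F n z) (b := F n z - F n z₁) (c := F n z₁ - f z₁)]
  rw [norm_inv, inv_le_inv₀ (norm_pos_iff.2 (hn0 z₂ (mem_closedBall_self hr.le)))
    (by positivity)] at hkey
  have h2 := hn z₂ (mem_closedBall_self hr.le)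
  rw [dist_comm, ← heq] at h2
  rw [← dist_eq_norm] at hkey
  have := dist_triangle_right (F n z₂) (F n z₁) (f z₁)
  linarith

theorem exists_isMaxOn_isRiemannCandidate {U : Set ℂ} {z₀ : ℂ} (hU : IsOpen U)
    (hb : Bornology.IsBounded U) (hU' : IsPreconnected U) (hz₀ : z₀ ∈ U) :
    ∃ f, IsRiemannCandidate U z₀ f ∧ deriv f z₀ ≠ 0 ∧
      ∀ k, IsRiemannCandidate U z₀ k → ‖deriv k z₀‖ ≤ ‖deriv f z₀‖ := by
  set S : Set ℝ := (fun f => ‖deriv f z₀‖) '' {f | IsRiemannCandidate U z₀ f} with hS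
  obtain ⟨R, hR, hRU⟩ := Metric.isOpen_iff.1 hU z₀ hz₀
  have hbdd : BddAbove S := by
    refine ⟨1 / (R / 2), ?_⟩
    rintro _ ⟨f, hf, rfl⟩
    have hsub : closedBall z₀ (R / 2) ⊆ U := (closedBall_subset_ball (by linarith)).trans hRU
    refine Complex.norm_deriv_le_of_forall_mem_sphere_norm_le (by positivity)
      (DifferentiableOn.diffContOnCl ?_)
      (fun z hz => (IsRiemannCandidate.mapsTo hf z (hsub (sphere_subset_closedBall hz))).le)
    rw [closure_ball _ (by positivity)]
    exact (IsRiemannCandidate.differentiableOn hf).mono hsub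
  obtain ⟨M, hM, hMU⟩ := hb.subset_ball_lt 0 z₀
  have hlin : IsRiemannCandidate U z₀ (fun z => (M : ℂ)⁻¹ * (z - z₀)) := by
    have hM0 : (M : ℂ)⁻¹ ≠ 0 := inv_ne_zero (by exact_mod_cast hM.ne')
    refine ⟨by fun_prop, fun z _ w _ h => ?_, fun z hz => ?_, by simp⟩
    · simpa [hM.ne'] using h
    · have := hMU hz
      rw [mem_ball, dist_eq_norm] at this
      rw [norm_mul, norm_inv, Complex.norm_real, Real.norm_of_nonneg hM.le,
        inv_mul_lt_one₀ hM]
      exact this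
  have hlind : deriv (fun z => (M : ℂ)⁻¹ * (z - z₀)) z₀ = (M : ℂ)⁻¹ := by
    have : HasDerivAt (fun z => (M : ℂ)⁻¹ * (z - z₀)) ((M : ℂ)⁻¹ * 1) z₀ :=
      ((hasDerivAt_id z₀).sub_const z₀).const_mul _
    rw [this.deriv, mul_one]
  obtain ⟨u, -, hu, huS⟩ := exists_seq_tendsto_sSup ⟨_, mem_image_of_mem _ hlin⟩ hbdd
  choose F hF hFu using huS
  replace hF : ∀ n, IsRiemannCandidate U z₀ (F n) := hF
  set p : Ultrafilter ℕ := hyperfilter ℕ with hp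
  have hlim : ∀ z ∈ U, ∃ a, Tendsto (fun n => F n z) p (𝓝 a) := by
    intro z hz
    obtain ⟨a, -, ha⟩ := (isCompact_closedBall (0 : ℂ) 1).ultrafilter_le_nhds
      (p.map fun n => F n z) (by
        rw [le_principal_iff]
        exact mem_map.2 (univ_mem' fun n => mem_closedBall_zero_iff.2 ((hF n).mapsTo z hz).le))
    exact ⟨a, ha⟩
  choose! f hf using hlim
  have hunif := tendstoLocallyUniformlyOn_of_norm_le hU (fun n => (hF n).differentiableOn)
    (fun n z hz => ((hF n).mapsTo z hz).le) hf
  have hFd := Eventually.of_forall (f := (p : Filter ℕ)) fun n => (hF n).differentiableOn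
  have hfd := hunif.differentiableOn hFd hU
  have hder : ‖deriv f z₀‖ = sSup S := by
    refine tendsto_nhds_unique ((hunif.deriv hFd hU).tendsto_at hz₀).norm ?_
    refine (hu.mono_left Nat.hyperfilter_le_atTop).congr fun n => ?_
    exact (hFu n).symm
  have hmax : ∀ k, IsRiemannCandidate U z₀ k → ‖deriv k z₀‖ ≤ ‖deriv f z₀‖ := fun k hk => by
    rw [hder]
    exact le_csSup hbdd ⟨k, hk, rfl⟩
  have hd0 : deriv f z₀ ≠ 0 := by
    have := hmax _ hlin
    rw [hlind] at this
    rw [← norm_pos_iff]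
    exact lt_of_lt_of_le (norm_pos_iff.2 (inv_ne_zero (by exact_mod_cast hM.ne'))) this
  have hne : ¬ ∃ a, ∀ z ∈ U, f z = a := by
    rintro ⟨a, ha⟩
    refine hd0 ?_
    rw [(Filter.eventuallyEq_of_mem (hU.mem_nhds hz₀) ha : f =ᶠ[𝓝 z₀] fun _ => a).deriv_eq,
      deriv_const]
  refine ⟨f, ⟨hfd, hunif.injOn_of_injOn hU hU' (fun n => (hF n).differentiableOn)
    (fun n => (hF n).injOn) hne, fun z hz => ?_, ?_⟩, hd0, hmax⟩
  · have hopen := ((hfd.analyticOnNhd hU).is_constant_or_isOpen hU').resolve_left hne U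
      Subset.rfl hU
    have hsub : f '' U ⊆ closedBall 0 1 := by
      rintro _ ⟨w, hw, rfl⟩
      refine mem_closedBall_zero_iff.2 (le_of_tendsto (hf w hw).norm
        (Eventually.of_forall fun n => ((hF n).mapsTo w hw).le))
    have := interior_maximal hsub hopen (mem_image_of_mem f hz)
    rwa [interior_closedBall _ one_ne_zero, mem_ball_zero_iff] at this
  · exact tendsto_nhds_unique (hf z₀ hz₀) (by simp [(hF _).map_base])

/-- **Riemann mapping theorem** for bounded planar domains with connected complement. -/
theorem exists_biholomorphic_ball {U : Set ℂ} {z₀ : ℂ} (hU : IsOpen U)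
    (hb : Bornology.IsBounded U) (hU' : IsPreconnected U) (hc : IsPreconnected Uᶜ) (hz₀ : z₀ ∈ U) :
    ∃ ψ φ : ℂ → ℂ, DifferentiableOn ℂ ψ (ball 0 1) ∧ ContinuousOn φ U ∧
      MapsTo ψ (ball 0 1) U ∧ MapsTo φ U (ball 0 1) ∧
      LeftInvOn φ ψ (ball 0 1) ∧ LeftInvOn ψ φ U := by
  obtain ⟨φ, hφ, hd, hmax⟩ := exists_isMaxOn_isRiemannCandidate hU hb hU' hz₀
  have hsurj : SurjOn φ U (ball 0 1) := by
    intro c hc'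
    by_contra hcf
    obtain ⟨k, hk, hlt⟩ := hφ.exists_norm_deriv_lt hU hz₀
      (fun g hg h0 => exists_sqrt_of_isPreconnected_compl hU hb ⟨⟨z₀, hz₀⟩, hU'⟩ hc hg h0) hd
      (mem_ball_zero_iff.1 hc') hcf
    exact absurd (hmax k hk) (not_le.2 hlt)
  have hmap : MapsTo φ U (ball 0 1) := fun z hz => mem_ball_zero_iff.2 (hφ.mapsTo z hz)
  set ψ := Function.invFunOn φ U with hψ
  have hright : LeftInvOn φ ψ (ball 0 1) := hsurj.rightInvOn_invFunOn
  have hψU : MapsTo ψ (ball 0 1) U := hsurj.mapsTo_invFunOn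
  have hleft : LeftInvOn ψ φ U := hφ.injOn.leftInvOn_invFunOn
  have han : AnalyticOnNhd ℂ φ U := hφ.differentiableOn.analyticOnNhd hU
  have hne : ¬ ∃ a, ∀ z ∈ U, φ z = a := by
    rintro ⟨a, ha⟩
    refine hd ?_
    rw [(Filter.eventuallyEq_of_mem (hU.mem_nhds hz₀) ha : φ =ᶠ[𝓝 z₀] fun _ => a).deriv_eq,
      deriv_const]
  have hopen := (han.is_constant_or_isOpen hU').resolve_left hne
  have hψc : ∀ w ∈ ball (0 : ℂ) 1, ContinuousAt ψ w := by
    intro w hw s hs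
    obtain ⟨t, hts, hto, hwt⟩ := _root_.mem_nhds_iff.1 (inter_mem hs (hU.mem_nhds (hψU hw)))
    refine mem_map.2 (mem_of_superset ((hopen t (fun x hx => (hts hx).2) hto).mem_nhds
      ⟨ψ w, hwt, hright hw⟩) ?_)
    rintro _ ⟨x, hx, rfl⟩
    rw [mem_preimage, hleft (hts hx).2]
    exact (hts hx).1
  have hψd : ∀ w ∈ ball (0 : ℂ) 1, deriv φ (ψ w) ≠ 0 → DifferentiableAt ℂ ψ w := by
    intro w hw h0
    refine (HasDerivAt.of_local_left_inverse (hψc w hw)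
      (han _ (hψU hw)).differentiableAt.hasDerivAt h0 ?_).differentiableAt
    filter_upwards [isOpen_ball.mem_nhds hw] with x hx using hright hx
  have hiso : ∀ w ∈ ball (0 : ℂ) 1, ∀ᶠ x in 𝓝[≠] w, DifferentiableAt ℂ ψ x := by
    intro w hw
    have h1 : ∀ᶠ z in 𝓝[≠] (ψ w), deriv φ z ≠ 0 := by
      refine ((han.deriv) (ψ w) (hψU hw)).eventually_eq_zero_or_eventually_ne_zero.resolve_left
        fun h => hd ?_
      exact han.deriv.eqOn_zero_of_preconnected_of_eventuallyEq_zero hU' (hψU hw) h hz₀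
    have h2 : Tendsto ψ (𝓝[≠] w) (𝓝[≠] (ψ w)) := by
      refine tendsto_nhdsWithin_iff.2 ⟨(hψc w hw).tendsto.mono_left nhdsWithin_le_nhds, ?_⟩
      filter_upwards [self_mem_nhdsWithin, mem_nhdsWithin_of_mem_nhds (isOpen_ball.mem_nhds hw)]
        with x hx hxb h
      exact hx (by rw [mem_singleton_iff, ← hright hxb, h, hright hw])
    filter_upwards [h2.eventually h1, mem_nhdsWithin_of_mem_nhds (isOpen_ball.mem_nhds hw)]
      with x hx hxb using hψd x hxb hx
  refine ⟨ψ, φ, fun w hw => ?_, hφ.differentiableOn.continuousOn, hψU, hmap, hright, hleft⟩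
  exact (Complex.analyticAt_of_differentiable_on_punctured_nhds_of_continuousAt (hiso w hw)
    (hψc w hw)).differentiableAt.differentiableWithinAt

theorem lintegral_sq_norm_deriv_eq_volume_image {Ω : Set ℂ} (hΩ : IsOpen Ω) {F : ℂ → ℂ}
    (hF : DifferentiableOn ℂ F Ω) (hinj : InjOn F Ω) :
    ∫⁻ w in Ω, ENNReal.ofReal (‖deriv F w‖ ^ 2) = MeasureTheory.volume (F '' Ω) := by
  rw [← MeasureTheory.lintegral_abs_det_fderiv_eq_addHaar_image MeasureTheory.volume
    hΩ.measurableSet (fun x hx => (((hF.differentiableAt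
      (hΩ.mem_nhds hx)).hasDerivAt.hasFDerivAt.restrictScalars ℝ).hasFDerivWithinAt)) hinj]
  refine MeasureTheory.setLIntegral_congr_fun hΩ.measurableSet fun w _ => ?_
  rw [ContinuousLinearMap.det, ContinuousLinearMap.coe_restrictScalars,
    LinearMap.det_restrictScalars, Algebra.norm_complex_apply, Complex.normSq_eq_norm_sq,
    abs_of_nonneg (sq_nonneg _), LinearMap.det_ring]
  simp

/-- The **length-area principle** on a region with convex vertical slices. -/
theorem exists_vertical_slice_dist_lt {Ω : Set ℂ} (hΩ : IsOpen Ω) {F : ℂ → ℂ}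
    (hF : DifferentiableOn ℂ F Ω) (hinj : InjOn F Ω) (hb : Bornology.IsBounded (F '' Ω))
    (hπ : ∀ w ∈ Ω, |w.im| ≤ Real.pi)
    (hslice : ∀ s : ℝ, OrdConnected {θ : ℝ | (⟨s, θ⟩ : ℂ) ∈ Ω})
    {η : ℝ} (hη : 0 < η) (s₀ : ℝ) :
    ∃ s < s₀, ∀ θ₁ θ₂ : ℝ, (⟨s, θ₁⟩ : ℂ) ∈ Ω → (⟨s, θ₂⟩ : ℂ) ∈ Ω →
      dist (F ⟨s, θ₁⟩) (F ⟨s, θ₂⟩) < η := by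
  set g : ℂ → ENNReal := Ω.indicator fun w => ENNReal.ofReal (‖deriv F w‖ ^ 2) with hg
  have hgm : Measurable g :=
    (Measurable.ennreal_ofReal ((measurable_deriv F).norm.pow_const 2)).indicator
      hΩ.measurableSet
  have hfin : ∫⁻ s : ℝ, ∫⁻ θ : ℝ, g ⟨s, θ⟩ < ⊤ := by
    have h1 : ∫⁻ w, g w < ⊤ := by
      rw [MeasureTheory.lintegral_indicator hΩ.measurableSet,
        lintegral_sq_norm_deriv_eq_volume_image hΩ hF hinj]
      exact hb.measure_lt_top
    have h2 := (Complex.volume_preserving_equiv_real_prod.symm).lintegral_comp_emb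
      Complex.measurableEquivRealProd.symm.measurableEmbedding g
    have hm : Measurable fun p : ℝ × ℝ => g (Complex.measurableEquivRealProd.symm p) :=
      hgm.comp Complex.measurableEquivRealProd.symm.measurable
    rw [← h2, MeasureTheory.Measure.volume_eq_prod,
      MeasureTheory.lintegral_prod _ hm.aemeasurable] at h1
    exact h1
  set δ : ℝ := η / (4 * Real.pi) with hδ
  have hπ0 := Real.pi_pos
  have hδ0 : 0 < δ := by positivity
  set ε : ℝ := δ * η / 2 with hε
  have hε0 : 0 < ε := by positivity
  obtain ⟨s, hs, hsε⟩ : ∃ s < s₀, ∫⁻ θ : ℝ, g ⟨s, θ⟩ < ENNReal.ofReal ε := by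
    by_contra! hcon
    refine hfin.ne (top_unique ?_)
    calc (⊤ : ENNReal) = ∫⁻ s in Iio s₀, ENNReal.ofReal ε := by
          rw [MeasureTheory.setLIntegral_const, Real.volume_Iio, ENNReal.mul_top]
          simpa using hε0
      _ ≤ ∫⁻ s in Iio s₀, ∫⁻ θ : ℝ, g ⟨s, θ⟩ :=
          MeasureTheory.setLIntegral_mono' measurableSet_Iio hcon
      _ ≤ _ := MeasureTheory.setLIntegral_le_lintegral _ _
  refine ⟨s, hs, ?_⟩
  have key : ∀ θ₁ θ₂ : ℝ, θ₁ ≤ θ₂ → (⟨s, θ₁⟩ : ℂ) ∈ Ω → (⟨s, θ₂⟩ : ℂ) ∈ Ω →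
      dist (F ⟨s, θ₁⟩) (F ⟨s, θ₂⟩) < η := by
    intro θ₁ θ₂ hle h₁ h₂
    have hI : ∀ θ ∈ Icc θ₁ θ₂, (⟨s, θ⟩ : ℂ) ∈ Ω := fun θ hθ => (hslice s).out h₁ h₂ hθ
    have hmk : ∀ θ : ℝ, (⟨s, θ⟩ : ℂ) = s + θ * Complex.I := fun θ => Complex.mk_eq_add_mul_I s θ
    have hcont : Continuous fun θ : ℝ => (⟨s, θ⟩ : ℂ) := by
      simp only [hmk]; fun_prop
    have hdc : ContinuousOn (fun θ : ℝ => deriv F ⟨s, θ⟩) (Icc θ₁ θ₂) :=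
      ((hF.deriv hΩ).continuousOn).comp hcont.continuousOn hI
    have hder : ∀ θ ∈ uIcc θ₁ θ₂, HasDerivAt (fun θ : ℝ => F ⟨s, θ⟩)
        (deriv F ⟨s, θ⟩ * Complex.I) θ := by
      intro θ hθ
      rw [uIcc_of_le hle] at hθ
      have h1 := (hF.differentiableAt (hΩ.mem_nhds (hI θ hθ))).hasDerivAt
      have h2 : HasDerivAt (fun θ : ℝ => (⟨s, θ⟩ : ℂ)) Complex.I θ := by
        simp only [hmk]
        simpa using ((Complex.ofRealCLM.hasDerivAt (x := θ)).mul_const Complex.I).const_add (s : ℂ)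
      exact h1.comp θ h2
    have h_int : IntervalIntegrable (fun θ : ℝ => deriv F ⟨s, θ⟩ * Complex.I)
        MeasureTheory.volume θ₁ θ₂ := by
      refine ContinuousOn.intervalIntegrable ?_
      rw [uIcc_of_le hle]
      exact hdc.mul continuousOn_const
    have hsq : ContinuousOn (fun θ : ℝ => ‖deriv F ⟨s, θ⟩‖ ^ 2) (Icc θ₁ θ₂) := hdc.norm.pow 2
    have hsqi : ∫ θ in θ₁..θ₂, ‖deriv F ⟨s, θ⟩‖ ^ 2 < ε := by
      rw [intervalIntegral.integral_of_le hle, ← ENNReal.ofReal_lt_ofReal_iff hε0,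
        MeasureTheory.ofReal_integral_eq_lintegral_ofReal
          ((hsq.integrableOn_Icc).mono_set Ioc_subset_Icc_self)
          (Eventually.of_forall fun _ => sq_nonneg _)]
      refine lt_of_le_of_lt ?_ hsε
      refine le_trans ?_ (MeasureTheory.setLIntegral_le_lintegral (Ioc θ₁ θ₂) _)
      refine MeasureTheory.setLIntegral_mono' measurableSet_Ioc fun θ hθ => ?_
      rw [hg, indicator_of_mem (hI θ (Ioc_subset_Icc_self hθ))]
    have hlen : θ₂ - θ₁ ≤ 2 * Real.pi := by
      have := abs_le.1 (hπ _ h₁)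
      have := abs_le.1 (hπ _ h₂)
      linarith
    rw [dist_comm, dist_eq_norm, ← intervalIntegral.integral_eq_sub_of_hasDerivAt hder h_int]
    refine (intervalIntegral.norm_integral_le_integral_norm hle).trans_lt ?_
    have hsqI : IntervalIntegrable (fun θ : ℝ => ‖deriv F ⟨s, θ⟩‖ ^ 2)
        MeasureTheory.volume θ₁ θ₂ :=
      ContinuousOn.intervalIntegrable (by rwa [uIcc_of_le hle])
    calc ∫ θ in θ₁..θ₂, ‖deriv F ⟨s, θ⟩ * Complex.I‖
        ≤ ∫ θ in θ₁..θ₂, (δ / 2 + ‖deriv F ⟨s, θ⟩‖ ^ 2 * (1 / (2 * δ))) := by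
          refine intervalIntegral.integral_mono_on hle h_int.norm
            (intervalIntegrable_const.add (hsqI.mul_const _)) fun θ _ => ?_
          rw [norm_mul, Complex.norm_I, mul_one]
          set x := ‖deriv F ⟨s, θ⟩‖
          have : δ / 2 + x ^ 2 * (1 / (2 * δ)) - x = (δ - x) ^ 2 / (2 * δ) := by
            field_simp; ring
          have h2 : 0 ≤ (δ - x) ^ 2 / (2 * δ) := by positivity
          linarith
      _ = (θ₂ - θ₁) * (δ / 2) + (∫ θ in θ₁..θ₂, ‖deriv F ⟨s, θ⟩‖ ^ 2) * (1 / (2 * δ)) := by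
          rw [intervalIntegral.integral_add intervalIntegrable_const (hsqI.mul_const _),
            intervalIntegral.integral_const, intervalIntegral.integral_mul_const, smul_eq_mul]
      _ ≤ (2 * Real.pi) * (δ / 2) + ε * (1 / (2 * δ)) := by gcongr
      _ = η / 2 := by rw [hε, hδ]; field_simp; norm_num
      _ < η := by linarith
  intro θ₁ θ₂ h₁ h₂
  rcases le_total θ₁ θ₂ with h | h
  · exact key _ _ h h₁ h₂
  · rw [dist_comm]; exact key _ _ h h₂ h₁

theorem norm_one_sub_exp_lt_one_iff (w : ℂ) :
    ‖1 - Complex.exp w‖ < 1 ↔ Real.exp w.re < 2 * Real.cos w.im := by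
  have h1 : ‖1 - Complex.exp w‖ ^ 2 =
      1 + Real.exp w.re * (Real.exp w.re - 2 * Real.cos w.im) := by
    rw [← Complex.normSq_eq_norm_sq, Complex.normSq_apply]
    simp only [Complex.sub_re, Complex.sub_im, Complex.exp_re, Complex.exp_im, Complex.one_re,
      Complex.one_im]
    linear_combination (Real.exp w.re) ^ 2 * Real.sin_sq_add_cos_sq w.im
  have h2 := Real.exp_pos w.re
  rw [← sq_lt_one_iff₀ (norm_nonneg _), h1]
  constructor
  · intro h; nlinarith
  · intro h; nlinarith

/-- For a bounded injective holomorphic function on the disk, some arbitrarily small circles around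
a boundary point have small image. -/
theorem exists_sphere_image_dist_lt {ψ : ℂ → ℂ} (hψ : DifferentiableOn ℂ ψ (ball 0 1))
    (hinj : InjOn ψ (ball 0 1)) (hb : Bornology.IsBounded (ψ '' ball 0 1)) {ζ : ℂ} (hζ : ‖ζ‖ = 1)
    {η ρ₀ : ℝ} (hη : 0 < η) (hρ₀ : 0 < ρ₀) :
    ∃ ρ, 0 < ρ ∧ ρ < ρ₀ ∧ ∀ z w : ℂ, z ∈ ball (0 : ℂ) 1 → w ∈ ball (0 : ℂ) 1 → dist z ζ = ρ →
      dist w ζ = ρ → dist (ψ z) (ψ w) < η := by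
  have hζ0 : ζ ≠ 0 := norm_ne_zero_iff.1 (by rw [hζ]; exact one_ne_zero)
  set T : ℂ → ℂ := fun w => ζ * (1 - Complex.exp w) with hT
  set Ω : Set ℂ := {w | |w.im| < Real.pi ∧ Real.exp w.re < 2 * Real.cos w.im} with hΩ
  have hΩo : IsOpen Ω := by
    exact (isOpen_lt (f := fun w : ℂ => |w.im|) (by fun_prop) continuous_const).inter
      (isOpen_lt (f := fun w : ℂ => Real.exp w.re) (g := fun w : ℂ => 2 * Real.cos w.im)
        (by fun_prop) (by fun_prop))
  have hTm : MapsTo T Ω (ball 0 1) := fun w hw => by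
    rw [mem_ball_zero_iff, hT, norm_mul, hζ, one_mul, norm_one_sub_exp_lt_one_iff]
    exact hw.2
  have hTi : InjOn T Ω := fun x hx y hy h => by
    have hx' := abs_lt.1 hx.1
    have hy' := abs_lt.1 hy.1
    refine Complex.exp_inj_of_neg_pi_lt_of_le_pi hx'.1 hx'.2.le hy'.1 hy'.2.le ?_
    have := mul_left_cancel₀ hζ0 h
    linear_combination -this
  have hsurj : ∀ z ∈ ball (0 : ℂ) 1, ∀ s : ℝ, dist z ζ = Real.exp s →
      ∃ θ : ℝ, (⟨s, θ⟩ : ℂ) ∈ Ω ∧ T ⟨s, θ⟩ = z := by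
    intro z hz s hs
    set u : ℂ := 1 - z / ζ with hu
    have hun : ‖u‖ = Real.exp s := by
      rw [← hs, dist_comm, dist_eq_norm, hu]
      have : ζ - z = ζ * (1 - z / ζ) := by field_simp
      rw [this, norm_mul, hζ, one_mul]
    have hu0 : u ≠ 0 := norm_ne_zero_iff.1 (by rw [hun]; exact (Real.exp_pos s).ne')
    have hlog : (⟨s, Complex.arg u⟩ : ℂ) = Complex.log u := by
      rw [Complex.log, hun, Real.log_exp, Complex.mk_eq_add_mul_I]
    have hTz : T ⟨s, Complex.arg u⟩ = z := by
      rw [hT, hlog]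
      dsimp only
      rw [Complex.exp_log hu0, hu, sub_sub_cancel, mul_div_cancel₀ _ hζ0]
    refine ⟨Complex.arg u, ?_, hTz⟩
    have h2 : Real.exp s < 2 * Real.cos (Complex.arg u) := by
      refine (norm_one_sub_exp_lt_one_iff ⟨s, Complex.arg u⟩).1 ?_
      rw [hlog, Complex.exp_log hu0, hu, sub_sub_cancel, norm_div, hζ, div_one]
      exact mem_ball_zero_iff.1 hz
    refine ⟨lt_of_le_of_ne (Complex.abs_arg_le_pi u) fun h => ?_, h2⟩
    have h3 := Real.exp_pos s
    rw [← Real.cos_abs, show |Complex.arg u| = Real.pi from h, Real.cos_pi] at h2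
    linarith
  obtain ⟨s, hs, hsd⟩ := exists_vertical_slice_dist_lt hΩo (F := ψ ∘ T)
    (hψ.comp (by fun_prop) hTm) (hinj.comp hTi hTm)
    (hb.subset (by rw [image_comp]; exact image_mono hTm.image_subset))
    (fun w hw => hw.1.le) (fun s => ⟨fun a ha b hb θ hθ => by
      have hmax : |θ| ≤ max |a| |b| := abs_le_max_abs_abs hθ.1 hθ.2
      rcases le_max_iff.1 hmax with h | h
      · refine ⟨h.trans_lt ha.1, ha.2.trans_le ?_⟩
        have := Real.cos_le_cos_of_nonneg_of_le_pi (abs_nonneg θ) (le_of_lt ha.1) h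
        simp only [Real.cos_abs] at this
        linarith
      · refine ⟨h.trans_lt hb.1, hb.2.trans_le ?_⟩
        have := Real.cos_le_cos_of_nonneg_of_le_pi (abs_nonneg θ) (le_of_lt hb.1) h
        simp only [Real.cos_abs] at this
        linarith⟩) hη (Real.log ρ₀)
  refine ⟨Real.exp s, Real.exp_pos s, (Real.lt_log_iff_exp_lt hρ₀).1 hs, fun z w hz hw h1 h2 => ?_⟩
  obtain ⟨θ₁, hθ₁, rfl⟩ := hsurj z hz s h1
  obtain ⟨θ₂, hθ₂, rfl⟩ := hsurj w hw s h2
  exact hsd θ₁ θ₂ hθ₁ hθ₂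

theorem IsPreconnected.subset_of_disjoint_frontier {X : Type*} [TopologicalSpace X] {U W : Set X}
    (hW : IsPreconnected W) (hU : IsOpen U) (hd : Disjoint W (frontier U))
    (hne : (W ∩ U).Nonempty) :
    W ⊆ U := by
  refine hW.subset_left_of_subset_union hU isClosed_closure.isOpen_compl
    (disjoint_compl_right_iff_subset.2 subset_closure) (fun x hx => ?_) hne
  by_cases h : x ∈ closure U
  · refine Or.inl ?_
    by_contra hxU
    exact disjoint_left.1 hd hx (hU.frontier_eq ▸ ⟨h, hxU⟩)
  · exact Or.inr h

/-- A continuous injection on a compact set has a uniformly continuous inverse. -/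
theorem IsCompact.exists_dist_lt_of_injOn {X Y : Type*} [MetricSpace X] [MetricSpace Y] {s : Set X}
    (hs : IsCompact s) {γ : X → Y} (hγ : ContinuousOn γ s) (hinj : InjOn γ s) {r : ℝ} (hr : 0 < r) :
    ∃ δ > 0, ∀ a ∈ s, ∀ b ∈ s, dist (γ a) (γ b) < δ → dist a b < r := by
  set K : Set (X × X) := (s ×ˢ s) ∩ {p | r ≤ dist p.1 p.2} with hK
  have hKc : IsCompact K := (hs.prod hs).inter_right (isClosed_le continuous_const continuous_dist)
  have hc : ContinuousOn (fun p : X × X => dist (γ p.1) (γ p.2)) K :=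
    continuous_dist.comp_continuousOn ((hγ.comp continuousOn_fst fun _ hp => hp.1.1).prodMk
      (hγ.comp continuousOn_snd fun _ hp => hp.1.2))
  rcases K.eq_empty_or_nonempty with h | h
  · refine ⟨1, one_pos, fun a ha b hb _ => ?_⟩
    by_contra hab
    exact (h ▸ (⟨⟨ha, hb⟩, not_lt.1 hab⟩ : (a, b) ∈ K) : (a, b) ∈ (∅ : Set (X × X)))
  · obtain ⟨p, hp, hmin⟩ := hKc.exists_isMinOn h hc
    refine ⟨dist (γ p.1) (γ p.2), dist_pos.2 fun heq => ?_, fun a ha b hb hab => ?_⟩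
    · have h1 : r ≤ dist p.1 p.2 := hp.2
      rw [hinj hp.1.1 hp.1.2 heq, dist_self] at h1
      exact absurd hr (not_lt.2 h1)
    · by_contra h1
      exact absurd hab (not_lt.2 (hmin (⟨⟨ha, hb⟩, not_lt.1 h1⟩ : (a, b) ∈ K)))

/-- A Jordan curve is locally connected, uniformly. -/
theorem exists_isPreconnected_subset_jordan_curve {γ : ℂ → ℂ} (hγ : ContinuousOn γ (sphere 0 1))
    (hinj : InjOn γ (sphere 0 1)) {ε : ℝ} (hε : 0 < ε) :
    ∃ δ > 0, ∀ p ∈ γ '' sphere 0 1, ∃ J₁, J₁ ⊆ γ '' sphere 0 1 ∧ IsCompact J₁ ∧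
      IsPreconnected J₁ ∧ γ '' sphere 0 1 ∩ ball p δ ⊆ J₁ ∧ J₁ ⊆ ball p ε := by
  obtain ⟨r, hr, hrε⟩ := Metric.uniformContinuousOn_iff.1
    ((isCompact_sphere (0 : ℂ) 1).uniformContinuousOn_of_continuous hγ) ε hε
  set t : ℝ := min (r / 4) (1 / 2) with ht
  have ht0 : 0 < t := by positivity
  have htr : t ≤ r / 4 := min_le_left _ _
  have ht1 : t ≤ 1 / 2 := min_le_right _ _
  obtain ⟨δ, hδ, hδt⟩ := (isCompact_sphere (0 : ℂ) 1).exists_dist_lt_of_injOn hγ hinj ht0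
  refine ⟨δ, hδ, ?_⟩
  rintro _ ⟨u, hu, rfl⟩
  set N : ℂ → ℂ := fun x => x / (‖x‖ : ℂ) with hN
  have hu1 : ‖u‖ = 1 := mem_sphere_zero_iff_norm.1 hu
  have h0 : ∀ x ∈ closedBall u t, x ≠ 0 := by
    rintro x hx rfl
    rw [mem_closedBall, dist_comm, dist_zero_right, hu1] at hx
    linarith
  have hNc : ContinuousOn N (closedBall u t) :=
    continuousOn_id.div (by fun_prop) fun x hx => by simpa using h0 x hx
  have hNs : MapsTo N (closedBall u t) (sphere 0 1) := fun x hx => by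
    simp [hN, h0 x hx]
  have hNd : ∀ x ∈ closedBall u t, dist (N x) u ≤ 2 * t := by
    intro x hx
    have hx0 : (‖x‖ : ℂ) ≠ 0 := by simpa using h0 x hx
    have h1 : dist (N x) x ≤ dist x u := by
      have h2 : N x - x = N x * (1 - (‖x‖ : ℝ) : ℝ) := by
        rw [hN]; push_cast; field_simp
      rw [dist_eq_norm, h2, norm_mul, mem_sphere_zero_iff_norm.1 (hNs hx), one_mul,
        Complex.norm_real, Real.norm_eq_abs, ← hu1, abs_sub_comm, dist_eq_norm]
      exact abs_norm_sub_norm_le x u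
    have := dist_triangle (N x) x u
    linarith [mem_closedBall.1 hx]
  refine ⟨(γ ∘ N) '' closedBall u t, ?_, (isCompact_closedBall u t).image_of_continuousOn
    (hγ.comp hNc hNs), (convex_closedBall u t).isPreconnected.image _ (hγ.comp hNc hNs), ?_, ?_⟩
  · rw [image_comp]
    exact image_mono hNs.image_subset
  · rintro _ ⟨⟨v, hv, rfl⟩, hvδ⟩
    refine ⟨v, (hδt v hv u hu hvδ).le, ?_⟩
    simp [hN, mem_sphere_zero_iff_norm.1 hv]
  · rintro _ ⟨x, hx, rfl⟩
    exact hrε _ (hNs hx) _ hu (by linarith [hNd x hx])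

/-- A Riemann map `ψ` onto a bounded domain `U` whose boundary lies on the compact set `J`. -/
structure IsRiemannMap (U J : Set ℂ) (ψ φ : ℂ → ℂ) : Prop where
  isOpen : IsOpen U
  isBounded : Bornology.IsBounded U
  isCompact : IsCompact J
  frontier_subset : frontier U ⊆ J
  disjoint : Disjoint U J
  differentiableOn : DifferentiableOn ℂ ψ (ball 0 1)
  continuousOn : ContinuousOn φ U
  mapsTo : MapsTo ψ (ball 0 1) U
  mapsTo_symm : MapsTo φ U (ball 0 1)
  leftInvOn : LeftInvOn φ ψ (ball 0 1)
  rightInvOn : LeftInvOn ψ φ U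

namespace IsRiemannMap

variable {U J : Set ℂ} {ψ φ : ℂ → ℂ}

theorem image_ball (h : IsRiemannMap U J ψ φ) : ψ '' ball 0 1 = U :=
  h.mapsTo.image_subset.antisymm fun x hx => ⟨φ x, h.mapsTo_symm hx, h.rightInvOn hx⟩

theorem exists_isPreconnected (h : IsRiemannMap U J ψ φ) {A S : Set ℂ} (hA : IsCompact A)
    (hAJ : IsPreconnected (A ∩ J)) (hS : IsPreconnected S) (hSA : Disjoint S A) {z w : ℂ}
    (hz : z ∈ ball (0 : ℂ) 1) (hw : w ∈ ball (0 : ℂ) 1) (hzS : ψ z ∈ S) (hwS : ψ w ∈ S) :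
    ∃ W ⊆ ball (0 : ℂ) 1, IsPreconnected W ∧ z ∈ W ∧ w ∈ W ∧ ∀ x ∈ W, ψ x ∉ A := by
  have hU : IsPreconnected U := by
    rw [← h.image_ball]
    exact (convex_ball 0 1).isPreconnected.image _ h.differentiableOn.continuousOn
  obtain ⟨W, hW, hWd, hzW, hwW⟩ := exists_isPreconnected_of_union hA h.isCompact hAJ hS hSA hU
    h.disjoint hzS hwS (h.mapsTo hz) (h.mapsTo hw)
  have hWU : W ⊆ U := hW.subset_of_disjoint_frontier h.isOpen
    (hWd.mono_right (h.frontier_subset.trans subset_union_right)) ⟨ψ z, hzW, h.mapsTo hz⟩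
  refine ⟨φ '' W, (h.mapsTo_symm.mono_left hWU).image_subset, hW.image _ (h.continuousOn.mono hWU),
    ⟨ψ z, hzW, h.leftInvOn hz⟩, ⟨ψ w, hwW, h.leftInvOn hw⟩, ?_⟩
  rintro _ ⟨x, hx, rfl⟩ hxA
  rw [h.rightInvOn (hWU hx)] at hxA
  exact disjoint_left.1 hWd hx (Or.inl hxA)

theorem closure_image_inter_nonempty (h : IsRiemannMap U J ψ φ) {C : Set ℂ} (hC : C ⊆ ball 0 1)
    {b : ℂ} (hb : b ∉ ball (0 : ℂ) 1) (hbC : b ∈ closure C) : (closure (ψ '' C) ∩ J).Nonempty := by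
  by_contra hne
  have hsub : closure (ψ '' C) ⊆ U := by
    intro x hx
    by_contra hxU
    have : x ∈ closure U := closure_mono ((h.mapsTo.mono_left hC).image_subset) hx
    exact hne ⟨x, hx, h.frontier_subset (h.isOpen.frontier_eq ▸ ⟨this, hxU⟩)⟩
  have hcomp : IsCompact (closure (ψ '' C)) :=
    (h.isBounded.subset ((h.mapsTo.mono_left hC).image_subset)).isCompact_closure
  have hφ : IsCompact (φ '' closure (ψ '' C)) :=
    hcomp.image_of_continuousOn (h.continuousOn.mono hsub)
  have hCφ : C ⊆ φ '' closure (ψ '' C) := fun x hx =>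
    ⟨ψ x, subset_closure ⟨x, hx, rfl⟩, h.leftInvOn (hC hx)⟩
  exact hb ((h.mapsTo_symm.mono_left hsub).image_subset
    (closure_minimal hCφ hφ.isClosed hbC))

end IsRiemannMap

theorem exists_mem_closure_ball_inter_sphere {ζ : ℂ} (hζ : ‖ζ‖ = 1) {ρ : ℝ} (hρ : 0 < ρ)
    (hρ1 : ρ < 1) : ∃ b ∉ ball (0 : ℂ) 1, b ∈ closure (ball (0 : ℂ) 1 ∩ sphere ζ ρ) := by
  set a := Real.arccos (ρ / 2) with ha
  have ha0 : 0 < a := Real.arccos_pos.2 (by linarith)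
  have haπ : a ≤ Real.pi := Real.arccos_le_pi _
  have hcos : Real.cos a = ρ / 2 := Real.cos_arccos (by linarith) (by linarith)
  set T : ℝ → ℂ := fun θ => ζ * (1 - Complex.exp ⟨Real.log ρ, θ⟩) with hT
  have hTc : Continuous T := by
    have : T = fun θ : ℝ => ζ * (1 - Complex.exp (Real.log ρ + θ * Complex.I)) := by
      funext θ; rw [hT]; dsimp only; rw [Complex.mk_eq_add_mul_I]
    rw [this]; fun_prop
  refine ⟨T a, ?_, ?_⟩
  · rw [mem_ball_zero_iff, hT, norm_mul, hζ, one_mul, norm_one_sub_exp_lt_one_iff]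
    simp only [Real.exp_log hρ, hcos]
    linarith
  · have hsub : T '' Ioo 0 a ⊆ ball (0 : ℂ) 1 ∩ sphere ζ ρ := by
      rintro _ ⟨θ, hθ, rfl⟩
      constructor
      · rw [mem_ball_zero_iff, hT, norm_mul, hζ, one_mul, norm_one_sub_exp_lt_one_iff]
        simp only [Real.exp_log hρ]
        have := Real.cos_lt_cos_of_nonneg_of_le_pi hθ.1.le haπ hθ.2
        linarith
      · rw [mem_sphere, dist_eq_norm, hT]
        have : ζ * (1 - Complex.exp ⟨Real.log ρ, θ⟩) - ζ =
          -(ζ * Complex.exp ⟨Real.log ρ, θ⟩) := by ring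
        rw [this, norm_neg, norm_mul, hζ, one_mul, Complex.norm_exp, Real.exp_log hρ]
    refine closure_mono hsub (image_closure_subset_closure_image hTc ⟨a, ?_, rfl⟩)
    rw [closure_Ioo ha0.ne]
    exact right_mem_Icc.2 ha0.le

/-- Boundary behaviour of a Riemann map onto a Jordan domain: images of small half-disks are
small. -/
theorem IsRiemannMap.exists_image_subset_closedBall {U : Set ℂ} {ψ φ γ : ℂ → ℂ}
    (hγ : ContinuousOn γ (sphere 0 1)) (hinj : InjOn γ (sphere 0 1))
    (h : IsRiemannMap U (γ '' sphere 0 1) ψ φ) {ζ : ℂ} (hζ : ‖ζ‖ = 1) {ε : ℝ} (hε : 0 < ε) :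
    ∃ ρ > 0, ∃ p, ∀ z ∈ ball (0 : ℂ) 1 ∩ ball ζ ρ, ψ z ∈ closedBall p ε := by
  set J := γ '' sphere 0 1 with hJ
  have h0 : (0 : ℂ) ∈ ball (0 : ℂ) 1 := mem_ball_self one_pos
  have hψ0 : ψ 0 ∈ Jᶜ := fun hm => disjoint_left.1 h.disjoint (h.mapsTo h0) hm
  obtain ⟨d, hd, hdJ⟩ := Metric.isOpen_iff.1 h.isCompact.isClosed.isOpen_compl _ hψ0
  set e : ℝ := min ε (d / 2) with he
  have he0 : 0 < e := by positivity
  obtain ⟨δ, hδ, hδJ⟩ := exists_isPreconnected_subset_jordan_curve hγ hinj he0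
  set η : ℝ := min (δ / 2) (e / 2) with hη
  have hη0 : 0 < η := by positivity
  obtain ⟨ρ, hρ, hρ1, hρη⟩ := exists_sphere_image_dist_lt h.differentiableOn h.leftInvOn.injOn
    (h.image_ball.symm ▸ h.isBounded) hζ hη0 one_pos
  set C := ball (0 : ℂ) 1 ∩ sphere ζ ρ with hC
  set K := closure (ψ '' C) with hK
  obtain ⟨b, hb, hbC⟩ := exists_mem_closure_ball_inter_sphere hζ hρ hρ1
  obtain ⟨p, hpK, hpJ⟩ := h.closure_image_inter_nonempty inter_subset_left hb hbC
  have hdiam : ∀ x ∈ K, dist x p ≤ η := by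
    have hcl : IsClosed {q : ℂ × ℂ | dist q.1 q.2 ≤ η} :=
      isClosed_le continuous_dist continuous_const
    have hsub : closure ((ψ '' C) ×ˢ (ψ '' C)) ⊆ {q : ℂ × ℂ | dist q.1 q.2 ≤ η} := by
      refine closure_minimal ?_ hcl
      rintro ⟨_, _⟩ ⟨⟨z, hz, rfl⟩, ⟨w, hw, rfl⟩⟩
      exact (hρη z w hz.1 hw.1 hz.2 hw.2).le
    rw [closure_prod_eq] at hsub
    exact fun x hx => hsub (⟨hx, hpK⟩ : (x, p) ∈ K ×ˢ K)
  obtain ⟨J₁, hJ₁J, hJ₁c, hJ₁p, hJ₁δ, hJ₁e⟩ := hδJ p hpJ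
  have hKc : IsCompact K :=
    (h.isBounded.subset ((h.mapsTo.mono_left inter_subset_left).image_subset)).isCompact_closure
  have hAJ : (K ∪ J₁) ∩ J = J₁ := by
    refine Subset.antisymm ?_ fun x hx => ⟨Or.inr hx, hJ₁J hx⟩
    rintro x ⟨hx | hx, hxJ⟩
    · refine hJ₁δ ⟨hxJ, (hdiam x hx).trans_lt ?_⟩
      exact (min_le_left _ _).trans_lt (half_lt_self hδ)
    · exact hx
  have hAe : K ∪ J₁ ⊆ closedBall p e := by
    refine union_subset (fun x hx => (hdiam x hx).trans ?_) (hJ₁e.trans ball_subset_closedBall)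
    exact (min_le_right _ _).trans (half_le_self he0.le)
  refine ⟨ρ, hρ, p, fun z hz => ?_⟩
  by_contra hzp
  obtain ⟨W, hWb, hW, hzW, h0W, hWA⟩ := h.exists_isPreconnected (hKc.union hJ₁c)
    (by rw [hAJ]; exact hJ₁p) (isPreconnected_compl_closedBall_complex p e)
    (disjoint_compl_left_iff_subset.2 hAe) hz.1 h0
    (fun hm => hzp (closedBall_subset_closedBall (min_le_left _ _) hm)) (fun hm => by
      have h1 : p ∉ ball (ψ 0) d := fun hm => hdJ hm hpJ
      refine h1 ?_
      rw [mem_ball, dist_comm]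
      exact (mem_closedBall.1 hm).trans_lt
        ((min_le_right _ _).trans_lt (half_lt_self hd)))
  obtain ⟨x, hxW, hx⟩ := hW.intermediate_value hzW h0W
    (f := fun x => dist x ζ) (by fun_prop)
    (⟨(mem_ball.1 hz.2).le, by simpa [hζ] using hρ1.le⟩ : ρ ∈ Icc (dist z ζ) (dist 0 ζ))
  exact hWA x hxW (Or.inl (subset_closure ⟨x, ⟨hWb hxW, hx⟩, rfl⟩))

theorem IsCompact.continuousOn_invFunOn {X Y : Type*} [MetricSpace X] [MetricSpace Y] [Nonempty X]
    {s : Set X} (hs : IsCompact s) {γ : X → Y} (hγ : ContinuousOn γ s) (hinj : InjOn γ s) :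
    ContinuousOn (Function.invFunOn γ s) (γ '' s) := by
  rw [Metric.continuousOn_iff]
  rintro _ ⟨b, hb, rfl⟩ ε hε
  obtain ⟨δ, hδ, h⟩ := hs.exists_dist_lt_of_injOn hγ hinj hε
  refine ⟨δ, hδ, ?_⟩
  rintro _ ⟨a, ha, rfl⟩ hab
  rw [hinj.leftInvOn_invFunOn ha, hinj.leftInvOn_invFunOn hb]
  exact h a ha b hb hab

theorem neg_mul_exp_mem_sphere_sdiff {a : ℂ} (ha : ‖a‖ = 1) {θ : ℝ}
    (hθ : θ ∈ Ioo (-Real.pi) Real.pi) :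
    -a * Complex.exp (θ * Complex.I) ∈ sphere (0 : ℂ) 1 \ {a} := by
  refine ⟨by simp [ha, Complex.norm_exp_ofReal_mul_I], fun h => ?_⟩
  have ha0 : a ≠ 0 := norm_ne_zero_iff.1 (by rw [ha]; exact one_ne_zero)
  have h1 : Complex.exp (θ * Complex.I) = Complex.exp (Real.pi * Complex.I) := by
    rw [Complex.exp_pi_mul_I]
    rw [mem_singleton_iff] at h
    refine mul_left_cancel₀ (neg_ne_zero.2 ha0) ?_
    rw [h]; ring
  have h2 := Complex.exp_inj_of_neg_pi_lt_of_le_pi (by simpa using hθ.1) (by simpa using hθ.2.le)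
    (by simpa using neg_lt_self Real.pi_pos) (by simp) h1
  have h3 : θ = Real.pi := by simpa using congrArg Complex.im h2
  exact hθ.2.ne h3

theorem div_neg_mem_slitPlane {a z : ℂ} (ha : ‖a‖ = 1) (hz : z ∈ sphere (0 : ℂ) 1 \ {a}) :
    z / -a ∈ Complex.slitPlane := by
  have ha0 : a ≠ 0 := norm_ne_zero_iff.1 (by rw [ha]; exact one_ne_zero)
  have hn : ‖z / -a‖ = 1 := by
    rw [norm_div, norm_neg, ha, div_one, mem_sphere_zero_iff_norm.1 hz.1]
  rw [Complex.mem_slitPlane_iff_arg]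
  refine ⟨fun h => hz.2 ?_, norm_ne_zero_iff.1 (by rw [hn]; exact one_ne_zero)⟩
  have := Complex.norm_mul_exp_arg_mul_I (z / -a)
  rw [hn, h, Complex.exp_pi_mul_I] at this
  rw [mem_singleton_iff]
  field_simp at this
  push_cast at this
  linear_combination this

theorem isPreconnected_sphere_sdiff_singleton {a : ℂ} (ha : ‖a‖ = 1) :
    IsPreconnected (sphere (0 : ℂ) 1 \ {a}) := by
  have : sphere (0 : ℂ) 1 \ {a} =
      (fun θ : ℝ => -a * Complex.exp (θ * Complex.I)) '' Ioo (-Real.pi) Real.pi := by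
    refine Subset.antisymm (fun z hz => ?_) ?_
    · have h := div_neg_mem_slitPlane ha hz
      refine ⟨Complex.arg (z / -a), ⟨Complex.neg_pi_lt_arg _, lt_of_le_of_ne (Complex.arg_le_pi _)
        (Complex.mem_slitPlane_iff_arg.1 h).1⟩, ?_⟩
      have ha0 : a ≠ 0 := norm_ne_zero_iff.1 (by rw [ha]; exact one_ne_zero)
      have h2 := Complex.norm_mul_exp_arg_mul_I (z / -a)
      rw [norm_div, norm_neg, ha, div_one, mem_sphere_zero_iff_norm.1 hz.1, Complex.ofReal_one,
        one_mul] at h2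
      dsimp only
      rw [h2, mul_div_cancel₀ _ (neg_ne_zero.2 ha0)]
    · rintro _ ⟨θ, hθ, rfl⟩
      exact neg_mul_exp_mem_sphere_sdiff ha hθ
  rw [this]
  exact isPreconnected_Ioo.image _ (by fun_prop)

/-- A continuous injective self-map of the circle is surjective. -/
theorem surjOn_sphere_of_injOn {T : ℂ → ℂ} (hT : ContinuousOn T (sphere 0 1))
    (hinj : InjOn T (sphere 0 1)) (hm : MapsTo T (sphere 0 1) (sphere 0 1)) :
    SurjOn T (sphere 0 1) (sphere 0 1) := by
  intro a ha
  by_contra hcon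
  have ha1 := mem_sphere_zero_iff_norm.1 ha
  have hsl : ∀ z ∈ sphere (0 : ℂ) 1, T z / -a ∈ Complex.slitPlane := fun z hz =>
    div_neg_mem_slitPlane ha1 ⟨hm hz, fun h => hcon ⟨z, hz, h⟩⟩
  set k : ℂ → ℝ := fun z => Complex.arg (T z / -a) with hk
  have hkc : ContinuousOn k (sphere 0 1) := fun z hz =>
    ContinuousAt.comp_continuousWithinAt (f := fun z => T z / -a)
      (Complex.continuousAt_arg (hsl z hz)) ((hT z hz).div_const _)
  have hneg : MapsTo (fun z : ℂ => -z) (sphere 0 1) (sphere 0 1) := fun z hz => by simpa using hz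
  have hkc' : ContinuousOn (fun z => k z - k (-z)) (sphere 0 1) :=
    hkc.sub (hkc.comp continuous_neg.continuousOn hneg)
  have h1 : (1 : ℂ) ∈ sphere (0 : ℂ) 1 := by simp
  have hpre : IsPreconnected (sphere (0 : ℂ) 1) :=
    isPreconnected_sphere (by simp [Complex.rank_real_complex]) 0 1
  obtain ⟨z, hz, hz0⟩ : ∃ z ∈ sphere (0 : ℂ) 1, k z - k (-z) = 0 := by
    rcases le_total (k 1 - k (-1)) 0 with h | h
    · exact hpre.intermediate_value h1 (hneg h1) hkc' ⟨h, by simpa using h⟩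
    · exact hpre.intermediate_value (hneg h1) h1 hkc' ⟨by simpa using h, h⟩
  have hnT : ∀ z ∈ sphere (0 : ℂ) 1, ‖T z / -a‖ = 1 := fun z hz => by
    rw [norm_div, norm_neg, ha1, div_one, mem_sphere_zero_iff_norm.1 (hm hz)]
  have ha0 : -a ≠ 0 := neg_ne_zero.2 (norm_ne_zero_iff.1 (by rw [ha1]; exact one_ne_zero))
  have h2 : T z / -a = T (-z) / -a := by
    refine Complex.ext_norm_arg ?_ (sub_eq_zero.1 hz0)
    rw [hnT z hz, hnT _ (hneg hz)]
  have h3 : z = -z := hinj hz (hneg hz) ((div_left_inj' ha0).1 h2)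
  have h4 : z = 0 := self_eq_neg.1 h3
  simp [h4] at hz

/-- The two radii through distinct points of the unit circle cut the disk in two pieces, told apart
by the sign of a continuous function. -/
theorem exists_continuous_sign_of_ne {ζ₁ ζ₂ : ℂ} (h₁ : ‖ζ₁‖ = 1) (h₂ : ‖ζ₂‖ = 1) (hne : ζ₁ ≠ ζ₂) :
    ∃ h : ℂ → ℝ, Continuous h ∧ (∀ z, ‖z‖ = 1 → h z = 0 → z = ζ₁ ∨ z = ζ₂) ∧
      (∃ m, ‖m‖ = 1 ∧ 0 < h m) ∧ ∃ m, ‖m‖ = 1 ∧ h m < 0 := by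
  have h20 : ζ₂ ≠ 0 := norm_ne_zero_iff.1 (by rw [h₂]; exact one_ne_zero)
  set ω : ℂ := ζ₁ / ζ₂ with hω
  have hω1 : ω.re ^ 2 + ω.im ^ 2 = 1 := by
    have : ‖ω‖ ^ 2 = 1 := by rw [hω, norm_div, h₁, h₂]; norm_num
    rw [← Complex.normSq_eq_norm_sq, Complex.normSq_apply] at this
    linarith
  have hωne : ω ≠ 1 := fun h => hne (by rwa [hω, div_eq_one_iff_eq h20] at h)
  have hx : ω.re < 1 := by
    rcases lt_or_eq_of_le (show ω.re ≤ 1 by nlinarith [sq_nonneg ω.im]) with h | h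
    · exact h
    · exfalso
      refine hωne (Complex.ext h ?_)
      rw [h] at hω1
      simpa using hω1
  set x := ω.re
  set y := ω.im
  have hval : ∀ p q : ℝ, (⟨p, q⟩ * ζ₂) / ζ₂ = (⟨p, q⟩ : ℂ) := fun p q => mul_div_cancel_right₀ _ h20
  set r := √(2 * (1 - x)) with hr
  have hr2 : r ^ 2 = 2 * (1 - x) := Real.sq_sqrt (by linarith)
  have hr0 : 0 < r := Real.sqrt_pos.2 (by linarith)
  have hyr : |y| < r := by
    refine abs_lt_of_sq_lt_sq ?_ hr0.le
    nlinarith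
  have hmn : ‖(⟨y / r, (1 - x) / r⟩ : ℂ) * ζ₂‖ = 1 := by
    rw [norm_mul, h₂, mul_one, ← pow_eq_one_iff_of_nonneg (norm_nonneg _) two_ne_zero,
      ← Complex.normSq_eq_norm_sq, Complex.normSq_apply]
    field_simp
    nlinarith
  refine ⟨fun z => y * (z / ζ₂).re + (1 - x) * (z / ζ₂).im - ‖z‖ * y, by fun_prop, ?_,
    ⟨⟨y / r, (1 - x) / r⟩ * ζ₂, hmn, ?_⟩, ⟨-(⟨y / r, (1 - x) / r⟩ * ζ₂), by rw [norm_neg, hmn], ?_⟩⟩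
  · intro z hz h
    dsimp only at h
    rw [hz] at h
    have hu : (z / ζ₂).re ^ 2 + (z / ζ₂).im ^ 2 = 1 := by
      have : ‖z / ζ₂‖ ^ 2 = 1 := by rw [norm_div, hz, h₂]; norm_num
      rw [← Complex.normSq_eq_norm_sq, Complex.normSq_apply] at this
      linarith
    set p := (z / ζ₂).re with hp
    set q := (z / ζ₂).im with hq
    have h3 : (1 - x) * ((1 - p) * (p - x)) = 0 := by
      have e1 : (1 - x) * q = y * (1 - p) := by linarith
      have e2 : ((1 - x) * q) ^ 2 = (y * (1 - p)) ^ 2 := by rw [e1]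
      linear_combination (1 / 2) * e2 - (1 / 2) * (1 - x) ^ 2 * hu + (1 / 2) * (1 - p) ^ 2 * hω1
    have hx0 : 1 - x ≠ 0 := by linarith
    rcases mul_eq_zero.1 ((mul_eq_zero.1 h3).resolve_left hx0) with h4 | h4
    · right
      have hp1 : p = 1 := by linarith
      have hq1 : q = 0 := by rw [hp1] at hu; simpa using hu
      have : z / ζ₂ = 1 := Complex.ext hp1 hq1
      rwa [div_eq_one_iff_eq h20] at this
    · left
      have hpx : p = x := by linarith
      have hqy : q = y := by
        rw [hpx] at h
        exact mul_left_cancel₀ hx0 (by linarith)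
      have : z / ζ₂ = ζ₁ / ζ₂ := Complex.ext hpx hqy
      exact (div_left_inj' h20).1 this
  · dsimp only
    rw [hmn, hval]
    have : y * (y / r) + (1 - x) * ((1 - x) / r) = r := by field_simp; nlinarith
    rw [this]
    linarith [(abs_lt.1 hyr).2]
  · dsimp only
    rw [norm_neg, hmn, neg_div, hval, Complex.neg_re, Complex.neg_im]
    have : y * (y / r) + (1 - x) * ((1 - x) / r) = r := by field_simp; nlinarith
    linarith [(abs_lt.1 hyr).1]

/-- A holomorphic function with constant boundary values on an arc of the circle is constant. -/
theorem eq_of_eqOn_sphere_inter_ball {Ψ : ℂ → ℂ} (hc : ContinuousOn Ψ (closedBall 0 1))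
    (hd : DifferentiableOn ℂ Ψ (ball 0 1)) {p m : ℂ} (hm : ‖m‖ = 1) {r : ℝ} (hr : 0 < r)
    (h : ∀ z ∈ sphere (0 : ℂ) 1 ∩ ball m r, Ψ z = p) : Ψ 0 = p := by
  have hunit : ∀ x ∈ sphere (0 : ℂ) 1, ‖m / x‖ = 1 := fun x hx => by
    rw [norm_div, hm, mem_sphere_zero_iff_norm.1 hx, div_one]
  obtain ⟨T, hT, hcover⟩ := (isCompact_sphere (0 : ℂ) 1).elim_nhds_subcover
    (fun x => (fun z => m / x * z) ⁻¹' ball m r) (fun x hx => by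
      have hx0 : x ≠ 0 := norm_ne_zero_iff.1 (by
        rw [mem_sphere_zero_iff_norm.1 hx]; exact one_ne_zero)
      refine ContinuousAt.preimage_mem_nhds (by fun_prop) (isOpen_ball.mem_nhds ?_)
      rw [div_mul_cancel₀ _ hx0]
      exact mem_ball_self hr)
  set G : ℂ → ℂ := fun z => ∏ x ∈ T, (Ψ (m / x * z) - p) with hG
  have hmap : ∀ x ∈ T, ∀ z, ‖m / x * z‖ = ‖z‖ := fun x hx z => by
    rw [norm_mul, hunit x (hT x hx), one_mul]
  have hGd : DiffContOnCl ℂ G (ball 0 1) := by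
    refine ⟨?_, ?_⟩
    · refine DifferentiableOn.fun_finsetProd fun x hx => ?_
      exact (hd.comp (by fun_prop) fun z hz => by
        rwa [mem_ball_zero_iff, hmap x hx, ← mem_ball_zero_iff]).sub_const p
    · rw [closure_ball _ one_ne_zero]
      refine continuousOn_finsetProd _ fun x hx => ?_
      exact (hc.comp (by fun_prop) fun z hz => by
        rwa [mem_closedBall_zero_iff, hmap x hx, ← mem_closedBall_zero_iff]).sub continuousOn_const
  have h0 : ‖G 0‖ ≤ 0 := by
    refine Complex.norm_le_of_forall_mem_frontier_norm_le isBounded_ball hGd (fun z hz => ?_)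
      (subset_closure (mem_ball_self one_pos))
    rw [frontier_ball _ one_ne_zero] at hz
    obtain ⟨x, hx, hxz⟩ := mem_iUnion₂.1 (hcover hz)
    rw [norm_le_zero_iff]
    refine Finset.prod_eq_zero hx (sub_eq_zero.2 (h _ ⟨?_, hxz⟩))
    rwa [mem_sphere_zero_iff_norm, hmap x hx, ← mem_sphere_zero_iff_norm]
  obtain ⟨x, -, hx⟩ := Finset.prod_eq_zero_iff.1 (norm_le_zero_iff.1 h0)
  rw [mul_zero] at hx
  exact sub_eq_zero.1 hx

section
variable {U : Set ℂ} {ψ φ γ : ℂ → ℂ}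

theorem IsRiemannMap.exists_continuousOn_extension (hγ : ContinuousOn γ (sphere 0 1))
    (hinj : InjOn γ (sphere 0 1)) (h : IsRiemannMap U (γ '' sphere 0 1) ψ φ) :
    ∃ Ψ : ℂ → ℂ, ContinuousOn Ψ (closedBall 0 1) ∧ EqOn Ψ ψ (ball 0 1) := by
  refine ⟨extendFrom (ball 0 1) ψ, continuousOn_extendFrom
    (closure_ball (0 : ℂ) one_ne_zero).symm.subset fun ζ hζ => ?_, fun z hz => extendFrom_extends
      h.differentiableOn.continuousOn z hz⟩
  rcases lt_or_eq_of_le (mem_closedBall_zero_iff.1 hζ) with h1 | h1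
  · exact ⟨ψ ζ, h.differentiableOn.continuousOn ζ (mem_ball_zero_iff.2 h1)⟩
  · have hne : (𝓝[ball (0 : ℂ) 1] ζ).NeBot := mem_closure_iff_nhdsWithin_neBot.1 (by
      rwa [closure_ball _ one_ne_zero])
    refine CompleteSpace.complete (Metric.cauchy_iff.2 ⟨inferInstance, fun ε hε => ?_⟩)
    obtain ⟨ρ, hρ, p, hp⟩ := h.exists_image_subset_closedBall hγ hinj h1
      (show 0 < ε / 3 by positivity)
    refine ⟨ψ '' (ball 0 1 ∩ ball ζ ρ), image_mem_map (inter_mem self_mem_nhdsWithin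
      (mem_nhdsWithin_of_mem_nhds (ball_mem_nhds ζ hρ))), ?_⟩
    rintro _ ⟨z, hz, rfl⟩ _ ⟨w, hw, rfl⟩
    have := dist_triangle_right (ψ z) (ψ w) p
    linarith [mem_closedBall.1 (hp z hz), mem_closedBall.1 (hp w hw)]

variable {J : Set ℂ} {Ψ : ℂ → ℂ}

theorem IsRiemannMap.mapsTo_sphere (h : IsRiemannMap U J ψ φ)
    (hΨ : ContinuousOn Ψ (closedBall 0 1)) (hΨψ : EqOn Ψ ψ (ball 0 1)) :
    MapsTo Ψ (sphere 0 1) J := by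
  intro ζ hζ
  have hne : (𝓝[ball (0 : ℂ) 1] ζ).NeBot := mem_closure_iff_nhdsWithin_neBot.1 (by
    rw [closure_ball _ one_ne_zero]; exact sphere_subset_closedBall hζ)
  have ht : Tendsto ψ (𝓝[ball (0 : ℂ) 1] ζ) (𝓝 (Ψ ζ)) := by
    refine ((hΨ ζ (sphere_subset_closedBall hζ)).mono ball_subset_closedBall).tendsto.congr' ?_
    filter_upwards [self_mem_nhdsWithin] with z hz using hΨψ hz
  refine h.frontier_subset (h.isOpen.frontier_eq ▸ ⟨mem_closure_of_tendsto ht ?_, fun hU => ?_⟩)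
  · filter_upwards [self_mem_nhdsWithin] with z hz using h.mapsTo hz
  · have h1 : Tendsto (fun z => φ (ψ z)) (𝓝[ball (0 : ℂ) 1] ζ) (𝓝 (φ (Ψ ζ))) :=
      ((h.continuousOn.continuousAt (h.isOpen.mem_nhds hU)).tendsto).comp ht
    have h2 : Tendsto (fun z => φ (ψ z)) (𝓝[ball (0 : ℂ) 1] ζ) (𝓝 ζ) := by
      refine (tendsto_id.mono_left nhdsWithin_le_nhds).congr' ?_
      filter_upwards [self_mem_nhdsWithin] with z hz using (h.leftInvOn hz).symm
    have h3 := h.mapsTo_symm hU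
    rw [tendsto_nhds_unique h1 h2, mem_ball_zero_iff, mem_sphere_zero_iff_norm.1 hζ] at h3
    exact lt_irrefl _ h3

theorem IsRiemannMap.injOn_sphere (h : IsRiemannMap U J ψ φ)
    (hJ : ∀ p ∈ J, IsPreconnected (J \ {p}))
    (hΨ : ContinuousOn Ψ (closedBall 0 1)) (hΨψ : EqOn Ψ ψ (ball 0 1)) :
    InjOn Ψ (sphere 0 1) := by
  intro ζ₁ h₁ ζ₂ h₂ heq
  by_contra hne
  have hS := h.mapsTo_sphere hΨ hΨψ
  obtain ⟨g, hg, hg0, ⟨m, hm, hgm⟩, ⟨m', hm', hgm'⟩⟩ := exists_continuous_sign_of_ne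
    (mem_sphere_zero_iff_norm.1 h₁) (mem_sphere_zero_iff_norm.1 h₂) hne
  set p := Ψ ζ₁ with hp
  set D : Set ℂ := closedBall 0 1 ∩ {z | g z = 0} with hD
  have hDc : IsCompact D :=
    (isCompact_closedBall 0 1).inter_right (isClosed_eq hg continuous_const)
  set A := Ψ '' D with hA
  have hAc : IsCompact A := hDc.image_of_continuousOn (hΨ.mono inter_subset_left)
  have hAJ : A ∩ J ⊆ {p} := by
    rintro _ ⟨⟨z, ⟨hz1, hz2⟩, rfl⟩, hzJ⟩
    rcases lt_or_eq_of_le (mem_closedBall_zero_iff.1 hz1) with h1 | h1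
    · rw [hΨψ (mem_ball_zero_iff.2 h1)] at hzJ
      exact absurd hzJ (disjoint_left.1 h.disjoint (h.mapsTo (mem_ball_zero_iff.2 h1)))
    · rcases hg0 z h1 hz2 with rfl | rfl
      · rfl
      · exact heq.symm
  have hnear : ∀ ξ ∈ sphere (0 : ℂ) 1, g ξ ≠ 0 → Ψ ξ ≠ p → ∃ z ∈ ball (0 : ℂ) 1,
      0 < g z * g ξ ∧ ∃ S, IsPreconnected S ∧ Disjoint S A ∧ Ψ ξ ∈ S ∧ ψ z ∈ S := by
    intro ξ hξ hgξ hξp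
    have hξA : Ψ ξ ∉ A := fun hm => hξp (hAJ ⟨hm, hS hξ⟩)
    have hev : ∀ᶠ z in 𝓝[closedBall 0 1] ξ, Ψ z ∈ Aᶜ ∧ 0 < g z * g ξ := by
      refine ((hΨ ξ (sphere_subset_closedBall hξ)).eventually
        (hAc.isClosed.isOpen_compl.mem_nhds hξA)).and
        (Filter.Eventually.filter_mono nhdsWithin_le_nhds ?_)
      exact (show ContinuousAt (fun z => g z * g ξ) ξ by fun_prop).eventually
        (lt_mem_nhds (mul_self_pos.2 hgξ))
    obtain ⟨r, hr, hrs⟩ := Metric.mem_nhdsWithin_iff.1 hev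
    obtain ⟨z, hz, hzr⟩ := Metric.mem_closure_iff.1 (show ξ ∈ closure (ball (0 : ℂ) 1) by
      rw [closure_ball _ one_ne_zero]; exact sphere_subset_closedBall hξ) r hr
    have hz' : z ∈ ball ξ r ∩ closedBall 0 1 := ⟨by rwa [mem_ball, dist_comm],
      ball_subset_closedBall hz⟩
    refine ⟨z, hz, (hrs hz').2, Ψ '' (ball ξ r ∩ closedBall 0 1),
      ((convex_ball ξ r).inter (convex_closedBall 0 1)).isPreconnected.image _
        (hΨ.mono inter_subset_right), disjoint_left.2 ?_,
      ⟨ξ, ⟨mem_ball_self hr, sphere_subset_closedBall hξ⟩, rfl⟩, ⟨z, hz', hΨψ hz⟩⟩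
    rintro _ ⟨w, hw, rfl⟩
    exact (hrs hw).1
  have hsplit : ∀ ξ ∈ sphere (0 : ℂ) 1, ∀ ξ' ∈ sphere (0 : ℂ) 1, 0 < g ξ → g ξ' < 0 →
      Ψ ξ = p ∨ Ψ ξ' = p := by
    intro ξ hξ ξ' hξ' hgξ hgξ'
    by_contra! hcon
    obtain ⟨z, hz, hgz, S, hS1, hSA, hξS, hzS⟩ := hnear ξ hξ hgξ.ne' hcon.1
    obtain ⟨z', hz', hgz', S', hS1', hSA', hξS', hzS'⟩ := hnear ξ' hξ' hgξ'.ne hcon.2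
    have hz0 : 0 < g z := (pos_iff_pos_of_mul_pos hgz).2 hgξ
    have hz0' : g z' < 0 := by
      by_contra! hh
      nlinarith
    have hJp := hJ p (hS h₁)
    have hξJ : Ψ ξ ∈ J \ {p} := ⟨hS hξ, hcon.1⟩
    have hξJ' : Ψ ξ' ∈ J \ {p} := ⟨hS hξ', hcon.2⟩
    have hJd : Disjoint (J \ {p}) A := disjoint_left.2 fun x hx hxA => hx.2 (hAJ ⟨hxA, hx.1⟩)
    obtain ⟨W, hWb, hW, hzW, hzW', hWA⟩ := h.exists_isPreconnected hAc
      (Set.Subsingleton.isPreconnected (subsingleton_singleton.anti hAJ))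
      ((hS1.union (Ψ ξ) hξS hξJ hJp).union (Ψ ξ') (Or.inr hξJ') hξS' hS1')
      ((hSA.union_left hJd).union_left hSA') hz hz' (Or.inl (Or.inl hzS)) (Or.inr hzS')
    obtain ⟨x, hxW, hx⟩ := hW.intermediate_value hzW' hzW hg.continuousOn
      (⟨hz0'.le, hz0.le⟩ : (0 : ℝ) ∈ Icc (g z') (g z))
    exact hWA x hxW ⟨x, ⟨ball_subset_closedBall (hWb hxW), hx⟩, hΨψ (hWb hxW)⟩
  have hfinal : ∀ m : ℂ, ‖m‖ = 1 → ∀ s : Set ℂ, IsOpen s → m ∈ s →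
      (∀ ξ ∈ sphere (0 : ℂ) 1, ξ ∈ s → Ψ ξ = p) → False := by
    intro m hm s hs hms hsp
    obtain ⟨r, hr, hrs⟩ := Metric.isOpen_iff.1 hs m hms
    have h0 : Ψ 0 = p := eq_of_eqOn_sphere_inter_ball hΨ (h.differentiableOn.congr hΨψ) hm hr
      fun z hz => hsp z hz.1 (hrs hz.2)
    rw [hΨψ (mem_ball_self one_pos)] at h0
    exact disjoint_left.1 h.disjoint (h.mapsTo (mem_ball_self one_pos)) (h0 ▸ hS h₁)
  by_cases hcase : ∃ ξ ∈ sphere (0 : ℂ) 1, 0 < g ξ ∧ Ψ ξ ≠ p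
  · obtain ⟨ξ, hξ, hgξ, hξp⟩ := hcase
    exact hfinal m' hm' {z | g z < 0} (isOpen_lt hg continuous_const) hgm' fun ξ' hξ' hgξ' =>
      (hsplit ξ hξ ξ' hξ' hgξ hgξ').resolve_left hξp
  · push Not at hcase
    exact hfinal m hm {z | 0 < g z} (isOpen_lt continuous_const hg) hgm fun ξ hξ hgξ =>
      hcase ξ hξ hgξ

end

section
variable {E : Type*} [NormedAddCommGroup E] [NormedSpace ℝ E] {F : E → E}

/-- The radial extension of a self-map of the unit sphere. -/
noncomputable def radialExtension (F : E → E) (z : E) : E := ‖z‖ • F (‖z‖⁻¹ • z)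

theorem inv_norm_smul_mem_unit_sphere {z : E} (hz : z ≠ 0) : ‖z‖⁻¹ • z ∈ sphere (0 : E) 1 := by
  rw [mem_sphere_zero_iff_norm, norm_smul, norm_inv, norm_norm,
    inv_mul_cancel₀ (norm_ne_zero_iff.2 hz)]

theorem norm_radialExtension (hF : MapsTo F (sphere 0 1) (sphere 0 1)) (z : E) :
    ‖radialExtension F z‖ = ‖z‖ := by
  rcases eq_or_ne z 0 with rfl | hz
  · simp [radialExtension]
  · rw [radialExtension, norm_smul, norm_norm,
      mem_sphere_zero_iff_norm.1 (hF (inv_norm_smul_mem_unit_sphere hz)), mul_one]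

theorem radialExtension_of_mem_sphere {z : E} (hz : z ∈ sphere (0 : E) 1) :
    radialExtension F z = F z := by
  rw [radialExtension, mem_sphere_zero_iff_norm.1 hz, inv_one, one_smul, one_smul]

theorem continuous_radialExtension (hF : MapsTo F (sphere 0 1) (sphere 0 1))
    (hFc : ContinuousOn F (sphere 0 1)) : Continuous (radialExtension F) := by
  refine continuous_iff_continuousAt.2 fun z => ?_
  rcases eq_or_ne z 0 with rfl | hz
  · have h0 : radialExtension F 0 = 0 := by simp [radialExtension]
    rw [ContinuousAt, h0]
    refine squeeze_zero_norm (fun z => (norm_radialExtension hF z).le) ?_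
    simpa using (continuous_norm (E := E)).tendsto 0
  · have h1 : ContinuousOn (radialExtension F) {0}ᶜ := by
      refine continuous_norm.continuousOn.smul (hFc.comp ?_ fun w hw =>
        inv_norm_smul_mem_unit_sphere hw)
      exact (continuous_norm.continuousOn.inv₀ fun w hw => norm_ne_zero_iff.2 hw).smul
        continuousOn_id
    exact h1.continuousAt (isOpen_compl_singleton.mem_nhds hz)

theorem injective_radialExtension (hF : MapsTo F (sphere 0 1) (sphere 0 1))
    (hFi : InjOn F (sphere 0 1)) : Function.Injective (radialExtension F) := by
  intro z w h
  have hn : ‖z‖ = ‖w‖ := by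
    rw [← norm_radialExtension hF z, h, norm_radialExtension hF w]
  rcases eq_or_ne z 0 with rfl | hz
  · exact (norm_eq_zero.1 (by rw [← hn, norm_zero])).symm
  · have hw : w ≠ 0 := norm_ne_zero_iff.1 (hn ▸ norm_ne_zero_iff.2 hz)
    have hz0 := norm_ne_zero_iff.2 hz
    rw [radialExtension, radialExtension, ← hn] at h
    have h1 := hFi (inv_norm_smul_mem_unit_sphere hz)
      (by rw [hn]; exact inv_norm_smul_mem_unit_sphere hw) (smul_right_injective E hz0 h)
    exact smul_right_injective E (inv_ne_zero hz0) h1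

theorem surjective_radialExtension (hFs : SurjOn F (sphere 0 1) (sphere 0 1)) :
    Function.Surjective (radialExtension F) := by
  intro w
  rcases eq_or_ne w 0 with rfl | hw
  · exact ⟨0, by simp [radialExtension]⟩
  · obtain ⟨x, hx, hxw⟩ := hFs (inv_norm_smul_mem_unit_sphere hw)
    have hw0 := norm_ne_zero_iff.2 hw
    refine ⟨‖w‖ • x, ?_⟩
    rw [radialExtension, norm_smul, norm_norm, mem_sphere_zero_iff_norm.1 hx, mul_one,
      inv_smul_smul₀ hw0, hxw, smul_inv_smul₀ hw0]

theorem radialExtension_image_ball (hF : MapsTo F (sphere 0 1) (sphere 0 1))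
    (hFs : SurjOn F (sphere 0 1) (sphere 0 1)) :
    radialExtension F '' ball 0 1 = ball 0 1 := by
  refine Subset.antisymm ?_ fun w hw => ?_
  · rintro _ ⟨z, hz, rfl⟩
    rwa [mem_ball_zero_iff, norm_radialExtension hF, ← mem_ball_zero_iff]
  · obtain ⟨z, rfl⟩ := surjective_radialExtension hFs w
    exact ⟨z, by rwa [mem_ball_zero_iff, norm_radialExtension hF, ← mem_ball_zero_iff] at hw, rfl⟩

end

/-- **Carathéodory's theorem**, together with the Riemann mapping theorem. -/
theorem exists_parametrization_of_frontier_subset {U : Set ℂ} {γ : ℂ → ℂ} (hU : IsOpen U)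
    (hb : Bornology.IsBounded U) (hU' : IsConnected U) (hUc : IsPreconnected Uᶜ)
    (hγ : ContinuousOn γ (sphere 0 1)) (hinj : InjOn γ (sphere 0 1))
    (hf : frontier U ⊆ γ '' sphere 0 1) (hd : Disjoint U (γ '' sphere 0 1)) :
    ∃ Ψ : ℂ → ℂ, ContinuousOn Ψ (closedBall 0 1) ∧ InjOn Ψ (closedBall 0 1) ∧
      Ψ '' ball 0 1 = U ∧ EqOn Ψ γ (sphere 0 1) := by
  obtain ⟨z₀, hz₀⟩ := hU'.nonempty
  obtain ⟨ψ, φ, h1, h2, h3, h4, h5, h6⟩ :=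
    exists_biholomorphic_ball hU hb hU'.isPreconnected hUc hz₀
  have h : IsRiemannMap U (γ '' sphere 0 1) ψ φ := ⟨hU, hb,
    (isCompact_sphere 0 1).image_of_continuousOn hγ, hf, hd, h1, h2, h3, h4, h5, h6⟩
  obtain ⟨Ψ, hΨ, hΨψ⟩ := h.exists_continuousOn_extension hγ hinj
  have hJ : ∀ p ∈ γ '' sphere 0 1, IsPreconnected (γ '' sphere 0 1 \ {p}) := by
    rintro _ ⟨a, ha, rfl⟩
    rw [← image_singleton, ← hinj.image_sdiff_subset (singleton_subset_iff.2 ha)]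
    exact (isPreconnected_sphere_sdiff_singleton (mem_sphere_zero_iff_norm.1 ha)).image _
      (hγ.mono sdiff_subset)
  have hS := h.mapsTo_sphere hΨ hΨψ
  have hI := h.injOn_sphere hJ hΨ hΨψ
  have hΨs : ContinuousOn Ψ (sphere 0 1) := hΨ.mono sphere_subset_closedBall
  have hinv : ∀ {f : ℂ → ℂ} {y : ℂ}, y ∈ f '' sphere 0 1 →
      Function.invFunOn f (sphere 0 1) y ∈ sphere (0 : ℂ) 1 ∧
        f (Function.invFunOn f (sphere 0 1) y) = y :=
    fun hy => ⟨Function.invFunOn_mem hy, Function.invFunOn_eq hy⟩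
  have hsurj : γ '' sphere 0 1 ⊆ Ψ '' sphere 0 1 := by
    have h7 : MapsTo (fun z => Function.invFunOn γ (sphere 0 1) (Ψ z)) (sphere 0 1) (sphere 0 1) :=
      fun z hz => (hinv (hS hz)).1
    have h8 := surjOn_sphere_of_injOn
      (((isCompact_sphere (0 : ℂ) 1).continuousOn_invFunOn hγ hinj).comp hΨs hS)
      (fun z hz w hw hzw => hI hz hw (by
        have := congrArg γ hzw
        simp only [Function.comp] at this
        rwa [(hinv (hS hz)).2, (hinv (hS hw)).2] at this)) h7
    rintro _ ⟨a, ha, rfl⟩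
    obtain ⟨z, hz, rfl⟩ := h8 ha
    exact ⟨z, hz, (hinv (hS hz)).2.symm⟩
  set T : ℂ → ℂ := fun z => Function.invFunOn Ψ (sphere 0 1) (γ z) with hT
  have hm : ∀ z ∈ sphere (0 : ℂ) 1, γ z ∈ Ψ '' sphere 0 1 := fun z hz =>
    hsurj (mem_image_of_mem γ hz)
  have hTm : MapsTo T (sphere 0 1) (sphere 0 1) := fun z hz => (hinv (hm z hz)).1
  have hTe : ∀ z ∈ sphere (0 : ℂ) 1, Ψ (T z) = γ z := fun z hz => (hinv (hm z hz)).2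
  have hTc : ContinuousOn T (sphere 0 1) :=
    ((isCompact_sphere (0 : ℂ) 1).continuousOn_invFunOn hΨs hI).comp hγ hm
  have hTi : InjOn T (sphere 0 1) := fun z hz w hw hzw => hinj hz hw (by
    rw [← hTe z hz, ← hTe w hw, hzw])
  have hΨi : InjOn Ψ (closedBall 0 1) := by
    rw [← ball_union_sphere]
    refine (injOn_union (disjoint_left.2 fun z hz hz' =>
      (mem_ball.1 hz).ne (mem_sphere.1 hz'))).2 ⟨?_, hI, fun z hz w hw heq => ?_⟩
    · exact h.leftInvOn.injOn.congr hΨψ.symm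
    · refine disjoint_left.1 hd (h.mapsTo hz) ?_
      rw [← hΨψ hz, heq]
      exact hS hw
  have hball : MapsTo (radialExtension T) (closedBall 0 1) (closedBall 0 1) := fun z hz => by
    rwa [mem_closedBall_zero_iff, norm_radialExtension hTm, ← mem_closedBall_zero_iff]
  refine ⟨Ψ ∘ radialExtension T, hΨ.comp (continuous_radialExtension hTm hTc).continuousOn hball,
    hΨi.comp (injective_radialExtension hTm hTi).injOn hball, ?_, fun z hz => ?_⟩
  · rw [image_comp, radialExtension_image_ball hTm (surjOn_sphere_of_injOn hTc hTi hTm),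
      hΨψ.image_eq, h.image_ball]
  · rw [Function.comp_apply, radialExtension_of_mem_sphere hz, hTe z hz]

theorem isPreconnected_closedBall_sdiff_zero :
    IsPreconnected (closedBall (0 : ℂ) 1 \ {0}) := by
  have h : closedBall (0 : ℂ) 1 \ {0} =
      (fun p : ℝ × ℂ => (p.1 : ℂ) * p.2) '' (Ioc 0 1 ×ˢ sphere 0 1) := by
    refine Subset.antisymm (fun z hz => ?_) ?_
    · have hz0 : z ≠ 0 := hz.2
      refine ⟨(‖z‖, z / ‖z‖), ⟨⟨norm_pos_iff.2 hz0, mem_closedBall_zero_iff.1 hz.1⟩, ?_⟩, ?_⟩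
      · rw [mem_sphere_zero_iff_norm, norm_div, Complex.norm_real, norm_norm,
          div_self (norm_ne_zero_iff.2 hz0)]
      · exact mul_div_cancel₀ z (Complex.ofReal_ne_zero.2 (norm_ne_zero_iff.2 hz0))
    · rintro _ ⟨⟨t, x⟩, ⟨ht, hx⟩, rfl⟩
      have hn : ‖(t : ℂ) * x‖ = t := by
        rw [norm_mul, mem_sphere_zero_iff_norm.1 hx, Complex.norm_real, mul_one,
          Real.norm_of_nonneg ht.1.le]
      refine ⟨mem_closedBall_zero_iff.2 (hn.trans_le ht.2), fun h0 => ?_⟩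
      have h0' : (t : ℂ) * x = 0 := h0
      rw [h0', norm_zero] at hn
      exact ht.1.ne hn
  rw [h]
  exact (isPreconnected_Ioc.prod
    (isPreconnected_sphere (by simp [Complex.rank_real_complex]) 0 1)).image _ (by fun_prop)

/-- Every point complement of the space `S` is homeomorphic to the plane. -/
def HasPlaneCharts (S : Type*) [TopologicalSpace S] : Prop :=
  ∀ q : S, ∃ e : OpenPartialHomeomorph S ℂ, e.source = {q}ᶜ ∧ e.target = univ

section
variable {S : Type*} [MetricSpace S] {f : ℂ → S}

theorem HasPlaneCharts.image_closedBall_ne_univ (hS : HasPlaneCharts S)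
    (hf : ContinuousOn f (closedBall 0 1)) (hi : InjOn f (closedBall 0 1)) :
    f '' closedBall 0 1 ≠ univ := by
  intro huniv
  have h0 : (0 : ℂ) ∈ closedBall (0 : ℂ) 1 := mem_closedBall_self zero_le_one
  obtain ⟨e, hes, het⟩ := hS (f 0)
  have hec : Continuous e.symm := by
    rw [← continuousOn_univ, ← het]; exact e.continuousOn_symm
  set k : ℂ → ℂ := fun w => Function.invFunOn f (closedBall 0 1) (e.symm w) with hk
  have hmem : ∀ y : S, y ∈ f '' closedBall 0 1 := fun y => huniv ▸ mem_univ y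
  have hkc : Continuous k := by
    have := (isCompact_closedBall (0 : ℂ) 1).continuousOn_invFunOn hf hi
    rw [huniv, continuousOn_univ] at this
    exact this.comp hec
  have hfk : ∀ w, f (k w) = e.symm w := fun w => Function.invFunOn_eq (hmem _)
  have hk0 : ∀ w, k w ≠ 0 := fun w hw => by
    have h1 : e.symm w ∈ e.source := e.map_target (het ▸ mem_univ w)
    rw [← hfk w, hw, hes] at h1
    exact h1 rfl
  have hsub : MapsTo f (sphere 0 1) e.source := fun z hz => by
    rw [hes]
    intro h
    rw [hi (sphere_subset_closedBall hz) h0 h] at hz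
    simp at hz
  have hef : ContinuousOn (fun z => e (f z)) (sphere 0 1) :=
    e.continuousOn.comp (hf.mono sphere_subset_closedBall) hsub
  obtain ⟨R, hR⟩ :=
    ((isCompact_sphere (0 : ℂ) 1).image_of_continuousOn hef).isBounded.subset_closedBall 0
  refine not_hasLogOn_of_odd (g := fun z => z) zero_le_one (fun _ _ => rfl) ?_
  refine ((HasLogOn.closedBall (c := 0) (r := R) hkc.continuousOn fun w _ => hk0 w).comp hef
    fun z hz => hR (mem_image_of_mem _ hz)).congr fun z hz => ?_
  refine (hi (Function.invFunOn_mem (hmem _)) (sphere_subset_closedBall hz) ?_).symm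
  exact (hfk _).trans (e.left_inv (hsub hz))

variable [CompactSpace S]

theorem HasPlaneCharts.not_isOpen_singleton (hS : HasPlaneCharts S) (q : S) :
    ¬ IsOpen ({q} : Set S) := by
  intro h
  obtain ⟨e, hes, het⟩ := hS q
  have h1 : IsCompact (e '' e.source) :=
    (hes ▸ h.isClosed_compl.isCompact : IsCompact e.source).image_of_continuousOn e.continuousOn
  rw [e.image_source_eq_target, het] at h1
  exact noncompact_univ ℂ h1

theorem HasPlaneCharts.isConnected_compl_image_and (hS : HasPlaneCharts S)
    (hf : ContinuousOn f (closedBall 0 1)) (hi : InjOn f (closedBall 0 1)) :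
    IsConnected (f '' closedBall 0 1)ᶜ ∧ f '' ball 0 1 ⊆ interior (f '' closedBall 0 1) := by
  have hne := hS.image_closedBall_ne_univ hf hi
  obtain ⟨q, hq⟩ := (ne_univ_iff_exists_notMem _).1 hne
  obtain ⟨e, hes, het⟩ := hS q
  have hec : Continuous e.symm := by
    rw [← continuousOn_univ, ← het]; exact e.continuousOn_symm
  have hm : MapsTo f (closedBall 0 1) e.source := fun z hz => by
    rw [hes]
    rintro rfl
    exact hq (mem_image_of_mem f hz)
  have hkc : ContinuousOn (e ∘ f) (closedBall 0 1) := e.continuousOn.comp hf hm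
  have hki : InjOn (e ∘ f) (closedBall 0 1) := e.injOn.comp hi hm
  have hsymm : e.symm '' ((e ∘ f) '' closedBall 0 1) = f '' closedBall 0 1 := by
    rw [image_comp]
    exact e.toPartialEquiv.symm_image_image_of_subset_source hm.image_subset
  have hinj : Function.Injective e.symm := by
    rw [← injOn_univ, ← het]; exact e.symm.injOn
  have hrange : range e.symm = {q}ᶜ := by
    rw [← image_univ, ← het, ← hes]; exact e.symm_image_target_eq_source
  refine ⟨⟨⟨q, hq⟩, ?_⟩, ?_⟩
  · have h1 := (isPreconnected_compl_image_closedBall hkc hki).image _ hec.continuousOn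
    rw [image_compl_eq_range_sdiff_image hinj, hsymm, hrange] at h1
    refine h1.subset_closure (fun x hx => hx.2) fun x hx => ?_
    by_cases hxq : x = q
    · subst hxq
      rw [_root_.mem_closure_iff]
      intro o ho hxo
      by_contra hcon
      refine hS.not_isOpen_singleton x ?_
      have : {x} = o ∩ (f '' closedBall 0 1)ᶜ := by
        refine Subset.antisymm (singleton_subset_iff.2 ⟨hxo, hx⟩) fun y hy => ?_
        by_contra hyx
        exact hcon ⟨y, hy.1, hyx, hy.2⟩
      rw [this]
      exact ho.inter ((isCompact_closedBall 0 1).image_of_continuousOn hf).isClosed.isOpen_compl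
    · exact subset_closure ⟨hxq, hx⟩
  · have h2 : IsOpen (e.symm '' interior ((e ∘ f) '' closedBall 0 1)) :=
      e.isOpen_image_symm_of_subset_target isOpen_interior (het ▸ subset_univ _)
    refine Subset.trans ?_ (interior_maximal ((image_mono interior_subset).trans hsymm.subset) h2)
    rintro _ ⟨z, hz, rfl⟩
    exact ⟨e (f z), image_ball_subset_interior hkc hki ⟨z, hz, rfl⟩,
      e.left_inv (hm (ball_subset_closedBall hz))⟩

/-- The **Schoenflies theorem** on the sphere, in one direction: an embedded disk has a
complementary embedded disk. -/
theorem HasPlaneCharts.exists_complementary_disk (hS : HasPlaneCharts S)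
    (hf : ContinuousOn f (closedBall 0 1)) (hi : InjOn f (closedBall 0 1)) :
    ∃ g : ℂ → S, ContinuousOn g (closedBall 0 1) ∧ InjOn g (closedBall 0 1) ∧
      g '' ball 0 1 = (f '' closedBall 0 1)ᶜ ∧ EqOn g f (sphere 0 1) := by
  obtain ⟨hconn, h_int⟩ := hS.isConnected_compl_image_and hf hi
  have hcl : IsClosed (f '' closedBall 0 1) :=
    ((isCompact_closedBall 0 1).image_of_continuousOn hf).isClosed
  have h0 : (0 : ℂ) ∈ closedBall (0 : ℂ) 1 := mem_closedBall_self zero_le_one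
  obtain ⟨e, hes, het⟩ := hS (f 0)
  have hec : Continuous e.symm := by
    rw [← continuousOn_univ, ← het]; exact e.continuousOn_symm
  have hes' : ∀ w, e (e.symm w) = w := fun w => e.right_inv (het ▸ mem_univ w)
  have hm : MapsTo f (closedBall 0 1 \ {0}) e.source := fun z hz => by
    rw [hes]
    exact fun h => hz.2 (hi hz.1 h0 h)
  have hsphere : sphere (0 : ℂ) 1 ⊆ closedBall 0 1 \ {0} := fun z hz =>
    ⟨sphere_subset_closedBall hz, fun h => by
      rw [mem_singleton_iff.1 h] at hz; simp at hz⟩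
  have hkc : ContinuousOn (e ∘ f) (closedBall 0 1 \ {0}) :=
    e.continuousOn.comp (hf.mono sdiff_subset) hm
  have hki : InjOn (e ∘ f) (closedBall 0 1 \ {0}) := e.injOn.comp (hi.mono sdiff_subset) hm
  set U : Set ℂ := e.symm ⁻¹' (f '' closedBall 0 1)ᶜ with hU
  have hWs : (f '' closedBall 0 1)ᶜ ⊆ e.source := by
    rw [hes]
    exact compl_subset_compl.2 (singleton_subset_iff.2 (mem_image_of_mem f h0))
  have hUe : U = e '' (f '' closedBall 0 1)ᶜ := by
    refine Subset.antisymm (fun w hw => ⟨e.symm w, hw, hes' w⟩) ?_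
    rintro _ ⟨x, hx, rfl⟩
    rwa [hU, mem_preimage, e.left_inv (hWs hx)]
  have hUopen : IsOpen U := hcl.isOpen_compl.preimage hec
  have hUconn : IsConnected U := hUe ▸ hconn.image _ (e.continuousOn.mono hWs)
  have hUc : Uᶜ = (e ∘ f) '' (closedBall 0 1 \ {0}) := by
    rw [hU, ← preimage_compl, compl_compl]
    refine Subset.antisymm ?_ ?_
    · rintro w ⟨z, hz, hzw⟩
      refine ⟨z, ⟨hz, ?_⟩, by rw [Function.comp, hzw, hes']⟩
      rintro rfl
      have : e.symm w ∈ e.source := e.map_target (het ▸ mem_univ w)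
      rw [← hzw, hes] at this
      exact this rfl
    · rintro _ ⟨z, hz, rfl⟩
      exact ⟨z, hz.1, (e.left_inv (hm hz)).symm⟩
  have hb : Bornology.IsBounded U := by
    have h1 : IsCompact (interior (f '' closedBall 0 1))ᶜ :=
      isOpen_interior.isClosed_compl.isCompact
    have h2 : (interior (f '' closedBall 0 1))ᶜ ⊆ e.source := by
      rw [hes]
      exact compl_subset_compl.2 (singleton_subset_iff.2
        (h_int (mem_image_of_mem f (mem_ball_self one_pos))))
    refine (h1.image_of_continuousOn (e.continuousOn.mono h2)).isBounded.subset ?_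
    rw [hUe]
    exact image_mono (compl_subset_compl.2 interior_subset)
  have hfr : frontier U ⊆ (e ∘ f) '' sphere 0 1 := by
    intro w hw
    have h1 := hec.frontier_preimage_subset _ hw
    rw [mem_preimage, frontier_compl] at h1
    obtain ⟨z, hz, hzw⟩ := hcl.frontier_subset h1
    refine ⟨z, ?_, by rw [Function.comp, hzw, hes']⟩
    rcases lt_or_eq_of_le (mem_closedBall_zero_iff.1 hz) with h2 | h2
    · exact absurd (h_int (mem_image_of_mem f (mem_ball_zero_iff.2 h2))) (hzw ▸ h1.2)
    · exact mem_sphere_zero_iff_norm.2 h2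
  have hd : Disjoint U ((e ∘ f) '' sphere 0 1) :=
    (disjoint_compl_right (a := U)).mono_right (hUc ▸ image_mono hsphere)
  obtain ⟨Ψ, hΨc, hΨi, hΨb, hΨγ⟩ := exists_parametrization_of_frontier_subset hUopen hb hUconn
    (hUc ▸ isPreconnected_closedBall_sdiff_zero.image _ hkc) (hkc.mono hsphere)
    (hki.mono hsphere) hfr hd
  refine ⟨e.symm ∘ Ψ, hec.comp_continuousOn hΨc, fun z hz w hw h => hΨi hz hw ?_, ?_,
    fun z hz => ?_⟩
  · rw [← hes' (Ψ z), ← hes' (Ψ w)]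
    exact congrArg e h
  · rw [image_comp, hΨb, hUe]
    exact e.toPartialEquiv.symm_image_image_of_subset_source hWs
  · rw [Function.comp, hΨγ hz]
    exact e.left_inv (hm (hsphere hz))

end

theorem hasPlaneCharts_sphere : HasPlaneCharts (sphere (0 : EuclideanSpace ℝ (Fin 3)) 1) := by
  intro q
  have : Fact (Module.finrank ℝ (EuclideanSpace ℝ (Fin 3)) = 2 + 1) := ⟨by simp⟩
  refine ⟨(stereographic' 2 q).transHomeomorph
    Complex.orthonormalBasisOneI.repr.symm.toHomeomorph, ?_, ?_⟩ <;> simp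

/-- The projection of `ℝ³` to the plane of the first two coordinates, identified with `ℂ`. -/
def planeProj (v : EuclideanSpace ℝ (Fin 3)) : ℂ := ⟨v 0, v 1⟩

theorem continuous_planeProj : Continuous planeProj := by
  have : planeProj = fun v : EuclideanSpace ℝ (Fin 3) => (v 0 : ℂ) + (v 1 : ℂ) * Complex.I := by
    funext v
    exact (Complex.mk_eq_add_mul_I _ _)
  rw [this]
  fun_prop

theorem norm_planeProj_sq (v : EuclideanSpace ℝ (Fin 3)) :
    ‖planeProj v‖ ^ 2 + v 2 ^ 2 = ‖v‖ ^ 2 := by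
  rw [EuclideanSpace.norm_sq_eq, Fin.sum_univ_three, Complex.sq_norm, Complex.normSq_apply,
    planeProj]
  simp only [Real.norm_eq_abs, sq_abs]
  ring

theorem ext_planeProj {v w : EuclideanSpace ℝ (Fin 3)} (h : planeProj v = planeProj w)
    (h2 : v 2 = w 2) : v = w := by
  rw [planeProj, planeProj, Complex.mk.injEq] at h
  ext i
  fin_cases i
  exacts [h.1, h.2, h2]

theorem norm_planeProj_le (v : EuclideanSpace ℝ (Fin 3)) : ‖planeProj v‖ ≤ ‖v‖ :=
  (sq_le_sq₀ (norm_nonneg _) (norm_nonneg _)).1 (by nlinarith [norm_planeProj_sq v])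

/-- The point of `ℝ³` with given planar projection and last coordinate. -/
def spacePoint (z : ℂ) (s : ℝ) : EuclideanSpace ℝ (Fin 3) := !₂[z.re, z.im, s]

@[simp] theorem planeProj_spacePoint (z : ℂ) (s : ℝ) : planeProj (spacePoint z s) = z := rfl

@[simp] theorem spacePoint_two (z : ℂ) (s : ℝ) : spacePoint z s 2 = s := rfl

theorem continuous_spacePoint : Continuous fun p : ℂ × ℝ => spacePoint p.1 p.2 := by
  refine (PiLp.continuous_toLp 2 _).comp (continuous_pi fun i => ?_)
  fin_cases i
  exacts [Complex.continuous_re.comp continuous_fst, Complex.continuous_im.comp continuous_fst,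
    continuous_snd]

theorem norm_spacePoint_sq (z : ℂ) (s : ℝ) : ‖spacePoint z s‖ ^ 2 = ‖z‖ ^ 2 + s ^ 2 := by
  rw [← norm_planeProj_sq, planeProj_spacePoint, spacePoint_two]

/-- An embedded disk in the unit sphere is the image of the upper hemisphere under a
homeomorphism of the sphere. -/
theorem exists_sphere_extension {f : ℂ → sphere (0 : EuclideanSpace ℝ (Fin 3)) 1}
    (hf : ContinuousOn f (closedBall 0 1)) (hi : InjOn f (closedBall 0 1)) :
    ∃ F : EuclideanSpace ℝ (Fin 3) → EuclideanSpace ℝ (Fin 3), ContinuousOn F (sphere 0 1) ∧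
      InjOn F (sphere 0 1) ∧ MapsTo F (sphere 0 1) (sphere 0 1) ∧
      SurjOn F (sphere 0 1) (sphere 0 1) ∧ ∀ v, 0 ≤ v 2 → F v = f (planeProj v) := by
  obtain ⟨g, hgc, hgi, hgb, hgf⟩ := hasPlaneCharts_sphere.exists_complementary_disk hf hi
  have hsq : ∀ v ∈ sphere (0 : EuclideanSpace ℝ (Fin 3)) 1, ‖planeProj v‖ ^ 2 + v 2 ^ 2 = 1 :=
    fun v hv => by rw [norm_planeProj_sq, mem_sphere_zero_iff_norm.1 hv, one_pow]
  have hp : MapsTo planeProj (sphere 0 1) (closedBall 0 1) := fun v hv =>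
    mem_closedBall_zero_iff.2 ((norm_planeProj_le v).trans (mem_sphere_zero_iff_norm.1 hv).le)
  have hpb : ∀ v ∈ sphere (0 : EuclideanSpace ℝ (Fin 3)) 1, v 2 < 0 → planeProj v ∈ ball 0 1 :=
    fun v hv h => mem_ball_zero_iff.2 (by nlinarith [hsq v hv, norm_nonneg (planeProj v)])
  have hfg : ∀ z ∈ closedBall (0 : ℂ) 1, ∀ w ∈ ball (0 : ℂ) 1, f z ≠ g w := fun z hz w hw h =>
    (hgb.subset (mem_image_of_mem g hw)) (h ▸ mem_image_of_mem f hz)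
  set F : EuclideanSpace ℝ (Fin 3) → EuclideanSpace ℝ (Fin 3) := fun v =>
    if 0 ≤ v 2 then f (planeProj v) else g (planeProj v) with hF
  have hup : ∀ v, 0 ≤ v 2 → F v = f (planeProj v) := fun v hv => if_pos hv
  have hlow : ∀ v ∈ sphere (0 : EuclideanSpace ℝ (Fin 3)) 1, v 2 ≤ 0 → F v = g (planeProj v) := by
    intro v hv h
    rcases h.lt_or_eq with h | h
    · exact if_neg (not_le.2 h)
    · rw [hup v h.ge, hgf (mem_sphere_zero_iff_norm.2 _)]
      have := hsq v hv
      rw [h] at this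
      nlinarith [norm_nonneg (planeProj v)]
  have hc2 : Continuous fun v : EuclideanSpace ℝ (Fin 3) => v 2 := by fun_prop
  have hcomp : ∀ {k : ℂ → sphere (0 : EuclideanSpace ℝ (Fin 3)) 1},
      ContinuousOn k (closedBall 0 1) →
      ContinuousOn (fun v => (k (planeProj v) : EuclideanSpace ℝ (Fin 3))) (sphere 0 1) := fun hk =>
    continuous_subtype_val.comp_continuousOn (hk.comp continuous_planeProj.continuousOn hp)
  refine ⟨F, ?_, ?_, fun v _ => ?_, ?_, hup⟩
  · have h1 : sphere (0 : EuclideanSpace ℝ (Fin 3)) 1 =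
        (sphere 0 1 ∩ {v | 0 ≤ v 2}) ∪ (sphere 0 1 ∩ {v | v 2 ≤ 0}) := by
      rw [← inter_union_distrib_left, inter_eq_left.2]
      exact fun v _ => le_total 0 (v 2)
    rw [h1]
    refine ContinuousOn.union_of_isClosed ?_ ?_
      (isClosed_sphere.inter (isClosed_le continuous_const hc2))
      (isClosed_sphere.inter (isClosed_le hc2 continuous_const))
    · exact ((hcomp hf).mono inter_subset_left).congr fun v hv => hup v hv.2
    · exact ((hcomp hgc).mono inter_subset_left).congr fun v hv => hlow v hv.1 hv.2
  · intro v hv w hw h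
    rcases le_or_gt 0 (v 2) with h1 | h1 <;> rcases le_or_gt 0 (w 2) with h2 | h2
    · rw [hup v h1, hup w h2] at h
      have h3 := hi (hp hv) (hp hw) (Subtype.ext h)
      have := hsq v hv
      rw [h3, ← hsq w hw] at this
      exact ext_planeProj h3 ((sq_eq_sq₀ h1 h2).1 (add_left_cancel this))
    · rw [hup v h1, hlow w hw h2.le] at h
      exact absurd (Subtype.ext h) (hfg _ (hp hv) _ (hpb w hw h2))
    · rw [hlow v hv h1.le, hup w h2] at h
      exact absurd (Subtype.ext h.symm) (hfg _ (hp hw) _ (hpb v hv h1))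
    · rw [hlow v hv h1.le, hlow w hw h2.le] at h
      have h3 := hgi (hp hv) (hp hw) (Subtype.ext h)
      have := hsq v hv
      rw [h3, ← hsq w hw] at this
      exact ext_planeProj h3 (by nlinarith [add_left_cancel this])
  · rw [hF]
    dsimp only
    split_ifs <;> exact Subtype.prop _
  · intro y hy
    have hs : ∀ z ∈ closedBall (0 : ℂ) 1, ∀ s : ℝ, s ^ 2 = 1 - ‖z‖ ^ 2 →
        spacePoint z s ∈ sphere (0 : EuclideanSpace ℝ (Fin 3)) 1 := fun z hz s h => by
      rw [mem_sphere_zero_iff_norm, ← sq_eq_sq₀ (norm_nonneg _) zero_le_one, norm_spacePoint_sq, h]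
      ring
    have hnn : ∀ z ∈ closedBall (0 : ℂ) 1, 0 ≤ 1 - ‖z‖ ^ 2 := fun z hz => by
      nlinarith [mem_closedBall_zero_iff.1 hz, norm_nonneg z]
    by_cases hyf : (⟨y, hy⟩ : sphere (0 : EuclideanSpace ℝ (Fin 3)) 1) ∈ f '' closedBall 0 1
    · obtain ⟨z, hz, hzy⟩ := hyf
      refine ⟨spacePoint z √(1 - ‖z‖ ^ 2), hs z hz _ (Real.sq_sqrt (hnn z hz)), ?_⟩
      rw [hup _ (Real.sqrt_nonneg _), planeProj_spacePoint, hzy]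
    · obtain ⟨z, hz, hzy⟩ := hgb.superset hyf
      have hz' := ball_subset_closedBall hz
      have h1 := hs z hz' (-√(1 - ‖z‖ ^ 2)) (by rw [neg_sq, Real.sq_sqrt (hnn z hz')])
      refine ⟨_, h1, ?_⟩
      rw [hlow _ h1 (neg_nonpos.2 (Real.sqrt_nonneg _)), planeProj_spacePoint, hzy]

theorem exists_homeomorph_closedBall_extension
    {f : ℂ → sphere (0 : EuclideanSpace ℝ (Fin 3)) 1}
    (hf : ContinuousOn f (closedBall 0 1)) (hi : InjOn f (closedBall 0 1)) :
    ∃ H : closedBall (0 : EuclideanSpace ℝ (Fin 3)) 1 ≃ₜ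
        closedBall (0 : EuclideanSpace ℝ (Fin 3)) 1,
      ∀ v : closedBall (0 : EuclideanSpace ℝ (Fin 3)) 1, ‖(v : EuclideanSpace ℝ (Fin 3))‖ = 1 →
        0 ≤ (v : EuclideanSpace ℝ (Fin 3)) 2 →
        (H v : EuclideanSpace ℝ (Fin 3)) = f (planeProj v) := by
  obtain ⟨F, hFc, hFi, hFm, hFs, hFf⟩ := exists_sphere_extension hf hi
  have hmem : ∀ v, radialExtension F v ∈ closedBall (0 : EuclideanSpace ℝ (Fin 3)) 1 ↔
      v ∈ closedBall (0 : EuclideanSpace ℝ (Fin 3)) 1 := fun v => by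
    rw [mem_closedBall_zero_iff, norm_radialExtension hFm, mem_closedBall_zero_iff]
  let G : closedBall (0 : EuclideanSpace ℝ (Fin 3)) 1 →
      closedBall (0 : EuclideanSpace ℝ (Fin 3)) 1 :=
    fun v => ⟨radialExtension F v, (hmem v).2 v.2⟩
  have hG : Function.Bijective G := by
    refine ⟨fun v w h => Subtype.ext (injective_radialExtension hFm hFi (congrArg Subtype.val h)),
      fun w => ?_⟩
    obtain ⟨v, hv⟩ := surjective_radialExtension hFs (w : EuclideanSpace ℝ (Fin 3))
    exact ⟨⟨v, (hmem v).1 (hv ▸ w.2)⟩, Subtype.ext hv⟩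
  have hGc : Continuous G :=
    ((continuous_radialExtension hFm hFc).comp continuous_subtype_val).subtype_mk _
  refine ⟨Continuous.homeoOfEquivCompactToT2 (f := Equiv.ofBijective G hG) hGc, fun v hv h => ?_⟩
  exact (radialExtension_of_mem_sphere (mem_sphere_zero_iff_norm.2 hv)).trans (hFf v h)

section
variable {v w : EuclideanSpace ℝ (Fin 3)}

theorem one_sub_norm_planeProj_sq_nonneg (hv : ‖v‖ ≤ 1) : 0 ≤ 1 - ‖planeProj v‖ ^ 2 := by
  nlinarith [norm_planeProj_le v, norm_nonneg (planeProj v)]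

theorem abs_two_le_sqrt (hv : ‖v‖ ≤ 1) : |v 2| ≤ √(1 - ‖planeProj v‖ ^ 2) :=
  Real.abs_le_sqrt (by nlinarith [norm_planeProj_sq v, norm_nonneg v])

/-- For `ε = 1` and `ε = -1`, a homeomorphism of the unit ball onto its upper, respectively lower,
half, which maps the upper hemisphere onto the equatorial disk. -/
noncomputable def halfBallMap (ε : ℝ) (v : EuclideanSpace ℝ (Fin 3)) : EuclideanSpace ℝ (Fin 3) :=
  spacePoint (planeProj v) (ε * ((√(1 - ‖planeProj v‖ ^ 2) - v 2) / 2))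

@[simp] theorem planeProj_halfBallMap (ε : ℝ) (v : EuclideanSpace ℝ (Fin 3)) :
    planeProj (halfBallMap ε v) = planeProj v := rfl

theorem continuous_halfBallMap (ε : ℝ) : Continuous (halfBallMap ε) := by
  have := continuous_planeProj
  exact continuous_spacePoint.comp (continuous_planeProj.prodMk (by fun_prop))

theorem norm_spacePoint_le {z : ℂ} {s : ℝ} (hz : 0 ≤ 1 - ‖z‖ ^ 2) (hs : |s| ≤ √(1 - ‖z‖ ^ 2)) :
    ‖spacePoint z s‖ ≤ 1 := by
  have h1 := norm_spacePoint_sq z s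
  have h2 := Real.sq_sqrt hz
  have h3 := sq_abs s
  exact (sq_le_sq₀ (norm_nonneg _) zero_le_one).1 (by nlinarith [abs_nonneg s])

theorem norm_halfBallMap_le {ε : ℝ} (hε : |ε| = 1) (hv : ‖v‖ ≤ 1) : ‖halfBallMap ε v‖ ≤ 1 := by
  have h := abs_le.1 (abs_two_le_sqrt hv)
  refine norm_spacePoint_le (one_sub_norm_planeProj_sq_nonneg hv) ?_
  rw [abs_mul, hε, one_mul, abs_le]
  constructor <;> linarith

theorem injective_halfBallMap {ε : ℝ} (hε : ε ≠ 0) : Function.Injective (halfBallMap ε) := by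
  intro v w h
  have h1 : planeProj v = planeProj w := by
    rw [← planeProj_halfBallMap ε v, h, planeProj_halfBallMap]
  have h2 := congrArg (fun u : EuclideanSpace ℝ (Fin 3) => u 2) h
  simp only [halfBallMap, spacePoint_two, h1] at h2
  exact ext_planeProj h1 (by linarith [mul_left_cancel₀ hε h2])

theorem exists_halfBallMap_eq {ε : ℝ} (hε : ε * ε = 1) (hw : ‖w‖ ≤ 1) (h : 0 ≤ ε * w 2) :
    ∃ v, ‖v‖ ≤ 1 ∧ halfBallMap ε v = w := by
  have hle : ε * w 2 ≤ √(1 - ‖planeProj w‖ ^ 2) := by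
    have h1 : |ε * w 2| = |w 2| := by
      rw [abs_mul, (sq_eq_sq₀ (abs_nonneg ε) zero_le_one).1 (by rw [sq_abs, sq, hε, one_pow]),
        one_mul]
    exact (le_abs_self _).trans (h1 ▸ abs_two_le_sqrt hw)
  refine ⟨spacePoint (planeProj w) (√(1 - ‖planeProj w‖ ^ 2) - 2 * (ε * w 2)),
    norm_spacePoint_le (one_sub_norm_planeProj_sq_nonneg hw) ?_, ext_planeProj rfl ?_⟩
  · rw [abs_le]
    constructor <;> linarith
  · rw [halfBallMap, planeProj_spacePoint, spacePoint_two, spacePoint_two]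
    linear_combination w 2 * hε

theorem halfBallMap_two_nonneg {ε : ℝ} (hε : ε * ε = 1) (hv : ‖v‖ ≤ 1) :
    0 ≤ ε * halfBallMap ε v 2 := by
  rw [halfBallMap, spacePoint_two, ← mul_assoc, hε]
  linarith [(le_abs_self _).trans (abs_two_le_sqrt hv)]

theorem halfBallMap_two_eq_zero_iff {ε : ℝ} (hε : ε ≠ 0) (hv : ‖v‖ ≤ 1) :
    halfBallMap ε v 2 = 0 ↔ ‖v‖ = 1 ∧ 0 ≤ v 2 := by
  have h1 := one_sub_norm_planeProj_sq_nonneg hv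
  have h2 := norm_planeProj_sq v
  rw [halfBallMap, spacePoint_two, mul_eq_zero, or_iff_right hε, div_eq_zero_iff,
    or_iff_left two_ne_zero, sub_eq_zero]
  refine ⟨fun h => ⟨?_, h ▸ Real.sqrt_nonneg _⟩, fun h => ?_⟩
  · have h3 := Real.sq_sqrt h1
    rw [h] at h3
    exact (sq_eq_sq₀ (norm_nonneg _) zero_le_one).1 (by linarith)
  · rw [h.1] at h2
    rw [← Real.sqrt_sq h.2]
    congr 1
    linarith

end

theorem exists_disk_parametrization {Y : Type*} [TopologicalSpace Y]
    (e : Y ≃ₜ closedBall (0 : EuclideanSpace ℝ (Fin 2)) 1) :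
    ∃ d : ℂ → Y, Continuous d ∧ InjOn d (closedBall 0 1) ∧ ∀ y, ∃ z ∈ closedBall (0 : ℂ) 1,
      d z = y := by
  set l := Complex.orthonormalBasisOneI.repr with hl
  have hmem : ∀ z, (max 1 ‖z‖)⁻¹ • l z ∈ closedBall (0 : EuclideanSpace ℝ (Fin 2)) 1 := fun z => by
    have hpos : 0 < max 1 ‖z‖ := one_pos.trans_le (le_max_left _ _)
    rw [mem_closedBall_zero_iff, norm_smul, l.norm_map, norm_inv, Real.norm_of_nonneg hpos.le,
      inv_mul_le_one₀ hpos]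
    exact le_max_right _ _
  have hval : ∀ z ∈ closedBall (0 : ℂ) 1, (max 1 ‖z‖)⁻¹ • l z = l z := fun z hz => by
    rw [max_eq_left (mem_closedBall_zero_iff.1 hz), inv_one, one_smul]
  refine ⟨fun z => e.symm ⟨_, hmem z⟩, e.symm.continuous.comp (Continuous.subtype_mk ?_ _),
    fun z hz w hw h => ?_, fun y => ?_⟩
  · exact ((continuous_const.max continuous_norm).inv₀ fun z =>
      (one_pos.trans_le (le_max_left _ _)).ne').smul l.continuous
  · have h1 := congrArg Subtype.val (e.symm.injective h)
    simp only [hval z hz, hval w hw] at h1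
    exact l.injective h1
  · have h1 : l.symm (e y) ∈ closedBall (0 : ℂ) 1 := by
      rw [mem_closedBall_zero_iff, l.symm.norm_map]
      exact mem_closedBall_zero_iff.1 (e y).2
    refine ⟨_, h1, e.symm_apply_eq.2 (Subtype.ext ?_)⟩
    dsimp only
    rw [hval _ h1, l.apply_symm_apply]

theorem exists_homeomorph_closedBall_normalized {B Y : Type*} [TopologicalSpace B]
    [TopologicalSpace Y] (h : B ≃ₜ closedBall (0 : EuclideanSpace ℝ (Fin 3)) 1) {i : Y → B}
    (hi : Continuous i) (hinj : Function.Injective i)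
    (hs : ∀ y, (h (i y) : EuclideanSpace ℝ (Fin 3)) ∈ sphere (0 : EuclideanSpace ℝ (Fin 3)) 1)
    {d : ℂ → Y} (hd : Continuous d) (hdi : InjOn d (closedBall 0 1)) :
    ∃ h' : B ≃ₜ closedBall (0 : EuclideanSpace ℝ (Fin 3)) 1, ∀ z ∈ closedBall (0 : ℂ) 1,
      ‖(h' (i (d z)) : EuclideanSpace ℝ (Fin 3))‖ = 1 ∧
      0 ≤ (h' (i (d z)) : EuclideanSpace ℝ (Fin 3)) 2 ∧
      planeProj (h' (i (d z))) = z := by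
  have hfc : Continuous fun z =>
      (⟨h (i (d z)), hs (d z)⟩ : sphere (0 : EuclideanSpace ℝ (Fin 3)) 1) :=
    (continuous_subtype_val.comp (h.continuous.comp (hi.comp hd))).subtype_mk _
  obtain ⟨H, hH⟩ := exists_homeomorph_closedBall_extension hfc.continuousOn
    fun z hz w hw hzw => hdi hz hw (hinj (h.injective (Subtype.ext (Subtype.mk.inj hzw))))
  refine ⟨h.trans H.symm, fun z hz => ?_⟩
  have hz' : 0 ≤ 1 - ‖z‖ ^ 2 := by
    nlinarith [mem_closedBall_zero_iff.1 hz, norm_nonneg z]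
  obtain ⟨v, hv, hvn, hv2⟩ : ∃ v, planeProj v = z ∧ ‖v‖ = 1 ∧ 0 ≤ v 2 := by
    refine ⟨spacePoint z √(1 - ‖z‖ ^ 2), rfl, ?_, Real.sqrt_nonneg _⟩
    rw [← sq_eq_sq₀ (norm_nonneg _) zero_le_one, norm_spacePoint_sq, Real.sq_sqrt hz']
    ring
  have h1 : (h.trans H.symm) (i (d z)) = ⟨v, mem_closedBall_zero_iff.2 hvn.le⟩ := by
    have h2 : H ⟨v, mem_closedBall_zero_iff.2 hvn.le⟩ = h (i (d z)) := by
      refine Subtype.ext ((hH ⟨v, mem_closedBall_zero_iff.2 hvn.le⟩ hvn hv2).trans ?_)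
      rw [hv]
    rw [Homeomorph.trans_apply, ← h2, Homeomorph.symm_apply_apply]
  rw [h1]
  exact ⟨hvn, hv2, hv⟩

theorem eq_of_planeProj_eq {v w : EuclideanSpace ℝ (Fin 3)} (h : planeProj v = planeProj w)
    (hv : ‖v‖ = 1) (hw : ‖w‖ = 1) (hv2 : 0 ≤ v 2) (hw2 : 0 ≤ w 2) : v = w := by
  refine ext_planeProj h ((sq_eq_sq₀ hv2 hw2).1 ?_)
  have h1 := norm_planeProj_sq v
  have h2 := norm_planeProj_sq w
  rw [hv] at h1
  rw [hw, ← h] at h2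
  linarith

/-- **Ball combination.** Let `D³` be the closed unit ball in `ℝ³`, `S²` its boundary
sphere, and `D²` the closed unit disk in `ℝ²`. Let `X` be a Hausdorff space with closed
subsets `B₁` and `B₂` such that `X = B₁ ∪ B₂`, and suppose there are homeomorphisms
`h₁ : B₁ ≃ₜ D³` and `h₂ : B₂ ≃ₜ D³` carrying `B₁ ∩ B₂` into `S²`, with `B₁ ∩ B₂`
homeomorphic to `D²`. Then `X` is homeomorphic to `D³`. -/
theorem union_of_balls_along_boundary_disk
    (X : Type) [TopologicalSpace X] [T2Space X]
    (B₁ B₂ : Set X) (hB₁ : IsClosed B₁) (hB₂ : IsClosed B₂) (hX : B₁ ∪ B₂ = Set.univ)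
    (h₁ : ↥B₁ ≃ₜ ↥(Metric.closedBall (0 : EuclideanSpace ℝ (Fin 3)) 1))
    (h₂ : ↥B₂ ≃ₜ ↥(Metric.closedBall (0 : EuclideanSpace ℝ (Fin 3)) 1))
    (hb₁ : ∀ x : B₁, (x : X) ∈ B₂ →
      (h₁ x : EuclideanSpace ℝ (Fin 3)) ∈ Metric.sphere (0 : EuclideanSpace ℝ (Fin 3)) 1)
    (hb₂ : ∀ x : B₂, (x : X) ∈ B₁ →
      (h₂ x : EuclideanSpace ℝ (Fin 3)) ∈ Metric.sphere (0 : EuclideanSpace ℝ (Fin 3)) 1)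
    (hdisk : Nonempty (↥(B₁ ∩ B₂) ≃ₜ ↥(Metric.closedBall (0 : EuclideanSpace ℝ (Fin 2)) 1))) :
    Nonempty (X ≃ₜ ↥(Metric.closedBall (0 : EuclideanSpace ℝ (Fin 3)) 1)) := by
  classical
  obtain ⟨e⟩ := hdisk
  obtain ⟨d, hd, hdi, hds⟩ := exists_disk_parametrization e
  obtain ⟨k₁, hk₁⟩ := exists_homeomorph_closedBall_normalized h₁
    (continuous_inclusion inter_subset_left) (inclusion_injective inter_subset_left)
    (fun y => hb₁ _ y.2.2) hd hdi
  obtain ⟨k₂, hk₂⟩ := exists_homeomorph_closedBall_normalized h₂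
    (continuous_inclusion inter_subset_right) (inclusion_injective inter_subset_right)
    (fun y => hb₂ _ y.2.1) hd hdi
  have hX' : ∀ x, x ∉ B₁ → x ∈ B₂ := fun x hx => (hX.superset (mem_univ x)).resolve_left hx
  have hn : ∀ v : closedBall (0 : EuclideanSpace ℝ (Fin 3)) 1,
      ‖(v : EuclideanSpace ℝ (Fin 3))‖ ≤ 1 := fun v => mem_closedBall_zero_iff.1 v.2
  have hm : (-1 : ℝ) ≠ 0 := by norm_num
  have hmm : (-1 : ℝ) * -1 = 1 := by norm_num
  set Φ : X → EuclideanSpace ℝ (Fin 3) := fun x =>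
    if hx : x ∈ B₁ then halfBallMap 1 (k₁ ⟨x, hx⟩) else halfBallMap (-1) (k₂ ⟨x, hX' x hx⟩) with hΦ
  have hΦ₁ : ∀ x (hx : x ∈ B₁), Φ x = halfBallMap 1 (k₁ ⟨x, hx⟩) := fun x hx => dif_pos hx
  have hΦ₂ : ∀ x (hx : x ∈ B₂), Φ x = halfBallMap (-1) (k₂ ⟨x, hx⟩) := by
    intro x hx
    by_cases hx1 : x ∈ B₁
    · rw [hΦ₁ x hx1]
      obtain ⟨z, hz, hzx⟩ := hds ⟨x, hx1, hx⟩
      have h3 := hk₁ z hz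
      have h4 := hk₂ z hz
      rw [hzx] at h3 h4
      refine ext_planeProj (h3.2.2.trans h4.2.2.symm) ?_
      rw [(halfBallMap_two_eq_zero_iff one_ne_zero (hn _)).2 ⟨h3.1, h3.2.1⟩]
      exact ((halfBallMap_two_eq_zero_iff hm (hn _)).2 ⟨h4.1, h4.2.1⟩).symm
    · exact dif_neg hx1
  have hmem : ∀ x, Φ x ∈ closedBall (0 : EuclideanSpace ℝ (Fin 3)) 1 := fun x => by
    rw [hΦ]
    dsimp only
    split_ifs <;> exact mem_closedBall_zero_iff.2 (norm_halfBallMap_le (by simp) (hn _))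
  have hcont : Continuous Φ := by
    rw [← continuousOn_univ, ← hX]
    refine ContinuousOn.union_of_isClosed ?_ ?_ hB₁ hB₂ <;>
      rw [continuousOn_iff_continuous_domRestrict]
    · exact ((continuous_halfBallMap 1).comp (continuous_subtype_val.comp k₁.continuous)).congr
        fun x => (hΦ₁ x x.2).symm
    · exact ((continuous_halfBallMap (-1)).comp (continuous_subtype_val.comp k₂.continuous)).congr
        fun x => (hΦ₂ x x.2).symm
  have hcross : ∀ x ∈ B₁, ∀ y ∈ B₂, Φ x = Φ y → x = y := by
    intro x hx y hy h
    have h5 := halfBallMap_two_nonneg (one_mul 1) (hn (k₁ ⟨x, hx⟩))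
    have h6 := halfBallMap_two_nonneg hmm (hn (k₂ ⟨y, hy⟩))
    have h7 : planeProj (k₁ ⟨x, hx⟩) = planeProj (k₂ ⟨y, hy⟩) := by
      rw [← planeProj_halfBallMap 1, ← hΦ₁ x hx, h, hΦ₂ y hy, planeProj_halfBallMap]
    rw [← hΦ₁ x hx] at h5
    rw [← hΦ₂ y hy, ← h] at h6
    have h0 : Φ x 2 = 0 := by linarith
    have hx0 := (halfBallMap_two_eq_zero_iff one_ne_zero (hn _)).1 (hΦ₁ x hx ▸ h0)
    have hy0 := (halfBallMap_two_eq_zero_iff hm (hn _)).1 (hΦ₂ y hy ▸ h ▸ h0)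
    have hz : planeProj (k₁ ⟨x, hx⟩) ∈ closedBall (0 : ℂ) 1 :=
      mem_closedBall_zero_iff.2 ((norm_planeProj_le _).trans (hn _))
    have h3 := hk₁ _ hz
    have h4 := hk₂ _ hz
    have hx1 := k₁.injective (Subtype.ext
      (eq_of_planeProj_eq h3.2.2 h3.1 hx0.1 h3.2.1 hx0.2))
    have hy1 := k₂.injective (Subtype.ext
      (eq_of_planeProj_eq (h4.2.2.trans h7) h4.1 hy0.1 h4.2.1 hy0.2))
    exact (congrArg Subtype.val hx1).symm.trans (congrArg Subtype.val hy1)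
  have hinj : Function.Injective Φ := by
    intro x y h
    by_cases hx : x ∈ B₁ <;> by_cases hy : y ∈ B₁
    · rw [hΦ₁ x hx, hΦ₁ y hy] at h
      exact congrArg Subtype.val
        (k₁.injective (Subtype.ext (injective_halfBallMap one_ne_zero h)))
    · exact hcross x hx y (hX' y hy) h
    · exact (hcross y hy x (hX' x hx) h.symm).symm
    · rw [hΦ₂ x (hX' x hx), hΦ₂ y (hX' y hy)] at h
      exact congrArg Subtype.val (k₂.injective (Subtype.ext (injective_halfBallMap hm h)))
  have hsurj : ∀ w ∈ closedBall (0 : EuclideanSpace ℝ (Fin 3)) 1, ∃ x, Φ x = w := by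
    intro w hw
    rw [mem_closedBall_zero_iff] at hw
    rcases le_total 0 (w 2) with h | h
    · obtain ⟨v, hv, rfl⟩ := exists_halfBallMap_eq (one_mul 1) hw (by rwa [one_mul])
      exact ⟨k₁.symm ⟨v, mem_closedBall_zero_iff.2 hv⟩, by
        rw [hΦ₁ _ (Subtype.prop _), Subtype.coe_eta, k₁.apply_symm_apply]⟩
    · obtain ⟨v, hv, rfl⟩ := exists_halfBallMap_eq hmm hw (by linarith)
      exact ⟨k₂.symm ⟨v, mem_closedBall_zero_iff.2 hv⟩, by
        rw [hΦ₂ _ (Subtype.prop _), Subtype.coe_eta, k₂.apply_symm_apply]⟩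
  have hcomp : CompactSpace X := by
    have hc₁ : CompactSpace B₁ := h₁.symm.compactSpace
    have hc₂ : CompactSpace B₂ := h₂.symm.compactSpace
    exact ⟨hX ▸ (isCompact_iff_compactSpace.2 hc₁).union (isCompact_iff_compactSpace.2 hc₂)⟩
  exact ⟨Continuous.homeoOfEquivCompactToT2 (f := Equiv.ofBijective
    (fun x => (⟨Φ x, hmem x⟩ : closedBall (0 : EuclideanSpace ℝ (Fin 3)) 1))
    ⟨fun x y h => hinj (congrArg Subtype.val h), fun w => (hsurj w w.2).imp fun x hx =>
      Subtype.ext hx⟩) (hcont.subtype_mk hmem)⟩
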